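/- For each partition λ of n, let e_λ = ∑_{I ∈ S_λ} e_I, where S_λ = {I ⊆ S : W_I is conjugate to W_λ in S_n}, and let E_λ = e_λ ℂS_n. Let φ̃_λ : Z_{S_n}(c_λ) → ℂˣ be the linear character with φ̃_λ|_{Z_λ} = φ_λ and φ̃_λ|_{N_λ} = 1, and set f̃_λ = (1/|Z_{S_n}(c_λ)|) ∑_{z ∈ Z_{S_n}(c_λ)} φ̃_λ(z) z⁻¹ ∈ ℂS_n (so that the right ℂS_n-module f̃_λ ℂS_n affords Ind_{Z_{S_n}(c_λ)}^{S_n}(φ̃_λ)). Then E_λ and f̃_λ ℂS_n are isomorphic as right ℂS_n-modules; i.e., the character of E_λ is Ind_{Z_{S_n}(c_λ)}^{S_n}(φ̃_λ). Consequently, since 1 = ∑_{λ ⊢ n} e_λ with the e_λ pairwise orthogonal idempotents, ℂS_n = ⨁_{λ ⊢ n} E_λ ≅ ⨁_{λ ⊢ n} f̃_λ ℂS_n: the regular representation of S_n decomposes as a direct sum of representations induced from linear characters of centralizers, one for each conjugacy class. -/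

import Mathlib

open scoped Classical
open MonoidAlgebra Finset Equiv

noncomputable section

namespace DPRSym

variable (n : ℕ)

/-- The simple reflection `s_i` (1-based, `1 ≤ i ≤ n-1`) of the symmetric group
`S_n = Perm (Fin n)`: the transposition of the (0-based) points `i-1` and `i`. -/
def sgen (i : ℕ) : Equiv.Perm (Fin n) :=
  if h : 0 < i ∧ i < n then Equiv.swap ⟨i - 1, by omega⟩ ⟨i, h.2⟩ else 1

/-- The Coxeter generating set `S = {s_1, …, s_{n-1}}` of `S_n`. -/
def Simples : Finset (Equiv.Perm (Fin n)) := (Finset.Icc 1 (n - 1)).image (sgen n)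

/-- The Coxeter length of a permutation: the length of a shortest word in the
generators `S` expressing it. -/
def len (w : Equiv.Perm (Fin n)) : ℕ :=
  sInf {k | ∃ L : List (Equiv.Perm (Fin n)),
    (∀ x ∈ L, x ∈ Simples n) ∧ L.length = k ∧ L.prod = w}

/-- The `i`-cycle `c_i = s_{i-1} ⋯ s_2 s_1` (with `c_1 = 1`). -/
def cgen (i : ℕ) : Equiv.Perm (Fin n) :=
  (((List.range (i - 1)).reverse).map (fun j => sgen n (j + 1))).prod

/-- The set `W^I` of minimal length left coset representatives of `W_I`,
computed inside the subset `H` (take `H = Set.univ` for the absolute case). -/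
def minCoset (H : Set (Equiv.Perm (Fin n))) (I : Finset (Equiv.Perm (Fin n))) :
    Finset (Equiv.Perm (Fin n)) :=
  Finset.univ.filter (fun w => w ∈ H ∧ ∀ s ∈ I, len n w < len n (w * s))

/-- The element `x_I = ∑_{w ∈ W^I} w` of the group algebra. -/
def xRel (H : Set (Equiv.Perm (Fin n))) (I : Finset (Equiv.Perm (Fin n))) :
    MonoidAlgebra ℂ (Equiv.Perm (Fin n)) :=
  ∑ w ∈ minCoset n H I, of ℂ (Equiv.Perm (Fin n)) w

/-- `w(Δ_J) ⊆ Δ_D`: for every `s ∈ J`, `wsw⁻¹ ∈ D` and `ℓ(ws) = ℓ(w) + 1`. -/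
def Takes (D : Finset (Equiv.Perm (Fin n))) (w : Equiv.Perm (Fin n))
    (J : Finset (Equiv.Perm (Fin n))) : Prop :=
  ∀ s ∈ J, w * s * w⁻¹ ∈ D ∧ len n (w * s) = len n w + 1

/-- `ᵂJ = wJw⁻¹`. -/
def conjF (w : Equiv.Perm (Fin n)) (J : Finset (Equiv.Perm (Fin n))) :
    Finset (Equiv.Perm (Fin n)) :=
  J.image (fun s => w * s * w⁻¹)

/-- The coefficient `m_{JK}` (for `σ ≡ 1`: the number of `w ∈ W^K` with
`w(Δ_J) ⊆ Δ`), relative to the pair `(H, D)`. -/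
def mC (H : Set (Equiv.Perm (Fin n))) (D : Finset (Equiv.Perm (Fin n)))
    (J K : Finset (Equiv.Perm (Fin n))) : ℕ :=
  if J ⊆ K then ((minCoset n H K).filter (fun w => Takes n D w J)).card else 0

/-- The family `(e_J)` of BBHT quasi-idempotents for `σ ≡ 1`, relative to `(H, D)`:
the unique solution of the triangular system `x_K = ∑_{J ⊆ K} m_{JK} e_J`, `K ⊆ D`. -/
def IsBBHT (H : Set (Equiv.Perm (Fin n))) (D : Finset (Equiv.Perm (Fin n)))
    (e : Finset (Equiv.Perm (Fin n)) → MonoidAlgebra ℂ (Equiv.Perm (Fin n))) : Prop :=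
  ∀ K ∈ D.powerset, xRel n H K = ∑ J ∈ K.powerset, (mC n H D J K : ℂ) • e J

/-- `b⁺(m, k)`: the coefficient of `t^k` in `(1 - c_1 t)(1 - c_2 t) ⋯ (1 - c_m t)`,
a polynomial with coefficients in the group algebra `ℂ S_n`. -/
def bplus (m k : ℕ) : MonoidAlgebra ℂ (Equiv.Perm (Fin n)) :=
  (((List.range m).map (fun i =>
      1 - Polynomial.C (of ℂ (Equiv.Perm (Fin n)) (cgen n (i + 1))) * Polynomial.X)).prod).coeff k

/-- The transposition of the 0-based points `a` and `b` (junk value `1` if out of range). -/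
def fswap (a b : ℕ) : Equiv.Perm (Fin n) :=
  if h : a < n ∧ b < n then Equiv.swap ⟨a, h.1⟩ ⟨b, h.2⟩ else 1

/-- Partial sums `τ_i = λ_1 + ⋯ + λ_i` of a partition. -/
def tau (lam : ℕ → ℕ) (i : ℕ) : ℕ := ∑ j ∈ Finset.range i, lam j

/-- `g_{λ_i} = s_{τ_i − 1} ⋯ s_{τ_{i−1}+2} s_{τ_{i−1}+1}`, a `λ_i`-cycle
(0-based block index `i`). -/
def gblock (lam : ℕ → ℕ) (i : ℕ) : Equiv.Perm (Fin n) :=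
  (((List.range (lam i - 1)).reverse).map (fun j => sgen n (tau lam i + j + 1))).prod

/-- `c_λ = g_{λ_1} g_{λ_2} ⋯ g_{λ_p}`, a permutation of cycle type `λ`. -/
def cpart (p : ℕ) (lam : ℕ → ℕ) : Equiv.Perm (Fin n) :=
  ((List.range p).map (gblock n lam)).prod

/-- `Z_λ = Z_{W_λ}(c_λ) = ⟨g_{λ_1}⟩ × ⋯ × ⟨g_{λ_p}⟩`. -/
def Zpart (p : ℕ) (lam : ℕ → ℕ) : Subgroup (Equiv.Perm (Fin n)) :=
  Subgroup.closure {x | ∃ i < p, x = gblock n lam i}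

/-- The involution `r_i` interchanging the `i`-th and `(i+1)`-st blocks
(when `λ_i = λ_{i+1}`). -/
def rgen (lam : ℕ → ℕ) (i : ℕ) : Equiv.Perm (Fin n) :=
  ((List.range (lam i)).map
    (fun j => fswap n (tau lam i + j) (tau lam (i + 1) + j))).prod

/-- `N_λ = ⟨r_i : λ_i = λ_{i+1}⟩`. -/
def Npart (p : ℕ) (lam : ℕ → ℕ) : Subgroup (Equiv.Perm (Fin n)) :=
  Subgroup.closure {x | ∃ i, i + 1 < p ∧ lam i = lam (i + 1) ∧ x = rgen n lam i}

/-- `f⁺_λ = f⁺_{λ_1} ⋯ f⁺_{λ_p}` where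
`f⁺_{λ_i} = (1/λ_i) ∑_{k=0}^{λ_i−1} e^{−2πik/λ_i} g_{λ_i}^{−k}`. -/
def fplusPart (p : ℕ) (lam : ℕ → ℕ) : MonoidAlgebra ℂ (Equiv.Perm (Fin n)) :=
  ((List.range p).map (fun i =>
    ((lam i : ℂ))⁻¹ • ∑ k ∈ Finset.range (lam i),
      Complex.exp (-(2 * (Real.pi : ℂ) * Complex.I) * (k : ℂ) / (lam i : ℂ)) •
        of ℂ (Equiv.Perm (Fin n)) ((gblock n lam i)⁻¹ ^ k))).prod

/-- `f⁻_λ = f⁻_{λ_1} ⋯ f⁻_{λ_p}` where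
`f⁻_{λ_i} = (1/λ_i) ∑_{k=0}^{λ_i−1} ε(g_{λ_i})^k e^{−2πik/λ_i} g_{λ_i}^{−k}`. -/
def fminusPart (p : ℕ) (lam : ℕ → ℕ) : MonoidAlgebra ℂ (Equiv.Perm (Fin n)) :=
  ((List.range p).map (fun i =>
    ((lam i : ℂ))⁻¹ • ∑ k ∈ Finset.range (lam i),
      ((((Equiv.Perm.sign (gblock n lam i) : ℤ) : ℂ)) ^ k *
        Complex.exp (-(2 * (Real.pi : ℂ) * Complex.I) * (k : ℂ) / (lam i : ℂ))) •
        of ℂ (Equiv.Perm (Fin n)) ((gblock n lam i)⁻¹ ^ k))).prod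

/-- Two subsets of `S` have the same shape if the parabolic subgroups they
generate are conjugate. -/
def ShapeEq (I J : Finset (Equiv.Perm (Fin n))) : Prop :=
  ∃ w : Equiv.Perm (Fin n),
    Subgroup.closure (J : Set (Equiv.Perm (Fin n))) =
      Subgroup.map (MulAut.conj w).toMonoidHom
        (Subgroup.closure (I : Set (Equiv.Perm (Fin n))))

section

variable {n}

/-- The inversions of a permutation. -/
def invs (w : Perm (Fin n)) : Finset (Fin n × Fin n) :=
  univ.filter fun q => q.1 < q.2 ∧ w q.2 < w q.1

lemma mem_invs {w : Perm (Fin n)} {a b : Fin n} : (a, b) ∈ invs w ↔ a < b ∧ w b < w a := by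
  simp [invs]

lemma invs_one : invs (1 : Perm (Fin n)) = ∅ := by
  ext ⟨a, b⟩
  rw [mem_invs]
  simpa using fun h : a < b => h.le

lemma sgen_succ {i : ℕ} (h : i + 1 < n) :
    sgen n (i + 1) = swap ⟨i, by omega⟩ ⟨i + 1, h⟩ := by
  simp [sgen, h]

lemma sgen_mul_self (i : ℕ) : sgen n i * sgen n i = 1 := by
  unfold sgen; split_ifs <;> simp

lemma sgen_inv (i : ℕ) : (sgen n i)⁻¹ = sgen n i := by
  rw [inv_eq_iff_mul_eq_one, sgen_mul_self]

lemma mem_Simples {s : Perm (Fin n)} :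
    s ∈ Simples n ↔ ∃ i, i + 1 < n ∧ sgen n (i + 1) = s := by
  simp only [Simples, Finset.mem_image, Finset.mem_Icc]
  constructor
  · rintro ⟨i, hi, rfl⟩
    exact ⟨i - 1, by omega, by congr 1; omega⟩
  · rintro ⟨i, hi, rfl⟩
    exact ⟨i + 1, by omega, rfl⟩

lemma sgen_mem_Simples {i : ℕ} (h : i + 1 < n) : sgen n (i + 1) ∈ Simples n :=
  mem_Simples.2 ⟨i, h, rfl⟩

lemma swap_succ_lt_iff {i : ℕ} (h : i + 1 < n) {a b : Fin n}
    (h1 : ¬ (a.1 = i ∧ b.1 = i + 1)) (h2 : ¬ (a.1 = i + 1 ∧ b.1 = i)) :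
    sgen n (i + 1) a < sgen n (i + 1) b ↔ a < b := by
  rw [sgen_succ h]
  simp only [swap_apply_def, Fin.ext_iff]
  split_ifs <;> simp only [Fin.lt_def] <;> omega

lemma card_invs_mul {w : Perm (Fin n)} {i : ℕ} (h : i + 1 < n)
    (hw : w ⟨i, by omega⟩ < w ⟨i + 1, h⟩) :
    (invs (w * sgen n (i + 1))).card = (invs w).card + 1 := by
  set s := sgen n (i + 1) with hs
  have hsi : s ⟨i, by omega⟩ = ⟨i + 1, h⟩ := by rw [hs, sgen_succ h, swap_apply_left]
  have hsj : s ⟨i + 1, h⟩ = ⟨i, by omega⟩ := by rw [hs, sgen_succ h, swap_apply_right]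
  have hss : ∀ a, s (s a) = a := fun a => by
    rw [← Perm.mul_apply, hs, sgen_mul_self, Perm.one_apply]
  have key : invs (w * s) = insert (⟨i, by omega⟩, ⟨i + 1, h⟩)
      ((invs w).map (s.prodCongr s).toEmbedding) := by
    ext ⟨a, b⟩
    simp only [mem_invs, mem_insert, Finset.mem_map, Prod.exists, Perm.mul_apply, Prod.mk.injEq]
    constructor
    · rintro ⟨h1, h2⟩
      by_cases hab : a.1 = i ∧ b.1 = i + 1
      · left; exact ⟨Fin.ext hab.1, Fin.ext hab.2⟩
      · right
        refine ⟨s a, s b, ⟨?_, h2⟩, by simp [hss]⟩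
        exact (swap_succ_lt_iff h hab (by rintro ⟨h3, h4⟩; rw [Fin.lt_def] at h1; omega)).2 h1
    · rintro (⟨rfl, rfl⟩ | ⟨c, d, ⟨h1, h2⟩, h3⟩)
      · rw [hsi, hsj]; exact ⟨by simp, hw⟩
      · simp only [Equiv.coe_toEmbedding, Equiv.prodCongr_apply, Prod.map_apply,
          Prod.mk.injEq] at h3
        obtain ⟨rfl, rfl⟩ := h3
        rw [hss, hss]
        refine ⟨(swap_succ_lt_iff h ?_ ?_).2 h1, h2⟩
        · rintro ⟨h3, h4⟩
          have e1 : c = ⟨i, by omega⟩ := Fin.ext h3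
          have e2 : d = ⟨i + 1, h⟩ := Fin.ext h4
          rw [congrArg w e1, congrArg w e2] at h2
          exact absurd h2 (not_lt.2 hw.le)
        · rintro ⟨h3, h4⟩
          rw [Fin.lt_def] at h1; omega
  rw [key, card_insert_of_notMem, card_map]
  simp only [Finset.mem_map, Prod.exists, not_exists, not_and]
  intro c d hcd h3
  simp only [Equiv.coe_toEmbedding, Equiv.prodCongr_apply, Prod.map_apply, Prod.mk.injEq] at h3
  rw [mem_invs] at hcd
  have e1 : c = ⟨i + 1, h⟩ := by rw [← hss c, h3.1, hsi]
  have e2 : d = ⟨i, by omega⟩ := by rw [← hss d, h3.2, hsj]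
  have := hcd.1
  simp [e1, e2] at this

lemma card_invs_mul' {w : Perm (Fin n)} {i : ℕ} (h : i + 1 < n)
    (hw : w ⟨i + 1, h⟩ < w ⟨i, by omega⟩) :
    (invs (w * sgen n (i + 1))).card + 1 = (invs w).card := by
  have := card_invs_mul (w := w * sgen n (i + 1)) h (by simpa [sgen_succ h] using hw)
  rw [mul_assoc, sgen_mul_self, mul_one] at this
  exact this.symm

lemma exists_word_card_invs (w : Perm (Fin n)) : ∃ L : List (Perm (Fin n)),
    (∀ x ∈ L, x ∈ Simples n) ∧ L.length = (invs w).card ∧ L.prod = w := by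
  induction hk : (invs w).card generalizing w with
  | zero =>
    refine ⟨[], by simp, rfl, ?_⟩
    have hmono : StrictMono w := by
      intro a b hab
      by_contra hc
      have hc' : w b < w a := lt_of_le_of_ne (not_lt.1 hc) (fun h => hab.ne (w.injective h).symm)
      have : (a, b) ∈ invs w := by simp [invs, hab, hc']
      rw [card_eq_zero.1 hk] at this
      simp at this
    have := (Perm.monotone_iff w).1 hmono.monotone
    simp [this]
  | succ k ih =>
    have : ∃ i, ∃ h : i + 1 < n, w ⟨i + 1, h⟩ < w ⟨i, by omega⟩ := by
      by_contra hc
      push Not at hc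
      have hmono : Monotone w := by
        rcases n with _ | n
        · intro a; exact a.elim0
        · exact Fin.monotone_iff_le_succ.2 fun i => hc i.1 (by omega)
      rw [(Perm.monotone_iff w).1 hmono] at hk
      rw [invs_one] at hk
      simp at hk
    obtain ⟨i, h, hw⟩ := this
    have h1 := card_invs_mul' h hw
    obtain ⟨L, hL1, hL2, hL3⟩ := ih (w * sgen n (i + 1)) (by omega)
    refine ⟨L ++ [sgen n (i + 1)], ?_, by simp [hL2], by simp [hL3, mul_assoc, sgen_mul_self]⟩
    intro x hx
    rcases List.mem_append.1 hx with hx | hx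
    · exact hL1 x hx
    · rw [List.mem_singleton.1 hx]; exact sgen_mem_Simples h

lemma card_invs_le_length (L : List (Perm (Fin n))) (hL : ∀ x ∈ L, x ∈ Simples n) :
    (invs L.prod).card ≤ L.length := by
  induction L using List.reverseRecOn with
  | nil =>
    simp [invs_one]
  | append_singleton L s ih =>
    have hs := hL s (by simp)
    have ih := ih fun x hx => hL x (by simp [hx])
    obtain ⟨i, h, rfl⟩ := mem_Simples.1 hs
    simp only [List.prod_append, List.prod_singleton, List.length_append, List.length_singleton]
    rcases lt_trichotomy (L.prod ⟨i, by omega⟩) (L.prod ⟨i + 1, h⟩) with h1 | h1 | h1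
    · rw [card_invs_mul h h1]; omega
    · have := L.prod.injective h1
      simp at this
    · have := card_invs_mul' h h1
      omega

lemma len_eq_card_invs (w : Perm (Fin n)) : len n w = (invs w).card := by
  apply le_antisymm
  · exact Nat.sInf_le (exists_word_card_invs w)
  · refine le_csInf ⟨_, exists_word_card_invs w⟩ ?_
    intro k hk
    simp only [Set.mem_ofPred_eq] at hk
    obtain ⟨L, hL, rfl, rfl⟩ := hk
    exact card_invs_le_length L hL

lemma len_lt_len_mul_sgen_iff {w : Perm (Fin n)} {i : ℕ} (h : i + 1 < n) :
    len n w < len n (w * sgen n (i + 1)) ↔ w ⟨i, by omega⟩ < w ⟨i + 1, h⟩ := by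
  rw [len_eq_card_invs, len_eq_card_invs]
  rcases lt_trichotomy (w ⟨i, by omega⟩) (w ⟨i + 1, h⟩) with h1 | h1 | h1
  · simp [card_invs_mul h h1, h1]
  · have := w.injective h1
    simp at this
  · have := card_invs_mul' h h1
    constructor
    · intro h2; omega
    · intro h2; exact absurd h1 (not_lt.2 h2.le)

lemma swap_mem_Simples_iff {a b : Fin n} (hab : a < b) :
    swap a b ∈ Simples n ↔ b.1 = a.1 + 1 := by
  rw [mem_Simples]
  constructor
  · rintro ⟨i, h, hi⟩
    rw [sgen_succ h] at hi
    have h1 : swap a b ⟨i, by omega⟩ = ⟨i + 1, h⟩ := by rw [← hi, swap_apply_left]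
    rw [swap_apply_def] at h1
    split_ifs at h1 with h2 h3
    · rw [← h2, h1]
    · rw [h1, ← h3, Fin.lt_def] at hab
      simp at hab
    · simp at h1
  · intro h
    refine ⟨a.1, by omega, ?_⟩
    rw [sgen_succ (by omega : a.1 + 1 < n)]
    congr 1
    exact Fin.ext h.symm

lemma conj_sgen_succ {w : Perm (Fin n)} {i : ℕ} (h : i + 1 < n) :
    w * sgen n (i + 1) * w⁻¹ = swap (w ⟨i, by omega⟩) (w ⟨i + 1, h⟩) := by
  rw [sgen_succ h, swap_apply_apply]

lemma takes_sgen_iff {w : Perm (Fin n)} {i : ℕ} (h : i + 1 < n) :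
    (w * sgen n (i + 1) * w⁻¹ ∈ Simples n ∧ len n (w * sgen n (i + 1)) = len n w + 1) ↔
      (w ⟨i + 1, h⟩).1 = (w ⟨i, by omega⟩).1 + 1 := by
  constructor
  · rintro ⟨h1, h2⟩
    have h3 : w ⟨i, by omega⟩ < w ⟨i + 1, h⟩ := (len_lt_len_mul_sgen_iff h).1 (by omega)
    rw [conj_sgen_succ h, swap_mem_Simples_iff h3] at h1
    exact h1
  · intro h1
    have h3 : w ⟨i, by omega⟩ < w ⟨i + 1, h⟩ := by rw [Fin.lt_def]; omega
    rw [conj_sgen_succ h, swap_mem_Simples_iff h3, len_eq_card_invs, len_eq_card_invs,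
      card_invs_mul h h3]
    exact ⟨h1, rfl⟩

lemma mem_minCoset_iff {K : Finset (Perm (Fin n))} (hK : K ⊆ Simples n) {w : Perm (Fin n)} :
    w ∈ minCoset n Set.univ K ↔
      ∀ i, ∀ h : i + 1 < n, sgen n (i + 1) ∈ K → w ⟨i, by omega⟩ < w ⟨i + 1, h⟩ := by
  simp only [minCoset, mem_filter, mem_univ, true_and, Set.mem_univ]
  constructor
  · intro H i h hi
    exact (len_lt_len_mul_sgen_iff h).1 (H _ hi)
  · intro H s hs
    obtain ⟨i, h, rfl⟩ := mem_Simples.1 (hK hs)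
    exact (len_lt_len_mul_sgen_iff h).2 (H i h hs)

lemma takes_iff {J : Finset (Perm (Fin n))} (hJ : J ⊆ Simples n) {w : Perm (Fin n)} :
    Takes n (Simples n) w J ↔
      ∀ i, ∀ h : i + 1 < n, sgen n (i + 1) ∈ J →
        (w ⟨i + 1, h⟩).1 = (w ⟨i, by omega⟩).1 + 1 := by
  constructor
  · intro H i h hi
    exact (takes_sgen_iff h).1 (H _ hi)
  · intro H s hs
    obtain ⟨i, h, rfl⟩ := mem_Simples.1 (hJ hs)
    exact (takes_sgen_iff h).2 (H i h hs)

lemma sgen_succ_injective {i j : ℕ} (hi : i + 1 < n) (hj : j + 1 < n)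
    (h : sgen n (i + 1) = sgen n (j + 1)) : i = j := by
  rw [sgen_succ hi, sgen_succ hj] at h
  have h1 : swap (⟨i, by omega⟩ : Fin n) ⟨i + 1, hi⟩ ⟨i, by omega⟩ =
    swap (⟨j, by omega⟩ : Fin n) ⟨j + 1, hj⟩ ⟨i, by omega⟩ := by rw [h]
  rw [swap_apply_left, swap_apply_def] at h1
  simp only [Fin.ext_iff] at h1
  split_ifs at h1 <;> simp_all
  omega

lemma exists_perm_of_card_fiber_eq {α β : Type*} [Fintype α] {f g : α → β}
    (h : ∀ b, (univ.filter fun a => f a = b).card = (univ.filter fun a => g a = b).card) :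
    ∃ σ : Perm α, ∀ a, f a = g (σ a) := by
  have h' : ∀ b, Nonempty ({a // f a = b} ≃ {a // g a = b}) := fun b => by
    apply Fintype.card_eq.1
    rw [Fintype.card_subtype, Fintype.card_subtype]
    exact h b
  let e := fun b => (h' b).some
  exact ⟨Equiv.ofFiberEquiv e, fun a => (Equiv.ofFiberEquiv_map e a).symm⟩

lemma card_fiber_comp_perm {α β : Type*} [Fintype α] (f : α → β) (σ : Perm α) (b : β) :
    (univ.filter fun a => f (σ a) = b).card = (univ.filter fun a => f a = b).card :=
  Finset.card_bij (fun a _ => σ a) (by simp) (by simp)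
    (fun c hc => ⟨σ.symm c, by simpa using hc, by simp⟩)

lemma monotone_eq_of_card_fiber_eq {α : Type*} [PartialOrder α] {f g : Fin n → α}
    (hf : Monotone f) (hg : Monotone g)
    (h : ∀ b, (univ.filter fun a => f a = b).card = (univ.filter fun a => g a = b).card) :
    f = g := by
  obtain ⟨σ, hσ⟩ := exists_perm_of_card_fiber_eq h
  have h1 : f = g ∘ σ := funext hσ
  rw [h1] at hf ⊢
  exact Tuple.unique_monotone (τ := 1) hf hg

lemma eq_of_adjacent {α β : Type*} [PartialOrder β] {b : Fin n → β} (hb : Monotone b)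
    {f : Fin n → α}
    (H : ∀ i, ∀ h : i + 1 < n, b ⟨i, by omega⟩ = b ⟨i + 1, h⟩ → f ⟨i, by omega⟩ = f ⟨i + 1, h⟩)
    {x y : Fin n} (hxy : b x = b y) : f x = f y := by
  wlog hle : x ≤ y generalizing x y
  · exact (this hxy.symm (le_of_not_ge hle)).symm
  obtain ⟨x, hx⟩ := x
  obtain ⟨y, hy⟩ := y
  induction y with
  | zero =>
    have : x = 0 := by simpa using hle
    subst this; rfl
  | succ y ih =>
    rcases Nat.lt_or_ge x (y + 1) with h | h
    · have hy' : y < n := by omega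
      have h1 : b ⟨x, hx⟩ ≤ b ⟨y, hy'⟩ := hb (by simp; omega)
      have h2 : b ⟨y, hy'⟩ ≤ b ⟨y + 1, hy⟩ := hb (by simp)
      have h3 : b ⟨x, hx⟩ = b ⟨y, hy'⟩ := le_antisymm h1 (hxy ▸ h2)
      rw [ih hy' h3 (by simp; omega)]
      exact H y hy (h3 ▸ hxy)
    · have : x = y + 1 := le_antisymm (by simpa using hle) h
      subst this; rfl

lemma lt_of_adjacent {β : Type*} [PartialOrder β] {b : Fin n → β} (hb : Monotone b)
    {w : Fin n → Fin n}
    (H : ∀ i, ∀ h : i + 1 < n, b ⟨i, by omega⟩ = b ⟨i + 1, h⟩ → w ⟨i, by omega⟩ < w ⟨i + 1, h⟩)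
    {x y : Fin n} (hlt : x < y) (hxy : b x = b y) : w x < w y := by
  obtain ⟨x, hx⟩ := x
  obtain ⟨y, hy⟩ := y
  induction y with
  | zero => simp at hlt
  | succ y ih =>
    have hy' : y < n := by omega
    have hxy' : x ≤ y := by simp at hlt; omega
    have h1 : b ⟨x, hx⟩ ≤ b ⟨y, hy'⟩ := hb (by simpa using hxy')
    have h2 : b ⟨y, hy'⟩ ≤ b ⟨y + 1, hy⟩ := hb (by simp)
    have h3 : b ⟨x, hx⟩ = b ⟨y, hy'⟩ := le_antisymm h1 (hxy ▸ h2)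
    have h4 := H y hy (h3 ▸ hxy)
    rcases hxy'.lt_or_eq with h | h
    · exact (ih hy' (by simpa using h) h3).trans h4
    · subst h; exact h4

/-- The simple reflections which preserve the fibres of `b`. -/
def typ {β : Type*} (b : Fin n → β) : Finset (Perm (Fin n)) :=
  (Simples n).filter fun s => ∀ x, b (s x) = b x

lemma typ_subset {β : Type*} (b : Fin n → β) : typ b ⊆ Simples n := filter_subset _ _

lemma sgen_mem_typ {β : Type*} {b : Fin n → β} {i : ℕ} (h : i + 1 < n) :
    sgen n (i + 1) ∈ typ b ↔ b ⟨i, by omega⟩ = b ⟨i + 1, h⟩ := by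
  rw [typ, mem_filter, and_iff_right (sgen_mem_Simples h), sgen_succ h]
  constructor
  · intro H
    have := H ⟨i + 1, h⟩
    rwa [swap_apply_right] at this
  · intro H x
    rw [swap_apply_def]
    split_ifs with h1 h2
    · rw [h1, H]
    · rw [h2, H]
    · rfl

lemma subset_typ_iff {β : Type*} {b : Fin n → β} {J : Finset (Perm (Fin n))}
    (hJ : J ⊆ Simples n) : J ⊆ typ b ↔
      ∀ i, ∀ h : i + 1 < n, sgen n (i + 1) ∈ J → b ⟨i, by omega⟩ = b ⟨i + 1, h⟩ := by
  constructor
  · intro H i h hi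
    exact (sgen_mem_typ h).1 (H hi)
  · intro H s hs
    obtain ⟨i, h, rfl⟩ := mem_Simples.1 (hJ hs)
    exact (sgen_mem_typ h).2 (H i h hs)

lemma finset_ext_sgen {J K : Finset (Perm (Fin n))} (hJ : J ⊆ Simples n) (hK : K ⊆ Simples n)
    (H : ∀ i, i + 1 < n → (sgen n (i + 1) ∈ J ↔ sgen n (i + 1) ∈ K)) : J = K := by
  apply Finset.Subset.antisymm
  · intro s hs
    obtain ⟨i, h, rfl⟩ := mem_Simples.1 (hJ hs)
    exact (H i h).1 hs
  · intro s hs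
    obtain ⟨i, h, rfl⟩ := mem_Simples.1 (hK hs)
    exact (H i h).2 hs

/-- The number of elements of `S \ K` to the left of a position: a monotone function whose
fibres are the blocks of `K`. -/
def colour (K : Finset (Perm (Fin n))) (x : Fin n) : Fin n :=
  ⟨((range x.1).filter fun i => sgen n (i + 1) ∉ K).card,
    lt_of_le_of_lt (card_filter_le _ _) (by simp)⟩

lemma colour_monotone (K : Finset (Perm (Fin n))) : Monotone (colour K) := by
  intro x y hxy
  rw [Fin.le_def]
  exact card_le_card (filter_subset_filter _ (range_subset_range.2 hxy))

lemma colour_succ_val (K : Finset (Perm (Fin n))) {i : ℕ} (h : i + 1 < n) :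
    (colour K ⟨i + 1, h⟩).1 =
      (colour K ⟨i, by omega⟩).1 + if sgen n (i + 1) ∈ K then 0 else 1 := by
  simp only [colour]
  rw [range_add_one, filter_insert]
  split_ifs with h1
  · rfl
  · rw [card_insert_of_notMem (by simp)]

lemma colour_eq_iff (K : Finset (Perm (Fin n))) {i : ℕ} (h : i + 1 < n) :
    colour K ⟨i, by omega⟩ = colour K ⟨i + 1, h⟩ ↔ sgen n (i + 1) ∈ K := by
  rw [Fin.ext_iff, colour_succ_val]
  split_ifs with h1 <;> simp [h1]

lemma typ_colour {K : Finset (Perm (Fin n))} (hK : K ⊆ Simples n) : typ (colour K) = K :=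
  finset_ext_sgen (typ_subset _) hK fun i h => by rw [sgen_mem_typ h, colour_eq_iff]

/-- `w` is increasing on the fibres of `b`. -/
def IncrOn {k : ℕ} {β : Type*} (b : Fin k → β) (w : Perm (Fin k)) : Prop :=
  ∀ x y, x < y → b x = b y → w x < w y

lemma mem_minCoset_iff_incrOn {K : Finset (Perm (Fin n))} (hK : K ⊆ Simples n)
    {w : Perm (Fin n)} : w ∈ minCoset n Set.univ K ↔ IncrOn (colour K) w := by
  rw [mem_minCoset_iff hK]
  constructor
  · intro H x y hlt hxy
    exact lt_of_adjacent (colour_monotone K)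
      (fun i h hi => H i h ((colour_eq_iff K h).1 hi)) hlt hxy
  · intro H i h hi
    exact H _ _ (by simp) ((colour_eq_iff K h).2 hi)

lemma sort_inv_lt_iff {k : ℕ} {α : Type*} [LinearOrder α] (f : Fin k → α) (x y : Fin k) :
    (Tuple.sort f)⁻¹ x < (Tuple.sort f)⁻¹ y ↔ f x < f y ∨ (f x = f y ∧ x < y) := by
  obtain ⟨h1, h2⟩ := Tuple.eq_sort_iff.1 (rfl : Tuple.sort f = Tuple.sort f)
  set σ := Tuple.sort f
  have key : ∀ x y, σ⁻¹ x < σ⁻¹ y → f x < f y ∨ (f x = f y ∧ x < y) := by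
    intro x y h
    have h3 : f x ≤ f y := by simpa using h1 h.le
    rcases h3.lt_or_eq with h4 | h4
    · exact Or.inl h4
    · right
      refine ⟨h4, ?_⟩
      simpa using h2 _ _ h (by simpa using h4)
  refine ⟨key x y, fun h => ?_⟩
  rcases lt_trichotomy (σ⁻¹ x) (σ⁻¹ y) with h3 | h3 | h3
  · exact h3
  · have := σ⁻¹.injective h3
    subst this
    simp at h
  · rcases key _ _ h3 with h4 | ⟨h4, h5⟩ <;> rcases h with h6 | ⟨h6, h7⟩
    · exact absurd h4 h6.not_gt
    · exact absurd h4 (by simp [h6])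
    · exact absurd h6 (by simp [h4])
    · exact absurd h5 h7.not_gt

lemma incrOn_sort {k : ℕ} {α : Type*} [LinearOrder α] (h : Fin k → α) :
    IncrOn (h ∘ Tuple.sort h) (Tuple.sort h) :=
  fun x y hlt hxy => (Tuple.eq_sort_iff.1 (rfl : Tuple.sort h = Tuple.sort h)).2 x y hlt hxy

lemma sort_comp_inv {k : ℕ} {α : Type*} [LinearOrder α] {g : Fin k → α} (hg : Monotone g)
    {v : Perm (Fin k)} (hv : IncrOn g v) : Tuple.sort (g ∘ ⇑v⁻¹) = v := by
  symm
  rw [Tuple.eq_sort_iff]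
  refine ⟨?_, fun i j hij h => hv i j hij (by simpa using h)⟩
  convert hg
  ext x; simp

/-- `xRel` as a sum over colourings. -/
lemma xRel_eq_sum_sort {K : Finset (Perm (Fin n))} (hK : K ⊆ Simples n) :
    xRel n Set.univ K = ∑ h ∈ univ.filter (fun h : Fin n → Fin n =>
      ∀ i, (univ.filter fun x => h x = i).card = (univ.filter fun x => colour K x = i).card),
      of ℂ (Perm (Fin n)) (Tuple.sort h) := by
  unfold xRel
  symm
  have key : ∀ h : Fin n → Fin n, (∀ i, (univ.filter fun x => h x = i).card =
      (univ.filter fun x => colour K x = i).card) → h ∘ Tuple.sort h = colour K := by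
    intro h hh
    refine monotone_eq_of_card_fiber_eq (Tuple.monotone_sort h) (colour_monotone K) fun b => ?_
    refine Eq.trans ?_ (Eq.trans (hh b) ?_)
    · convert card_fiber_comp_perm h (Tuple.sort h) b
      rfl
    · congr!
  refine Finset.sum_bij' (fun h _ => Tuple.sort h) (fun w _ => colour K ∘ ⇑w⁻¹) ?_ ?_ ?_ ?_ ?_
  · intro h hh
    rw [mem_filter] at hh
    rw [mem_minCoset_iff_incrOn hK, ← key h hh.2]
    exact incrOn_sort h
  · intro w hw
    simp only [mem_filter, mem_univ, true_and]
    intro i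
    convert card_fiber_comp_perm (colour K) w⁻¹ i
    rfl
  · intro h hh
    rw [mem_filter] at hh
    rw [← key h hh.2]
    ext x; simp
  · intro w hw
    exact sort_comp_inv (colour_monotone K) ((mem_minCoset_iff_incrOn hK).1 hw)
  · intro h hh
    rfl

lemma perm_eq_of_lt_iff {k : ℕ} {v v' : Perm (Fin k)} (h : ∀ x y, v x < v y → v' x < v' y) :
    v = v' := by
  have : Monotone (v' * v⁻¹) := by
    have : StrictMono (v' * v⁻¹) := fun a b hab => h (v⁻¹ a) (v⁻¹ b) (by simpa using hab)
    exact this.monotone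
  have := (Perm.monotone_iff _).1 this
  exact (mul_inv_eq_one.1 this).symm

/-- The BBHT coefficient `m_{JK}`, where `J` is the set of reflections preserving the blocks
of `b`, counts colourings of the blocks. -/
lemma card_colourings_eq_mC {k : ℕ} {b : Fin n → Fin k} (hb : Monotone b)
    (hsurj : Function.Surjective b) {K : Finset (Perm (Fin n))} (hK : K ⊆ Simples n) :
    (univ.filter fun h : Fin k → Fin n => (h ∘ Tuple.sort h) ∘ b = colour K).card =
      mC n Set.univ (Simples n) (typ b) K := by
  unfold mC
  split_ifs with hsub
  swap
  · rw [card_eq_zero, filter_eq_empty_iff]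
    intro h _ hh
    apply hsub
    rw [← typ_colour hK]
    rw [subset_typ_iff (typ_subset _)]
    intro i hi h1
    rw [sgen_mem_typ hi] at h1
    rw [← hh]
    simp only [Function.comp_apply, h1]
  obtain ⟨s, hs⟩ := hsurj.hasRightInverse
  have hcol : ∀ x y, b x = b y → colour K x = colour K y := by
    intro x y hxy
    refine eq_of_adjacent hb (fun i h hi => ?_) hxy
    rw [colour_eq_iff]
    exact hsub ((sgen_mem_typ h).2 hi)
  have hslt : ∀ l l', l < l' → s l < s l' := by
    intro l l' h
    by_contra hc
    have := hb (not_lt.1 hc)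
    rw [hs, hs] at this
    exact absurd h (not_lt.2 this)
  refine Finset.card_bij (fun h _ => (Tuple.sort (⇑(Tuple.sort h) ∘ b))⁻¹) ?_ ?_ ?_
  · intro h hh
    rw [mem_filter] at hh
    have hh := hh.2
    set v := Tuple.sort h with hv
    have hw := sort_inv_lt_iff (v ∘ b)
    set w := (Tuple.sort (v ∘ b))⁻¹ with hwdef
    rw [mem_filter, mem_minCoset_iff_incrOn hK, takes_iff (typ_subset _)]
    constructor
    · intro x y hlt hxy
      rw [hw]
      rcases (hb hlt.le).lt_or_eq with h1 | h1
      · left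
        refine incrOn_sort h _ _ h1 ?_
        have e1 := congrFun hh x
        have e2 := congrFun hh y
        simp only [Function.comp_apply] at e1 e2 ⊢
        rw [e1, e2, hxy]
      · right
        exact ⟨by simp [h1], hlt⟩
    · intro i hi h1
      rw [sgen_mem_typ hi] at h1
      have hlt : w ⟨i, by omega⟩ < w ⟨i + 1, hi⟩ := by
        rw [hw]; right; exact ⟨by simp [h1], by simp⟩
      by_contra hne
      have hlt' : (w ⟨i, by omega⟩).1 + 1 < (w ⟨i + 1, hi⟩).1 := by
        rw [Fin.lt_def] at hlt; omega
      obtain ⟨z, hz⟩ := w.surjective ⟨(w ⟨i, by omega⟩).1 + 1, by omega⟩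
      have hz1 : w ⟨i, by omega⟩ < w z := by rw [hz, Fin.lt_def]; simp
      have hz2 : w z < w ⟨i + 1, hi⟩ := by rw [hz, Fin.lt_def]; exact hlt'
      rw [hw] at hz1 hz2
      simp only [Function.comp_apply, h1] at hz1 hz2
      rcases hz1 with hz1 | ⟨hz1, hz3⟩ <;> rcases hz2 with hz2 | ⟨hz2, hz4⟩
      · exact absurd hz1 hz2.not_gt
      · exact absurd hz1 (by simp [hz2])
      · exact absurd hz2 (by simp [hz1])
      · rw [Fin.lt_def] at hz3 hz4
        simp at hz3 hz4
        omega
  · intro h hh h' hh' heq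
    simp only [mem_filter, mem_univ, true_and] at hh hh'
    have hw := sort_inv_lt_iff (Tuple.sort h ∘ b)
    have hw' := sort_inv_lt_iff (Tuple.sort h' ∘ b)
    rw [heq] at hw
    have hvv : Tuple.sort h = Tuple.sort h' := by
      apply perm_eq_of_lt_iff
      intro l l' hl
      have h1 := (hw (s l) (s l')).2 (Or.inl (by simpa [hs l, hs l'] using hl))
      rcases (hw' (s l) (s l')).1 h1 with h2 | ⟨h2, h3⟩
      · simpa [hs l, hs l'] using h2
      · simp only [Function.comp_apply, hs l, hs l'] at h2
        rw [(Tuple.sort h').injective h2] at hl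
        exact absurd hl (lt_irrefl _)
    have hg : h ∘ Tuple.sort h = h' ∘ Tuple.sort h' :=
      hsurj.injective_comp_right (hh.trans hh'.symm)
    rw [hvv] at hg
    exact (Tuple.sort h').surjective.injective_comp_right hg
  · intro w hw
    rw [mem_filter, mem_minCoset_iff_incrOn hK, takes_iff (typ_subset _)] at hw
    obtain ⟨hw1, hw2⟩ := hw
    have hwinc : ∀ x y, x < y → b x = b y → w x < w y := by
      intro x y hlt hxy
      refine lt_of_adjacent hb (fun i h hi => ?_) hlt hxy
      rw [Fin.lt_def, hw2 i h ((sgen_mem_typ h).2 hi)]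
      simp
    have hrun : ∀ y x x', b x = b x' → b y ≠ b x → (w x < w y ↔ w x' < w y) := by
      intro y x x' hx hy
      have : b y ≠ b x' := by rwa [← hx]
      have h1 := eq_of_adjacent hb (f := fun z => (b y ≠ b z → (w z < w y))) ?_ hx
      · simpa [hy, this] using h1
      · intro i hi hbi
        have h2 := hw2 i hi ((sgen_mem_typ hi).2 hbi)
        simp only [eq_iff_iff, hbi]
        refine imp_congr_right fun hne => ?_
        have h3 : w y ≠ w ⟨i + 1, hi⟩ := fun h => hne (congrArg b (w.injective h))
        rw [Ne, Fin.ext_iff] at h3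
        rw [Fin.lt_def, Fin.lt_def]
        omega
    have hrun' : ∀ y x x', b x = b x' → b y ≠ b x → (w y < w x ↔ w y < w x') := by
      intro y x x' hx hy
      have e1 : w y ≠ w x := fun h => hy (congrArg b (w.injective h))
      have e2 : w y ≠ w x' := fun h => hy (hx ▸ congrArg b (w.injective h))
      have := hrun y x x' hx hy
      constructor
      · intro h
        exact lt_of_le_of_ne (not_lt.1 fun h' => absurd (this.2 h') h.not_gt) e2
      · intro h
        exact lt_of_le_of_ne (not_lt.1 fun h' => absurd (this.1 h') h.not_gt) e1
    set v : Perm (Fin k) := (Tuple.sort (fun l => w (s l)))⁻¹ with hv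
    have hvlt : ∀ l l', v l < v l' ↔ w (s l) < w (s l') := by
      intro l l'
      rw [hv, sort_inv_lt_iff]
      constructor
      · rintro (h | ⟨h1, h2⟩)
        · exact h
        · have : l = l' := by rw [← hs l, ← hs l', w.injective h1]
          exact absurd h2 (by simp [this])
      · exact Or.inl
    have hgb : (fun l => colour K (s l)) ∘ b = colour K := by
      ext1 x
      exact hcol _ _ (hs _)
    have hgm : Monotone (fun l => colour K (s l)) := by
      intro l l' hl
      apply colour_monotone
      rcases hl.lt_or_eq with h | h
      · exact (hslt _ _ h).le
      · rw [h]
    have hvi : IncrOn (fun l => colour K (s l)) v := by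
      intro l l' hl hc
      rw [hvlt]
      exact hw1 _ _ (hslt _ _ hl) hc
    have hsort := sort_comp_inv hgm hvi
    refine ⟨(fun l => colour K (s l)) ∘ ⇑v⁻¹, ?_, ?_⟩
    · simp only [mem_filter, mem_univ, true_and]
      rw [hsort]
      have : ((fun l => colour K (s l)) ∘ ⇑v⁻¹) ∘ ⇑v = fun l => colour K (s l) := by
        ext x; simp
      rw [this]
      exact hgb
    · rw [hsort, inv_eq_iff_eq_inv, eq_comm, Tuple.eq_sort_iff]
      have hmain : ∀ x y, w x < w y → v (b x) ≤ v (b y) := by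
        intro x y hxy
        by_cases hbxy : b x = b y
        · rw [hbxy]
        · apply le_of_lt
          rw [hvlt]
          rw [← hrun _ x (s (b x)) (hs _).symm (by rw [hs]; exact fun h => hbxy h.symm)]
          rw [← hrun' x y (s (b y)) (hs _).symm hbxy]
          exact hxy
      constructor
      · intro i j hij
        rcases hij.lt_or_eq with h | h
        · exact hmain (w⁻¹ i) (w⁻¹ j) (by simpa using h)
        · rw [h]
      · intro i j hij h
        have hbb : b (w⁻¹ i) = b (w⁻¹ j) := v.injective h
        by_contra hc
        rcases (not_lt.1 hc).lt_or_eq with h1 | h1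
        · have := hwinc _ _ h1 hbb.symm
          simp at this
          exact absurd hij this.not_gt
        · rw [w⁻¹.injective h1] at hij
          exact absurd hij (lt_irrefl _)

/-- The free associative algebra on the letters `0, 1, 2, …`. -/
abbrev FreeAlg : Type := MonoidAlgebra ℂ (FreeMonoid ℕ)

/-- A word, as an element of the free algebra. -/
def wd (l : List ℕ) : FreeAlg := of ℂ (FreeMonoid ℕ) (FreeMonoid.ofList l)

lemma wd_nil : wd [] = 1 := rfl

lemma wd_append (l l' : List ℕ) : wd (l ++ l') = wd l * wd l' := by
  simp only [wd, FreeMonoid.ofList_append, map_mul]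

lemma wd_cons (x : ℕ) (l : List ℕ) : wd (x :: l) = wd [x] * wd l :=
  wd_append [x] l

/-- Linear extension of a function defined on words. -/
def wlift {M : Type*} [AddCommMonoid M] [Module ℂ M] (f : List ℕ → M) : FreeAlg →ₗ[ℂ] M :=
  (MonoidAlgebra.basis (FreeMonoid ℕ) ℂ).constr ℂ fun w => f (FreeMonoid.toList w)

lemma wlift_wd {M : Type*} [AddCommMonoid M] [Module ℂ M] (f : List ℕ → M) (l : List ℕ) :
    wlift f (wd l) = f l := by
  have h := (MonoidAlgebra.basis (FreeMonoid ℕ) ℂ).constr_basis ℂ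
    (fun w => f (FreeMonoid.toList w)) (FreeMonoid.ofList l)
  rw [MonoidAlgebra.basis_apply] at h
  exact h

lemma wd_hom_ext {M : Type*} [AddCommMonoid M] [Module ℂ M] {f g : FreeAlg →ₗ[ℂ] M}
    (h : ∀ l, f (wd l) = g (wd l)) : f = g := by
  refine (MonoidAlgebra.basis (FreeMonoid ℕ) ℂ).ext fun w => ?_
  rw [MonoidAlgebra.basis_apply]
  exact h (FreeMonoid.toList w)

/-- The homogeneous component of degree `a`. -/
def homog (a : ℕ) : Submodule ℂ FreeAlg := Submodule.span ℂ (wd '' {l | l.length = a})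

lemma wd_mem_homog {l : List ℕ} {a : ℕ} (h : l.length = a) : wd l ∈ homog a :=
  Submodule.subset_span ⟨l, h, rfl⟩

lemma mul_mem_homog {a b : ℕ} {P Q : FreeAlg} (hP : P ∈ homog a) (hQ : Q ∈ homog b) :
    P * Q ∈ homog (a + b) := by
  have h : homog a * homog b ≤ homog (a + b) := by
    rw [homog, homog, Submodule.span_mul_span]
    apply Submodule.span_le.2
    rintro _ ⟨_, ⟨l, hl, rfl⟩, _, ⟨l', hl', rfl⟩, rfl⟩
    simp only [Set.mem_ofPred_eq] at hl hl'
    have := wd_mem_homog (l := l ++ l') (a := a + b) (by simp [hl, hl'])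
    rwa [wd_append] at this
  exact h (Submodule.mul_mem_mul hP hQ)

/-- Lie monomials of a given degree. -/
inductive IsLie : ℕ → FreeAlg → Prop
  | letter (x : ℕ) : IsLie 1 (wd [x])
  | bracket {a b : ℕ} {P Q : FreeAlg} : IsLie a P → IsLie b Q → IsLie (a + b) (P * Q - Q * P)

lemma IsLie.pos {a : ℕ} {P : FreeAlg} (h : IsLie a P) : 0 < a := by
  induction h with
  | letter x => simp
  | bracket _ _ h1 h2 => omega

lemma IsLie.mem_homog {a : ℕ} {P : FreeAlg} (h : IsLie a P) : P ∈ homog a := by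
  induction h with
  | letter x => exact wd_mem_homog rfl
  | @bracket a b P Q _ _ h1 h2 =>
    refine Submodule.sub_mem _ (mul_mem_homog h1 h2) ?_
    rw [add_comm a b]
    exact mul_mem_homog h2 h1

lemma list_prod_mem_homog {k : ℕ} {P : Fin k → FreeAlg} {d : Fin k → ℕ}
    (h : ∀ j, P j ∈ homog (d j)) : (List.ofFn P).prod ∈ homog (∑ j, d j) := by
  induction k with
  | zero => simpa [wd_nil] using wd_mem_homog (l := []) rfl
  | succ k ih =>
    rw [List.ofFn_succ, List.prod_cons, Fin.sum_univ_succ]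
    exact mul_mem_homog (h 0) (ih fun j => h j.succ)

/-- Distribute the letters of a word over `m` places, keeping only distributions for which the
place `i` receives `κ i` letters; multilinear in the initial content of the places. -/
def distrib {m : ℕ} (κ : Fin m → ℕ) :
    List ℕ → (Fin m → ℕ) → MultilinearMap ℂ (fun _ : Fin m => FreeAlg) FreeAlg
  | [], δ => if δ = κ then MultilinearMap.mkPiAlgebraFin ℂ m FreeAlg else 0
  | x :: v, δ => ∑ i, (distrib κ v (δ + Pi.single i 1)).compLinearMap
      fun j => if j = i then LinearMap.mulRight ℂ (wd [x]) else LinearMap.id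

lemma mul_mulSingle {m : ℕ} (Q : Fin m → FreeAlg) (i : Fin m) (P : FreeAlg) :
    Q * Pi.mulSingle i P = Function.update Q i (Q i * P) := by
  ext1 j
  rcases eq_or_ne j i with rfl | h
  · simp
  · simp [h]

lemma distrib_cons {m : ℕ} (κ : Fin m → ℕ) (x : ℕ) (v : List ℕ) (δ : Fin m → ℕ)
    (Q : Fin m → FreeAlg) : distrib κ (x :: v) δ Q =
      ∑ i, distrib κ v (δ + Pi.single i 1) (Q * Pi.mulSingle i (wd [x])) := by
  rw [distrib, _root_.sum_apply]
  refine sum_congr rfl fun i _ => ?_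
  rw [MultilinearMap.compLinearMap_apply, mul_mulSingle]
  congr 1
  ext1 j
  rcases eq_or_ne j i with rfl | h
  · simp
  · simp [h]

/-- Linear extension of `distrib`. -/
def distribL {m : ℕ} (κ : Fin m → ℕ) :
    FreeAlg →ₗ[ℂ] ((Fin m → ℕ) → MultilinearMap ℂ (fun _ : Fin m => FreeAlg) FreeAlg) :=
  wlift (distrib κ)

lemma distribL_one {m : ℕ} (κ : Fin m → ℕ) (δ : Fin m → ℕ) (Q : Fin m → FreeAlg) :
    distribL κ 1 δ Q = if δ = κ then (List.ofFn Q).prod else 0 := by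
  rw [← wd_nil, distribL, wlift_wd, distrib]
  split_ifs <;> simp

lemma distribL_mulSingle_sub {m : ℕ} (κ : Fin m → ℕ) (v : FreeAlg) (δ : Fin m → ℕ)
    (Q : Fin m → FreeAlg) (i : Fin m) (X Y : FreeAlg) :
    distribL κ v δ (Q * Pi.mulSingle i (X - Y)) =
      distribL κ v δ (Q * Pi.mulSingle i X) - distribL κ v δ (Q * Pi.mulSingle i Y) := by
  simp only [mul_mulSingle, mul_sub, MultilinearMap.map_update_sub]

/-- A Lie monomial is distributed as if it were a single letter. -/
lemma IsLie.distribL_mul {m : ℕ} (κ : Fin m → ℕ) {a : ℕ} {P : FreeAlg} (h : IsLie a P) :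
    ∀ (v : FreeAlg) (δ : Fin m → ℕ) (Q : Fin m → FreeAlg), distribL κ (P * v) δ Q =
      ∑ i, distribL κ v (δ + Pi.single i a) (Q * Pi.mulSingle i P) := by
  induction h with
  | letter x =>
    intro v δ Q
    let ev : (Fin m → ℕ) → (Fin m → FreeAlg) →
      (((Fin m → ℕ) → MultilinearMap ℂ (fun _ : Fin m => FreeAlg) FreeAlg) →ₗ[ℂ] FreeAlg) :=
      fun δ Q => { toFun := fun f => f δ Q, map_add' := fun _ _ => rfl, map_smul' := fun _ _ => rfl }
    have : (ev δ Q) ∘ₗ distribL κ ∘ₗ LinearMap.mulLeft ℂ (wd [x]) =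
        ∑ i, ev (δ + Pi.single i 1) (Q * Pi.mulSingle i (wd [x])) ∘ₗ distribL κ := by
      apply wd_hom_ext
      intro l
      simp only [LinearMap.comp_apply, LinearMap.mulLeft_apply, LinearMap.sum_apply, distribL,
        wlift_wd, ← wd_cons, ev, LinearMap.coe_mk, AddHom.coe_mk, distrib_cons]
    have := LinearMap.congr_fun this v
    simpa only [LinearMap.comp_apply, LinearMap.mulLeft_apply, LinearMap.sum_apply, ev,
      LinearMap.coe_mk, AddHom.coe_mk] using this
  | @bracket a b P1 P2 _ _ h1 h2 =>
    intro v δ Q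
    have e : (P1 * P2 - P2 * P1) * v = P1 * (P2 * v) - P2 * (P1 * v) := by noncomm_ring
    have e1 : ∀ i, Q * Pi.mulSingle i (P1 * P2) = Q * Pi.mulSingle i P1 * Pi.mulSingle i P2 := by
      intro i; rw [Pi.mulSingle_mul, mul_assoc]
    have e2 : ∀ i, Q * Pi.mulSingle i (P2 * P1) = Q * Pi.mulSingle i P2 * Pi.mulSingle i P1 := by
      intro i; rw [Pi.mulSingle_mul, mul_assoc]
    rw [e, map_sub, Pi.sub_apply, _root_.sub_apply, h1, h2]
    simp only [h1, h2, distribL_mulSingle_sub, e1, e2]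
    conv_lhs => arg 2; rw [sum_comm]
    rw [← sum_sub_distrib]
    refine sum_congr rfl fun i _ => ?_
    rw [← sum_sub_distrib]
    rw [Finset.sum_eq_single i]
    · rw [add_assoc, ← Pi.single_add, add_assoc, ← Pi.single_add, add_comm b a]
    · intro j _ hj
      have hc : (Pi.mulSingle j P2 : Fin m → FreeAlg) * Pi.mulSingle i P1 =
          Pi.mulSingle i P1 * Pi.mulSingle j P2 :=
        (Pi.mulSingle_commute (f := fun _ : Fin m => FreeAlg) hj P2 P1).eq
      rw [mul_assoc, mul_assoc, hc, add_right_comm, sub_self]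
    · simp

lemma distribL_list_prod {m : ℕ} (κ : Fin m → ℕ) {k : ℕ} {P : Fin k → FreeAlg} {d : Fin k → ℕ}
    (h : ∀ j, IsLie (d j) (P j)) (v : FreeAlg) (δ : Fin m → ℕ) (Q : Fin m → FreeAlg) :
    distribL κ ((List.ofFn P).prod * v) δ Q = ∑ h : Fin k → Fin m,
      distribL κ v (δ + ∑ j, Pi.single (h j) (d j))
        (Q * (List.ofFn fun j => (Pi.mulSingle (h j) (P j) : Fin m → FreeAlg)).prod) := by
  induction k generalizing δ Q with
  | zero => simp
  | succ k ih =>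
    rw [List.ofFn_succ, List.prod_cons, mul_assoc, (h 0).distribL_mul κ]
    simp only [ih fun j => h (Fin.succ j)]
    rw [← (Fin.consEquiv fun _ : Fin (k + 1) => Fin m).sum_comp, Fintype.sum_prod_type]
    refine sum_congr rfl fun i _ => sum_congr rfl fun g _ => ?_
    simp only [Fin.consEquiv_apply, Fin.sum_univ_succ, List.ofFn_succ, Fin.cons_zero,
      Fin.cons_succ, List.prod_cons, add_assoc, mul_assoc]

lemma flatten_filter_eq_map_sort {k m : ℕ} (h : Fin k → Fin m) :
    (List.ofFn fun i => (List.finRange k).filter fun j => h j = i).flatten =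
      (List.finRange k).map (Tuple.sort h) := by
  have hs : (List.finRange k).Pairwise (· < ·) := List.pairwise_lt_finRange k
  refine List.Perm.eq_of_pairwise (le := fun a b => (Tuple.sort h)⁻¹ a ≤ (Tuple.sort h)⁻¹ b)
    ?_ ?_ ?_ ?_
  · intro a b _ _ h1 h2
    exact (Tuple.sort h)⁻¹.injective (le_antisymm h1 h2)
  · rw [List.pairwise_flatten]
    constructor
    · intro l hl
      obtain ⟨i, rfl⟩ := (List.mem_ofFn' _ _).1 hl
      rw [List.pairwise_filter]
      refine hs.imp fun hab ha hb => ?_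
      refine ((sort_inv_lt_iff h _ _).2 (Or.inr ⟨?_, hab⟩)).le
      simp only [decide_eq_true_eq] at ha hb
      rw [ha, hb]
    · rw [List.pairwise_ofFn]
      intro i j hij x hx y hy
      simp only [List.mem_filter, decide_eq_true_eq] at hx hy
      exact ((sort_inv_lt_iff h _ _).2 (Or.inl (by rw [hx.2, hy.2]; exact hij))).le
  · rw [List.pairwise_map]
    refine hs.imp fun hab => ?_
    simpa using hab.le
  · rw [List.perm_ext_iff_of_nodup]
    · intro a
      simp only [List.mem_flatten, List.mem_ofFn', List.mem_map, List.mem_finRange, true_and]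
      constructor
      · intro _; exact ⟨(Tuple.sort h)⁻¹ a, by simp⟩
      · intro _; exact ⟨_, ⟨h a, rfl⟩, by simp⟩
    · rw [List.nodup_flatten]
      constructor
      · intro l hl
        obtain ⟨i, rfl⟩ := (List.mem_ofFn' _ _).1 hl
        exact (List.nodup_finRange k).filter _
      · rw [List.pairwise_ofFn]
        intro i j hij x hx hy
        simp only [List.mem_filter, decide_eq_true_eq] at hx hy
        exact hij.ne (hx.2.symm.trans hy.2)
    · exact (List.nodup_finRange k).map (Tuple.sort h).injective

lemma prod_map_ite_one {α M : Type*} [Monoid M] (l : List α) (p : α → Prop) [DecidablePred p]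
    (f : α → M) : (l.map fun a => if p a then f a else 1).prod = ((l.filter p).map f).prod := by
  induction l with
  | nil => rfl
  | cons a l ih =>
    by_cases h : p a <;> simp [h, ih]

lemma prod_distributed {k m : ℕ} (P : Fin k → FreeAlg) (h : Fin k → Fin m) :
    (List.ofFn ((List.ofFn fun j => (Pi.mulSingle (h j) (P j) : Fin m → FreeAlg)).prod)).prod =
      (List.ofFn (P ∘ Tuple.sort h)).prod := by
  have e : (List.ofFn fun j => (Pi.mulSingle (h j) (P j) : Fin m → FreeAlg)).prod =
      fun i => (((List.finRange k).filter fun j => h j = i).map P).prod := by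
    ext1 i
    rw [← prod_map_ite_one, List.ofFn_eq_map, Pi.list_prod_apply]
    rw [List.map_map]
    congr 2
    ext1 j
    simp only [Function.comp_apply, Pi.mulSingle_apply, eq_comm]
  rw [e, List.ofFn_eq_map (f := P ∘ _), ← List.map_map, ← flatten_filter_eq_map_sort,
    List.map_flatten, List.prod_flatten, List.map_ofFn, List.map_ofFn]
  rfl

/-- The right action of the group algebra of `S_n` on the free algebra by permuting places. -/
def act : MonoidAlgebra ℂ (Perm (Fin n)) →ₗ[ℂ] FreeAlg →ₗ[ℂ] FreeAlg :=
  (MonoidAlgebra.basis (Perm (Fin n)) ℂ).constr ℂ fun σ =>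
    wlift fun l => wd (List.ofFn fun i : Fin n => l.getD (σ i) 0)

lemma act_of (σ : Perm (Fin n)) : act (of ℂ (Perm (Fin n)) σ) =
    wlift fun l => wd (List.ofFn fun i : Fin n => l.getD (σ i) 0) := by
  have h := (MonoidAlgebra.basis (Perm (Fin n)) ℂ).constr_basis ℂ
    (fun σ => wlift fun l => wd (List.ofFn fun i : Fin n => l.getD (σ i) 0)) σ
  rw [MonoidAlgebra.basis_apply] at h
  exact h

lemma act_of_wd (σ : Perm (Fin n)) (l : List ℕ) : act (of ℂ (Perm (Fin n)) σ) (wd l) =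
    wd (List.ofFn fun i : Fin n => l.getD (σ i) 0) := by
  rw [act_of, wlift_wd]

lemma act_of_ofFn (σ : Perm (Fin n)) (u : Fin n → ℕ) :
    act (of ℂ (Perm (Fin n)) σ) (wd (List.ofFn u)) = wd (List.ofFn (u ∘ σ)) := by
  rw [act_of_wd]
  congr 2
  ext1 i
  simp

lemma groupAlg_induction {G : Type*} [Group G] {p : MonoidAlgebra ℂ G → Prop}
    (a : MonoidAlgebra ℂ G) (hof : ∀ g, p (of ℂ G g)) (hadd : ∀ x y, p x → p y → p (x + y))
    (hsmul : ∀ (c : ℂ) x, p x → p (c • x)) : p a :=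
  MonoidAlgebra.induction_on a hof hadd hsmul

lemma act_mul (a b : MonoidAlgebra ℂ (Perm (Fin n))) (t : FreeAlg) :
    act (a * b) t = act b (act a t) := by
  induction a using groupAlg_induction with
  | hadd x y hx hy => rw [add_mul, map_add, map_add, LinearMap.add_apply, LinearMap.add_apply,
      map_add, hx, hy]
  | hsmul c x hx => rw [smul_mul_assoc, map_smul, map_smul, LinearMap.smul_apply,
      LinearMap.smul_apply, map_smul, hx]
  | hof σ =>
    induction b using groupAlg_induction with
    | hadd x y hx hy => rw [mul_add, map_add, map_add, LinearMap.add_apply, LinearMap.add_apply,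
        hx, hy]
    | hsmul c x hx => rw [mul_smul_comm, map_smul, map_smul, LinearMap.smul_apply,
        LinearMap.smul_apply, hx]
    | hof τ =>
      have : act (of ℂ (Perm (Fin n)) σ * of ℂ (Perm (Fin n)) τ) =
          act (of ℂ (Perm (Fin n)) τ) ∘ₗ act (of ℂ (Perm (Fin n)) σ) := by
        apply wd_hom_ext
        intro l
        rw [← map_mul, LinearMap.comp_apply, act_of_wd, act_of_wd, act_of_ofFn]
        rfl
      rw [this, LinearMap.comp_apply]

lemma wd_ofFn_mem (u : Fin n → ℕ) : wd (List.ofFn u) ∈ homog n :=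
  wd_mem_homog (by simp)

lemma homog_induction {p : ∀ t : FreeAlg, t ∈ homog n → Prop}
    (hw : ∀ u : Fin n → ℕ, p (wd (List.ofFn u)) (wd_ofFn_mem u)) (h0 : p 0 (zero_mem _))
    (hadd : ∀ x y hx hy, p x hx → p y hy → p (x + y) (add_mem hx hy))
    (hsmul : ∀ (c : ℂ) x hx, p x hx → p (c • x) (Submodule.smul_mem _ c hx))
    {t : FreeAlg} (ht : t ∈ homog n) : p t ht := by
  refine Submodule.span_induction ?_ h0 hadd hsmul ht
  rintro _ ⟨l, hl, rfl⟩
  simp only [Set.mem_ofPred_eq] at hl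
  subst hl
  have := hw l.get
  simp only [List.ofFn_get] at this
  exact this

lemma act_one {t : FreeAlg} (ht : t ∈ homog n) :
    act (1 : MonoidAlgebra ℂ (Perm (Fin n))) t = t := by
  induction ht using homog_induction with
  | hw u =>
    have := act_of_ofFn (1 : Perm (Fin n)) u
    rw [map_one] at this
    exact this
  | h0 => simp
  | hadd x y _ _ hx hy => rw [map_add, hx, hy]
  | hsmul c x _ hx => rw [map_smul, hx]

lemma act_mem_homog (a : MonoidAlgebra ℂ (Perm (Fin n))) {t : FreeAlg} (ht : t ∈ homog n) :
    act a t ∈ homog n := by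
  induction a using groupAlg_induction with
  | hadd x y hx hy => rw [map_add]; exact add_mem hx hy
  | hsmul c x hx => rw [map_smul]; exact Submodule.smul_mem _ _ hx
  | hof σ =>
    induction ht using homog_induction with
    | hw u => rw [act_of_ofFn]; exact wd_ofFn_mem _
    | h0 => simp
    | hadd x y _ _ hx hy => rw [map_add]; exact add_mem hx hy
    | hsmul c x _ hx => rw [map_smul]; exact Submodule.smul_mem _ _ hx

lemma act_identity_word (a : MonoidAlgebra ℂ (Perm (Fin n))) :
    act a (wd (List.ofFn fun i : Fin n => i.1)) =
      MonoidAlgebra.mapDomainLinearMap ℂ ℂ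
        (fun σ : Perm (Fin n) => FreeMonoid.ofList (List.ofFn fun i => (σ i).1)) a := by
  induction a using groupAlg_induction with
  | hadd x y hx hy => rw [map_add, map_add, LinearMap.add_apply, hx, hy]
  | hsmul c x hx => rw [map_smul, map_smul, LinearMap.smul_apply, hx]
  | hof σ =>
    rw [act_of_ofFn]
    exact (MonoidAlgebra.mapDomainLinearMap_single (R := ℂ) (S := ℂ)
      (fun σ : Perm (Fin n) => FreeMonoid.ofList (List.ofFn fun i => (σ i).1)) 1 σ).symm

/-- The place permutation action on words of length `n` is faithful. -/
lemma eq_of_act {a b : MonoidAlgebra ℂ (Perm (Fin n))}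
    (h : ∀ t ∈ homog n, act a t = act b t) : a = b := by
  have h1 := h _ (wd_ofFn_mem fun i : Fin n => i.1)
  rw [act_identity_word, act_identity_word] at h1
  refine MonoidAlgebra.mapDomain_injective ?_ h1
  intro σ τ hst
  have h2 := List.ofFn_injective (FreeMonoid.ofList.injective hst)
  exact Equiv.ext fun i => Fin.ext (congrFun h2 i)

lemma sum_single_apply {k m : ℕ} (h : Fin k → Fin m) (d : Fin k → ℕ) (i : Fin m) :
    (∑ j, Pi.single (h j) (d j) : Fin m → ℕ) i = ∑ j with h j = i, d j := by
  rw [Finset.sum_apply, Finset.sum_filter]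
  refine sum_congr rfl fun j _ => ?_
  rw [Pi.single_apply]
  simp only [eq_comm]

/-- The action of `x_K` distributes the letters of a word over the blocks of `K`. -/
lemma act_xRel {K : Finset (Perm (Fin n))} (hK : K ⊆ Simples n) {t : FreeAlg}
    (ht : t ∈ homog n) : act (xRel n Set.univ K) t =
      distribL (fun i => (univ.filter fun x => colour K x = i).card) t 0 1 := by
  induction ht using homog_induction with
  | h0 => simp
  | hadd x y _ _ hx hy => rw [map_add, map_add, hx, hy]; rfl
  | hsmul c x _ hx => rw [map_smul, map_smul, hx]; rfl
  | hw u =>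
    have e : ∀ u : Fin n → ℕ, (List.ofFn fun j => wd [u j]).prod = wd (List.ofFn u) := by
      intro u
      have : ∀ l : List ℕ, (l.map fun x => wd [x]).prod = wd l := by
        intro l
        induction l with
        | nil => rfl
        | cons x l ih => rw [List.map_cons, List.prod_cons, ih, ← wd_cons]
      rw [← this, List.map_ofFn]
      rfl
    have key := distribL_list_prod (fun i => (univ.filter fun x => colour K x = i).card)
      (fun j => IsLie.letter (u j)) 1 0 1
    rw [e, mul_one] at key
    rw [key, xRel_eq_sum_sort hK, map_sum, LinearMap.sum_apply, sum_filter]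
    refine sum_congr rfl fun h _ => ?_
    rw [distribL_one, act_of_ofFn, one_mul, prod_distributed]
    refine if_congr ?_ (e _).symm rfl
    rw [zero_add, funext_iff]
    simp only [sum_single_apply, sum_const, smul_eq_mul, mul_one]

lemma act_xRel_list_prod {K : Finset (Perm (Fin n))} (hK : K ⊆ Simples n) {k : ℕ}
    {P : Fin k → FreeAlg} {d : Fin k → ℕ} (hP : ∀ j, IsLie (d j) (P j)) (hd : ∑ j, d j = n) :
    act (xRel n Set.univ K) (List.ofFn P).prod = ∑ h : Fin k → Fin n,
      if ∀ i, ∑ j with h j = i, d j = (univ.filter fun x => colour K x = i).card then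
        (List.ofFn (P ∘ Tuple.sort h)).prod else 0 := by
  have hmem := list_prod_mem_homog fun j => (hP j).mem_homog
  rw [hd] at hmem
  rw [act_xRel hK hmem]
  have key := distribL_list_prod (fun i => (univ.filter fun x => colour K x = i).card) hP 1 0 1
  rw [mul_one] at key
  rw [key]
  refine sum_congr rfl fun h _ => ?_
  rw [distribL_one, one_mul, prod_distributed, zero_add]
  refine if_congr ?_ rfl rfl
  rw [funext_iff]
  simp only [sum_single_apply]

/-- `b` lists the blocks of the composition `d`. -/
structure IsBlock {k : ℕ} (b : Fin n → Fin k) (d : Fin k → ℕ) : Prop where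
  mono : Monotone b
  card : ∀ l, (univ.filter fun x => b x = l).card = d l

lemma exists_isBlock {k : ℕ} {d : Fin k → ℕ} (hd : ∑ j, d j = n) :
    ∃ b : Fin n → Fin k, IsBlock b d := by
  let f : Fin n → Fin k := fun x => (finSigmaFinEquiv.symm (Fin.cast hd.symm x)).1
  have hf : ∀ l, (univ.filter fun x => f x = l).card = d l := by
    intro l
    rw [← Fintype.card_fin (d l), ← Finset.card_univ (α := Fin (d l))]
    symm
    refine Finset.card_bij (fun y _ => Fin.cast hd (finSigmaFinEquiv ⟨l, y⟩)) ?_ ?_ ?_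
    · intro y _
      simp [f]
    · intro y _ y' _ h
      simpa using h
    · intro x hx
      obtain ⟨⟨l', y⟩, hy⟩ := finSigmaFinEquiv.surjective (Fin.cast hd.symm x)
      have : f x = l' := by simp [f, ← hy]
      simp only [mem_filter, mem_univ, true_and] at hx
      rw [this] at hx
      subst hx
      exact ⟨y, mem_univ _, by rw [hy]; simp⟩
  refine ⟨f ∘ Tuple.sort f, Tuple.monotone_sort f, fun l => ?_⟩
  rw [← hf l]
  convert card_fiber_comp_perm f (Tuple.sort f) l
  rfl

lemma IsBlock.surjective {k : ℕ} {b : Fin n → Fin k} {d : Fin k → ℕ} (h : IsBlock b d)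
    (hd : ∀ j, 0 < d j) : Function.Surjective b := by
  intro l
  have := h.card l ▸ hd l
  obtain ⟨x, hx⟩ := card_pos.1 this
  exact ⟨x, by simpa using hx⟩

lemma IsBlock.unique {k : ℕ} {b b' : Fin n → Fin k} {d : Fin k → ℕ} (h : IsBlock b d)
    (h' : IsBlock b' d) : b = b' := by
  refine monotone_eq_of_card_fiber_eq h.mono h'.mono fun l => ?_
  have := (h.card l).trans (h'.card l).symm
  convert this

/-- The set of simple reflections preserving the blocks of a composition. -/
def typd (n : ℕ) {k : ℕ} (d : Fin k → ℕ) : Finset (Perm (Fin n)) :=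
  if h : ∃ b : Fin n → Fin k, IsBlock b d then typ h.choose else ∅

lemma IsBlock.typd_eq {k : ℕ} {b : Fin n → Fin k} {d : Fin k → ℕ} (h : IsBlock b d) :
    typd n d = typ b := by
  have h' : ∃ b : Fin n → Fin k, IsBlock b d := ⟨b, h⟩
  rw [typd, dif_pos h', h'.choose_spec.unique h]

lemma typd_subset {k : ℕ} (d : Fin k → ℕ) : typd n d ⊆ Simples n := by
  unfold typd
  split_ifs
  · exact typ_subset _
  · exact empty_subset _

/-- The sum of the products of the `P j` in all possible orders. -/
def symProd {k : ℕ} (P : Fin k → FreeAlg) : FreeAlg :=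
  ∑ π : Perm (Fin k), (List.ofFn (P ∘ π)).prod

lemma act_xRel_symProd {K : Finset (Perm (Fin n))} (hK : K ⊆ Simples n) {k : ℕ}
    {P : Fin k → FreeAlg} {d : Fin k → ℕ} (hP : ∀ j, IsLie (d j) (P j)) (hd : ∑ j, d j = n) :
    act (xRel n Set.univ K) (symProd P) = ∑ π : Perm (Fin k),
      (mC n Set.univ (Simples n) (typd n (d ∘ π)) K : ℂ) • (List.ofFn (P ∘ π)).prod := by
  have hdπ : ∀ π : Perm (Fin k), ∑ j, (d ∘ π) j = n := fun π => by
    rw [← hd]; exact Equiv.sum_comp π d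
  have key : ∀ (h : Fin k → Fin n) (π : Perm (Fin k)) (b : Fin n → Fin k), IsBlock b (d ∘ π) →
      ((∀ i, ∑ j with h j = i, (d ∘ (π * (Tuple.sort h)⁻¹)) j =
          (univ.filter fun x => colour K x = i).card) ↔
        (h ∘ Tuple.sort h) ∘ b = colour K) := by
    intro h π b hb
    have e : ∀ i, ∑ j with h j = i, (d ∘ (π * (Tuple.sort h)⁻¹)) j =
        (univ.filter fun x => ((h ∘ Tuple.sort h) ∘ b) x = i).card := by
      intro i
      rw [sum_filter, ← Equiv.sum_comp (Tuple.sort h), ← sum_filter]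
      rw [Finset.card_eq_sum_card_fiberwise (f := b) (t := univ.filter fun j => h (Tuple.sort h j) = i)]
      · refine sum_congr rfl fun j hj => ?_
        rw [mem_filter] at hj
        rw [filter_filter]
        have hi : (Tuple.sort h)⁻¹ (Tuple.sort h j) = j := by simp
        simp only [Function.comp_apply, Perm.mul_apply, hi]
        have := hb.card j
        simp only [Function.comp_apply] at this
        rw [← this]
        congr 1
        ext x
        simp only [mem_filter, mem_univ, true_and]
        constructor
        · rintro rfl; exact ⟨hj.2, rfl⟩
        · exact fun h => h.2
      · intro x hx
        simpa using hx
    simp only [e]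
    constructor
    · intro h1
      refine monotone_eq_of_card_fiber_eq ((Tuple.monotone_sort h).comp hb.mono)
        (colour_monotone K) fun i => ?_
      have := h1 i
      convert this
    · intro h1 i
      rw [h1]
  simp only [symProd, map_sum]
  have h1 : ∀ π : Perm (Fin k), act (xRel n Set.univ K) (List.ofFn (P ∘ π)).prod =
      ∑ h : Fin k → Fin n, if ∀ i, ∑ j with h j = i, (d ∘ π) j =
        (univ.filter fun x => colour K x = i).card then
          (List.ofFn ((P ∘ π) ∘ Tuple.sort h)).prod else 0 :=
    fun π => act_xRel_list_prod hK (fun j => hP (π j)) (hdπ π)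
  simp only [h1]
  rw [sum_comm]
  have h2 : ∀ h : Fin k → Fin n, (∑ π : Perm (Fin k), if ∀ i, ∑ j with h j = i, (d ∘ π) j =
        (univ.filter fun x => colour K x = i).card then
          (List.ofFn ((P ∘ π) ∘ Tuple.sort h)).prod else 0) =
      ∑ π : Perm (Fin k), if ∀ i, ∑ j with h j = i, (d ∘ (π * (Tuple.sort h)⁻¹)) j =
        (univ.filter fun x => colour K x = i).card then
          (List.ofFn (P ∘ π)).prod else 0 := by
    intro h
    rw [← Equiv.sum_comp (Equiv.mulRight (Tuple.sort h)⁻¹)]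
    refine sum_congr rfl fun π _ => ?_
    refine if_congr Iff.rfl ?_ rfl
    congr 2
    ext1 j
    simp
  simp only [h2]
  rw [sum_comm]
  refine sum_congr rfl fun π _ => ?_
  obtain ⟨b, hb⟩ := exists_isBlock (hdπ π)
  rw [← sum_filter, sum_const, hb.typd_eq, ← card_colourings_eq_mC hb.mono
    (hb.surjective fun j => (hP (π j)).pos) hK, Nat.cast_smul_eq_nsmul]
  congr 2
  ext h
  rw [mem_filter, mem_filter, key h π b hb]

lemma mC_self_ne_zero {K : Finset (Perm (Fin n))} (hK : K ⊆ Simples n) :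
    mC n Set.univ (Simples n) K K ≠ 0 := by
  rw [mC, if_pos (Subset.refl K)]
  apply card_ne_zero_of_mem (a := 1)
  rw [mem_filter, mem_minCoset_iff hK, takes_iff hK]
  constructor
  · intro i h _; simp
  · intro i h _; rfl

/-- The action of the quasi-idempotent `e_K` on a symmetrized product of Lie monomials. -/
lemma act_symProd {e : Finset (Perm (Fin n)) → MonoidAlgebra ℂ (Perm (Fin n))}
    (he : IsBBHT n Set.univ (Simples n) e) {k : ℕ} {P : Fin k → FreeAlg} {d : Fin k → ℕ}
    (hP : ∀ j, IsLie (d j) (P j)) (hd : ∑ j, d j = n) {K : Finset (Perm (Fin n))}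
    (hK : K ⊆ Simples n) : act (e K) (symProd P) =
      ∑ π ∈ univ.filter (fun π : Perm (Fin k) => typd n (d ∘ π) = K), (List.ofFn (P ∘ π)).prod := by
  induction K using Finset.strongInduction with
  | H K ih =>
    have h1 := he K (mem_powerset.2 hK)
    have h2 := act_xRel_symProd hK hP hd
    have h3 : ∑ π : Perm (Fin k), (mC n Set.univ (Simples n) (typd n (d ∘ π)) K : ℂ) •
          (List.ofFn (P ∘ π)).prod = ∑ J ∈ K.powerset, (mC n Set.univ (Simples n) J K : ℂ) •
            ∑ π ∈ univ.filter (fun π : Perm (Fin k) => typd n (d ∘ π) = J),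
              (List.ofFn (P ∘ π)).prod := by
      simp only [smul_sum, sum_filter]
      rw [sum_comm]
      refine sum_congr rfl fun π _ => ?_
      by_cases h : typd n (d ∘ π) ⊆ K
      · rw [Finset.sum_eq_single_of_mem _ (mem_powerset.2 h), if_pos rfl]
        intro J _ hJ
        rw [if_neg hJ.symm]
        simp
      · rw [mC, if_neg h, Nat.cast_zero, zero_smul]
        symm
        refine sum_eq_zero fun J hJ => ?_
        rw [if_neg, smul_zero]
        rintro rfl
        exact h (mem_powerset.1 hJ)
    rw [h1, h3, map_sum, LinearMap.sum_apply] at h2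
    rw [← Finset.add_sum_erase _ _ (mem_powerset_self K),
      ← Finset.add_sum_erase _ _ (mem_powerset_self K)] at h2
    have h4 : ∑ J ∈ K.powerset.erase K,
        act ((mC n Set.univ (Simples n) J K : ℂ) • e J) (symProd P) =
        ∑ J ∈ K.powerset.erase K, (mC n Set.univ (Simples n) J K : ℂ) •
            ∑ π ∈ univ.filter (fun π : Perm (Fin k) => typd n (d ∘ π) = J),
              (List.ofFn (P ∘ π)).prod := by
      refine sum_congr rfl fun J hJ => ?_
      rw [mem_erase, mem_powerset] at hJ
      have hJK : J ⊂ K := Finset.ssubset_iff_subset_ne.2 ⟨hJ.2, hJ.1⟩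
      rw [map_smul, LinearMap.smul_apply, ih J hJK (hJ.2.trans hK)]
    rw [h4] at h2
    have h5 := add_right_cancel h2
    rw [map_smul, LinearMap.smul_apply] at h5
    exact smul_right_injective _ (Nat.cast_ne_zero.2 (mC_self_ne_zero hK)) h5

/-- The product of a list of Lie monomials labelled by their degrees. -/
def prodSnd (l : List (ℕ × FreeAlg)) : FreeAlg := (l.map Prod.snd).prod

/-- The span of the products of fewer than `k` Lie monomials, of total degree `m`. -/
def lieSpan (m k : ℕ) : Submodule ℂ FreeAlg :=
  Submodule.span ℂ {t | ∃ l : List (ℕ × FreeAlg), (∀ x ∈ l, IsLie x.1 x.2) ∧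
    (l.map Prod.fst).sum = m ∧ l.length < k ∧ t = prodSnd l}

lemma prodSnd_mem_lieSpan {l : List (ℕ × FreeAlg)} (h : ∀ x ∈ l, IsLie x.1 x.2) {k : ℕ}
    (hk : l.length < k) : prodSnd l ∈ lieSpan (l.map Prod.fst).sum k :=
  Submodule.subset_span ⟨l, h, rfl, hk, rfl⟩

lemma mul_mem_lieSpan {a m k : ℕ} {P t : FreeAlg} (hP : IsLie a P) (ht : t ∈ lieSpan m k) :
    P * t ∈ lieSpan (a + m) (k + 1) := by
  have : lieSpan m k ≤ (lieSpan (a + m) (k + 1)).comap (LinearMap.mulLeft ℂ P) := by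
    apply Submodule.span_le.2
    rintro _ ⟨l, h, hm, hk, rfl⟩
    refine Submodule.subset_span ⟨(a, P) :: l, ?_, by simp [hm], by simpa using hk, by
      simp [prodSnd]⟩
    intro x hx
    rcases List.mem_cons.1 hx with rfl | hx
    · exact hP
    · exact h x hx
  exact this ht

/-- Permuting the factors of a product of Lie monomials changes it by products of fewer
Lie monomials. -/
lemma prodSnd_sub_mem_of_perm {l l' : List (ℕ × FreeAlg)} (hp : l.Perm l')
    (h : ∀ x ∈ l, IsLie x.1 x.2) :
    prodSnd l - prodSnd l' ∈ lieSpan (l.map Prod.fst).sum l.length := by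
  induction hp with
  | nil => simp
  | @cons x l l' hp ih =>
    have := mul_mem_lieSpan (h x (by simp)) (ih fun y hy => h y (by simp [hy]))
    simpa [prodSnd, mul_sub] using this
  | swap x y l =>
    have hx := h x (by simp)
    have hy := h y (by simp)
    refine Submodule.subset_span ⟨(y.1 + x.1, y.2 * x.2 - x.2 * y.2) :: l, ?_, ?_, by simp, ?_⟩
    · intro z hz
      rcases List.mem_cons.1 hz with rfl | hz
      · exact IsLie.bracket hy hx
      · exact h z (by simp [hz])
    · simp [add_assoc]
    · simp only [prodSnd, List.map_cons, List.prod_cons]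
      noncomm_ring
  | @trans l l' l'' h1 h2 ih1 ih2 =>
    have e1 := ih1 h
    have e2 := ih2 fun x hx => h x (h1.mem_iff.2 hx)
    rw [← (h1.map Prod.fst).sum_eq, ← h1.length_eq] at e2
    simpa using add_mem e1 e2

/-- A family of Lie monomials of total degree `n`. -/
structure IsLieTuple (n : ℕ) {k : ℕ} (P : Fin k → FreeAlg) (d : Fin k → ℕ) : Prop where
  lie : ∀ j, IsLie (d j) (P j)
  sum_eq : ∑ j, d j = n

/-- The span of the symmetrized products of fewer than `k` Lie monomials. -/
def symSpan (n k : ℕ) : Submodule ℂ FreeAlg :=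
  Submodule.span ℂ {t | ∃ j, j < k ∧ ∃ (P : Fin j → FreeAlg) (d : Fin j → ℕ),
    IsLieTuple n P d ∧ t = symProd P}

lemma symSpan_mono {j k : ℕ} (h : j ≤ k) : symSpan n j ≤ symSpan n k := by
  apply Submodule.span_mono
  rintro t ⟨i, hi, H⟩
  exact ⟨i, hi.trans_le h, H⟩

lemma IsLieTuple.prod_sub_mem_lieSpan {k : ℕ} {P : Fin k → FreeAlg} {d : Fin k → ℕ}
    (h : IsLieTuple n P d) :
    (List.ofFn P).prod - ((k.factorial : ℂ))⁻¹ • symProd P ∈ lieSpan n k := by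
  have e : ∀ (P : Fin k → FreeAlg) (d : Fin k → ℕ),
      prodSnd (List.ofFn fun j => (d j, P j)) = (List.ofFn P).prod := by
    intro P d
    rw [prodSnd, List.map_ofFn]
    rfl
  have hk : (k.factorial : ℂ) ≠ 0 := Nat.cast_ne_zero.2 k.factorial_ne_zero
  have hsum : (List.ofFn P).prod - ((k.factorial : ℂ))⁻¹ • symProd P =
      ((k.factorial : ℂ))⁻¹ • ∑ π : Perm (Fin k),
        ((List.ofFn P).prod - (List.ofFn (P ∘ π)).prod) := by
    rw [sum_sub_distrib, smul_sub, sum_const, Finset.card_univ, Fintype.card_perm,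
      Fintype.card_fin, ← Nat.cast_smul_eq_nsmul ℂ, smul_smul, inv_mul_cancel₀ hk, one_smul]
    rfl
  rw [hsum]
  refine Submodule.smul_mem _ _ (Submodule.sum_mem _ fun π _ => ?_)
  have hp : (List.ofFn fun j => (d j, P j)).Perm (List.ofFn fun j => (d (π j), P (π j))) :=
    (Equiv.Perm.ofFn_comp_perm π fun j => (d j, P j)).symm
  have := prodSnd_sub_mem_of_perm hp (by
    intro x hx
    obtain ⟨j, rfl⟩ := (List.mem_ofFn' _ _).1 hx
    exact h.lie j)
  have e2 : prodSnd (List.ofFn fun j => (d (π j), P (π j))) = (List.ofFn (P ∘ π)).prod :=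
    e (P ∘ π) (d ∘ π)
  rw [e, e2, List.map_ofFn, List.sum_ofFn, List.length_ofFn] at this
  convert this
  exact h.sum_eq.symm

lemma lieSpan_le_symSpan (k : ℕ) : lieSpan n k ≤ symSpan n k := by
  induction k using Nat.strong_induction_on with
  | _ k ih =>
    apply Submodule.span_le.2
    rintro _ ⟨l, hl, hm, hk, rfl⟩
    have hT : IsLieTuple n (fun j : Fin l.length => (l.get j).2) (fun j => (l.get j).1) := by
      refine ⟨fun j => hl _ (List.get_mem _ _), ?_⟩
      rw [← hm, ← List.sum_ofFn]
      congr 1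
      conv_rhs => rw [← List.ofFn_get l, List.map_ofFn]
      rfl
    have h1 := ih _ hk hT.prod_sub_mem_lieSpan
    have h2 : symProd (fun j : Fin l.length => (l.get j).2) ∈ symSpan n k :=
      Submodule.subset_span ⟨_, hk, _, _, hT, rfl⟩
    have h3 := add_mem (symSpan_mono hk.le h1)
      (Submodule.smul_mem _ ((l.length.factorial : ℂ))⁻¹ h2)
    rw [sub_add_cancel] at h3
    convert h3
    rw [prodSnd]
    conv_lhs => rw [← List.ofFn_get l, List.map_ofFn]
    rfl

lemma IsLieTuple.prod_sub_mem_symSpan {k : ℕ} {P : Fin k → FreeAlg} {d : Fin k → ℕ}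
    (h : IsLieTuple n P d) :
    (List.ofFn P).prod - ((k.factorial : ℂ))⁻¹ • symProd P ∈ symSpan n k :=
  lieSpan_le_symSpan k h.prod_sub_mem_lieSpan

/-- Words are spanned by symmetrized products of Lie monomials. -/
lemma homog_le_symSpan : homog n ≤ symSpan n (n + 1) := by
  refine le_trans ?_ (lieSpan_le_symSpan _)
  apply Submodule.span_le.2
  rintro _ ⟨l, rfl, rfl⟩
  have : ∀ l : List ℕ, prodSnd (l.map fun x => (1, wd [x])) = wd l := by
    intro l
    induction l with
    | nil => rfl
    | cons x l ih =>
      rw [prodSnd] at ih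
      rw [prodSnd, List.map_cons, List.map_cons, List.prod_cons, ih, ← wd_cons]
  rw [← this]
  refine Submodule.subset_span ⟨_, ?_, ?_, ?_, rfl⟩
  · intro x hx
    obtain ⟨y, _, rfl⟩ := List.mem_map.1 hx
    exact IsLie.letter y
  · rw [List.map_map, show Prod.fst ∘ (fun x : ℕ => (1, wd [x])) = fun _ => 1 from rfl]
    simp
  · simp

lemma act_eq_of_symProd {a b : MonoidAlgebra ℂ (Perm (Fin n))}
    (h : ∀ (k : ℕ) (P : Fin k → FreeAlg) (d : Fin k → ℕ), IsLieTuple n P d →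
      act a (symProd P) = act b (symProd P)) : a = b := by
  refine eq_of_act fun t ht => ?_
  have := homog_le_symSpan ht
  have h2 : symSpan n (n + 1) ≤ LinearMap.eqLocus (act a) (act b) := by
    apply Submodule.span_le.2
    rintro _ ⟨k, _, P, d, hP, rfl⟩
    exact h k P d hP
  exact h2 this

lemma symProd_mem_homog {k : ℕ} {P : Fin k → FreeAlg} {d : Fin k → ℕ} (h : IsLieTuple n P d) :
    symProd P ∈ homog n := by
  refine Submodule.sum_mem _ fun π _ => ?_
  have := list_prod_mem_homog fun j => (h.lie (π j)).mem_homog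
  rw [Equiv.sum_comp π d, h.sum_eq] at this
  exact this

lemma mem_closure_typ {β : Type*} [PartialOrder β] {b : Fin n → β} (hb : Monotone b)
    {σ : Perm (Fin n)} : σ ∈ Subgroup.closure (typ b : Set (Perm (Fin n))) ↔
      ∀ x, b (σ x) = b x := by
  constructor
  · intro h
    induction h using Subgroup.closure_induction with
    | mem s hs => exact (mem_filter.1 hs).2
    | one => simp
    | mul s t _ _ hs ht => intro x; rw [Perm.mul_apply, hs, ht]
    | inv s _ hs => intro x; rw [← hs (s⁻¹ x)]; simp
  · intro h
    have hS : ∀ f ∈ (typ b : Set (Perm (Fin n))), f.IsSwap := by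
      intro f hf
      obtain ⟨i, hi, rfl⟩ := mem_Simples.1 (typ_subset b hf)
      exact ⟨_, _, by simp, sgen_succ hi⟩
    rw [mem_closure_isSwap hS]
    refine ⟨Set.toFinite _, fun x => ?_⟩
    have := eq_of_adjacent hb (f := fun x : Fin n =>
      (MulAction.orbit (Subgroup.closure (typ b : Set (Perm (Fin n)))) x)) ?_ (h x)
    · rw [← this]
      exact MulAction.mem_orbit_self _
    · intro i hi hbi
      apply MulAction.orbit_eq_iff.2
      refine ⟨⟨sgen n (i + 1), Subgroup.subset_closure ((sgen_mem_typ hi).2 hbi)⟩, ?_⟩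
      change sgen n (i + 1) _ = _
      rw [sgen_succ hi, swap_apply_right]

lemma swap_preserves_iff {β : Type*} {b : Fin n → β} {x y : Fin n} :
    (∀ z, b (swap x y z) = b z) ↔ b x = b y := by
  constructor
  · intro h
    have := h y
    rwa [swap_apply_right] at this
  · intro h z
    rw [swap_apply_def]
    split_ifs with h1 h2
    · rw [h1, h]
    · rw [h2, h]
    · rfl

lemma shapeEq_typ_iff {β γ : Type*} [PartialOrder β] [PartialOrder γ] {b : Fin n → β}
    {b' : Fin n → γ} (hb : Monotone b) (hb' : Monotone b') : ShapeEq n (typ b) (typ b') ↔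
      ∃ w : Perm (Fin n), ∀ x y, b x = b y ↔ b' (w x) = b' (w y) := by
  refine exists_congr fun w => ?_
  have hmem : ∀ σ, σ ∈ Subgroup.map (MulAut.conj w).toMonoidHom
      (Subgroup.closure (typ b : Set (Perm (Fin n)))) ↔ ∀ x, b ((w⁻¹ * σ * w) x) = b x := by
    intro σ
    rw [← mem_closure_typ hb, Subgroup.mem_map]
    constructor
    · rintro ⟨τ, hτ, rfl⟩
      have : w⁻¹ * (MulAut.conj w).toMonoidHom τ * w = τ := by
        simp [MulAut.conj_apply, mul_assoc]
      rwa [this]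
    · intro h
      exact ⟨_, h, by simp [MulAut.conj_apply, mul_assoc]⟩
  constructor
  · intro h x y
    have h1 : swap (w x) (w y) ∈ Subgroup.closure (typ b' : Set (Perm (Fin n))) ↔
        ∀ z, b ((w⁻¹ * swap (w x) (w y) * w) z) = b z := by
      rw [h]; exact hmem _
    rw [mem_closure_typ hb', swap_preserves_iff] at h1
    rw [h1]
    have : w⁻¹ * swap (w x) (w y) * w = swap x y := by
      rw [swap_apply_apply]; group
    rw [this, swap_preserves_iff]
  · intro h
    ext σ
    rw [hmem, mem_closure_typ hb']
    simp only [Perm.mul_apply]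
    constructor
    · intro H x
      rw [h]
      simpa using H (w x)
    · intro H x
      have := H (w⁻¹ x)
      rw [h] at this
      simpa using this

lemma shapeEq_refl (I : Finset (Perm (Fin n))) : ShapeEq n I I := by
  refine ⟨1, ?_⟩
  ext σ
  simp [Subgroup.mem_map]

lemma shapeEq_symm {I J : Finset (Perm (Fin n))} (h : ShapeEq n I J) : ShapeEq n J I := by
  obtain ⟨w, hw⟩ := h
  refine ⟨w⁻¹, ?_⟩
  rw [hw, Subgroup.map_map]
  ext σ
  simp [Subgroup.mem_map, mul_assoc]

lemma shapeEq_trans {I J K : Finset (Perm (Fin n))} (h : ShapeEq n I J) (h' : ShapeEq n J K) :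
    ShapeEq n I K := by
  obtain ⟨w, hw⟩ := h
  obtain ⟨v, hv⟩ := h'
  refine ⟨v * w, ?_⟩
  rw [hv, hw, Subgroup.map_map]
  ext σ
  simp [Subgroup.mem_map]

lemma shapeEq_typd_comp_perm {k : ℕ} {d : Fin k → ℕ} (hd : ∑ j, d j = n) (π : Perm (Fin k)) :
    ShapeEq n (typd n d) (typd n (d ∘ π)) := by
  obtain ⟨b, hb⟩ := exists_isBlock hd
  obtain ⟨b', hb'⟩ := exists_isBlock (n := n) (d := d ∘ π)
    (by rw [← hd]; exact Equiv.sum_comp π d)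
  rw [hb.typd_eq, hb'.typd_eq]
  apply shapeEq_symm
  rw [shapeEq_typ_iff hb'.mono hb.mono]
  obtain ⟨σ, hσ⟩ := exists_perm_of_card_fiber_eq (f := fun x => π (b' x)) (g := b) (by
    intro l
    have h1 := hb.card l
    have h2 := hb'.card (π⁻¹ l)
    have h3 : (d ∘ π) (π⁻¹ l) = d l := by simp
    rw [h3, ← h1] at h2
    have h4 : ∀ x, π (b' x) = l ↔ b' x = π⁻¹ l := fun x => by rw [Perm.eq_inv_iff_eq]
    simp only [h4]
    convert h2)
  exact ⟨σ, fun x y => by rw [← hσ, ← hσ]; exact π.injective.eq_iff.symm⟩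

lemma eq_of_typd_eq {k : ℕ} {d d' : Fin k → ℕ} (hd : ∑ j, d j = n) (hd' : ∑ j, d' j = n)
    (hp : ∀ j, 0 < d j) (h : typd n d = typd n d') : d = d' := by
  obtain ⟨b, hb⟩ := exists_isBlock hd
  obtain ⟨b', hb'⟩ := exists_isBlock hd'
  rw [hb.typd_eq, hb'.typd_eq] at h
  have h1 : ∀ x y, b' x = b' y → b x = b y := fun x y hxy =>
    eq_of_adjacent hb'.mono (fun i hi hbi => (sgen_mem_typ hi).1 (h ▸ (sgen_mem_typ hi).2 hbi)) hxy
  have h2 : ∀ x y, b x = b y → b' x = b' y := fun x y hxy =>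
    eq_of_adjacent hb.mono (fun i hi hbi => (sgen_mem_typ hi).1 (h ▸ (sgen_mem_typ hi).2 hbi)) hxy
  obtain ⟨s, hs⟩ := (hb.surjective hp).hasRightInverse
  have hsm : StrictMono fun l => b' (s l) := by
    intro l l' hl
    have hlt : s l < s l' := by
      by_contra hc
      have := hb.mono (not_lt.1 hc)
      rw [hs, hs] at this
      exact absurd hl (not_lt.2 this)
    refine lt_of_le_of_ne (hb'.mono hlt.le) fun hc => hl.ne ?_
    rw [← hs l, ← hs l', h1 _ _ hc]
  have hid : (fun l => b' (s l)) = id := by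
    have hbij : Function.Bijective fun l => b' (s l) :=
      Finite.injective_iff_bijective.1 hsm.injective
    refine (StrictMono.range_inj hsm strictMono_id).1 ?_
    rw [hbij.surjective.range_eq, Set.range_id]
  have hbb : b = b' := by
    ext1 x
    rw [h2 x (s (b x)) (hs _).symm]
    exact (congrFun hid (b x)).symm
  ext1 l
  rw [← hb.card, ← hb'.card, hbb]

lemma card_le_of_shapeEq {k k' : ℕ} {d : Fin k → ℕ} {d' : Fin k' → ℕ} (hd : ∑ j, d j = n)
    (hd' : ∑ j, d' j = n) (hp : ∀ j, 0 < d j) (h : ShapeEq n (typd n d) (typd n d')) :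
    k ≤ k' := by
  obtain ⟨b, hb⟩ := exists_isBlock hd
  obtain ⟨b', hb'⟩ := exists_isBlock hd'
  rw [hb.typd_eq, hb'.typd_eq, shapeEq_typ_iff hb.mono hb'.mono] at h
  obtain ⟨w, hw⟩ := h
  obtain ⟨s, hs⟩ := (hb.surjective hp).hasRightInverse
  have : Function.Injective fun l => b' (w (s l)) := by
    intro l l' hl
    have := (hw _ _).2 hl
    rwa [hs, hs] at this
  simpa using Fintype.card_le_of_injective _ this

lemma exists_perm_of_shapeEq {k : ℕ} {d d' : Fin k → ℕ} (hd : ∑ j, d j = n)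
    (hd' : ∑ j, d' j = n) (hp : ∀ j, 0 < d j) (h : ShapeEq n (typd n d) (typd n d')) :
    ∃ π : Perm (Fin k), d = d' ∘ π := by
  obtain ⟨b, hb⟩ := exists_isBlock hd
  obtain ⟨b', hb'⟩ := exists_isBlock hd'
  rw [hb.typd_eq, hb'.typd_eq, shapeEq_typ_iff hb.mono hb'.mono] at h
  obtain ⟨w, hw⟩ := h
  obtain ⟨s, hs⟩ := (hb.surjective hp).hasRightInverse
  have : Function.Injective fun l => b' (w (s l)) := by
    intro l l' hl
    have := (hw _ _).2 hl
    rwa [hs, hs] at this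
  refine ⟨Equiv.ofBijective _ (Finite.injective_iff_bijective.1 this), ?_⟩
  ext1 l
  rw [Function.comp_apply, Equiv.ofBijective_apply, ← hb.card, ← hb'.card]
  symm
  refine Eq.trans (b := (univ.filter fun x => b' (w x) = b' (w (s l))).card)
    (by convert (card_fiber_comp_perm b' w (b' (w (s l)))).symm) ?_
  congr 1
  ext x
  simp only [mem_filter, mem_univ, true_and]
  rw [← hw, hs]

/-- The subsets of `S` of the same shape as `I`. -/
def shapeClass (I : Finset (Perm (Fin n))) : Finset (Finset (Perm (Fin n))) :=
  (Simples n).powerset.filter (fun J => ShapeEq n I J)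

lemma mem_shapeClass {I J : Finset (Perm (Fin n))} :
    J ∈ shapeClass I ↔ J ⊆ Simples n ∧ ShapeEq n I J := by
  rw [shapeClass, mem_filter, mem_powerset]

lemma act_sum_symProd {e : Finset (Perm (Fin n)) → MonoidAlgebra ℂ (Perm (Fin n))}
    (he : IsBBHT n Set.univ (Simples n) e) {k : ℕ} {P : Fin k → FreeAlg} {d : Fin k → ℕ}
    (hT : IsLieTuple n P d) {C : Finset (Finset (Perm (Fin n)))} (hC : ∀ J ∈ C, J ⊆ Simples n) :
    act (∑ J ∈ C, e J) (symProd P) =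
      ∑ π : Perm (Fin k), if typd n (d ∘ π) ∈ C then (List.ofFn (P ∘ π)).prod else 0 := by
  rw [map_sum, LinearMap.sum_apply]
  have : ∀ J ∈ C, act (e J) (symProd P) = ∑ π : Perm (Fin k),
      if typd n (d ∘ π) = J then (List.ofFn (P ∘ π)).prod else 0 := fun J hJ => by
    rw [act_symProd he hT.lie hT.sum_eq (hC J hJ), sum_filter]
  rw [sum_congr rfl this, sum_comm]
  refine sum_congr rfl fun π _ => ?_
  rw [Finset.sum_ite_eq]

/-- The sum of the `e_J` over the subsets of the same shape as `I`. -/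
def eShape (e : Finset (Perm (Fin n)) → MonoidAlgebra ℂ (Perm (Fin n)))
    (I : Finset (Perm (Fin n))) : MonoidAlgebra ℂ (Perm (Fin n)) := ∑ J ∈ shapeClass I, e J

section

variable {e : Finset (Perm (Fin n)) → MonoidAlgebra ℂ (Perm (Fin n))}
  (he : IsBBHT n Set.univ (Simples n) e)

include he

lemma sum_e_eq_one : ∑ J ∈ (Simples n).powerset, e J = 1 := by
  refine act_eq_of_symProd fun k P d hT => ?_
  rw [act_sum_symProd he hT fun J hJ => mem_powerset.1 hJ, act_one (symProd_mem_homog hT), symProd]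
  refine sum_congr rfl fun π _ => ?_
  rw [if_pos (mem_powerset.2 (typd_subset _))]

lemma act_eShape {I : Finset (Perm (Fin n))} {k : ℕ} {P : Fin k → FreeAlg} {d : Fin k → ℕ}
    (hT : IsLieTuple n P d) : act (eShape e I) (symProd P) =
      if ShapeEq n I (typd n d) then symProd P else 0 := by
  rw [eShape, act_sum_symProd he hT fun J hJ => (mem_shapeClass.1 hJ).1]
  have : ∀ π : Perm (Fin k), typd n (d ∘ π) ∈ shapeClass I ↔ ShapeEq n I (typd n d) := fun π => by
    have h := shapeEq_typd_comp_perm hT.sum_eq π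
    rw [mem_shapeClass]
    exact ⟨fun H => shapeEq_trans H.2 (shapeEq_symm h),
      fun H => ⟨typd_subset _, shapeEq_trans H h⟩⟩
  simp only [this]
  split_ifs with h
  · rfl
  · simp

lemma eShape_mul_self (I : Finset (Perm (Fin n))) : eShape e I * eShape e I = eShape e I := by
  refine act_eq_of_symProd fun k P d hT => ?_
  rw [act_mul, act_eShape he hT]
  split_ifs with h
  · rw [act_eShape he hT, if_pos h]
  · rw [map_zero]

lemma eShape_mul_of_not_shapeEq {I J : Finset (Perm (Fin n))} (hIJ : ¬ ShapeEq n I J) :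
    eShape e I * eShape e J = 0 := by
  refine act_eq_of_symProd fun k P d hT => ?_
  rw [act_mul, act_eShape he hT, map_zero, LinearMap.zero_apply]
  split_ifs with h
  · rw [act_eShape he hT, if_neg fun h' => hIJ (shapeEq_trans h (shapeEq_symm h'))]
  · rw [map_zero]

lemma act_eShape_prod {I : Finset (Perm (Fin n))} {k : ℕ} {P : Fin k → FreeAlg} {d : Fin k → ℕ}
    (hT : IsLieTuple n P d) (hI : ShapeEq n I (typd n d)) :
    act (eShape e I) (List.ofFn P).prod = ((k.factorial : ℂ))⁻¹ • symProd P := by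
  have h1 : symSpan n k ≤ LinearMap.ker (act (eShape e I)) := by
    apply Submodule.span_le.2
    rintro _ ⟨j, hj, Q, d', hQ, rfl⟩
    change act (eShape e I) (symProd Q) = 0
    rw [act_eShape he hQ, if_neg]
    intro h
    exact absurd (card_le_of_shapeEq hT.sum_eq hQ.sum_eq (fun j => (hT.lie j).pos)
      (shapeEq_trans (shapeEq_symm hI) h)) (not_le.2 hj)
  have h2 := LinearMap.mem_ker.1 (h1 hT.prod_sub_mem_symSpan)
  rw [map_sub, sub_eq_zero, map_smul, act_eShape he hT, if_pos hI] at h2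
  exact h2

omit he in
lemma symProd_comp_perm {k : ℕ} (P : Fin k → FreeAlg) (π : Perm (Fin k)) :
    symProd (P ∘ π) = symProd P := by
  exact Equiv.sum_comp (Equiv.mulLeft π) fun σ => (List.ofFn (P ∘ σ)).prod

lemma act_e_symProd {p k : ℕ} {lam : Fin p → ℕ} (hpos : ∀ j, 0 < lam j)
    (hsum : ∑ j, lam j = n) {P : Fin k → FreeAlg} {d : Fin k → ℕ} (hT : IsLieTuple n P d)
    (hd : ShapeEq n (typd n lam) (typd n d)) : ∃ h : p = k,
    act (e (typd n lam)) (symProd P) =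
      ∑ π ∈ univ.filter (fun π : Perm (Fin k) => ∀ j, d (π (Fin.cast h j)) = lam j),
        (List.ofFn (P ∘ π)).prod := by
  have hk : p = k := le_antisymm (card_le_of_shapeEq hsum hT.sum_eq hpos hd)
    (card_le_of_shapeEq hT.sum_eq hsum (fun j => (hT.lie j).pos) (shapeEq_symm hd))
  subst hk
  refine ⟨rfl, ?_⟩
  rw [act_symProd he hT.lie hT.sum_eq (typd_subset _)]
  refine sum_congr (filter_congr fun π _ => ?_) fun _ _ => rfl
  constructor
  · intro h j
    have hs : ∑ j, (d ∘ π) j = n := (Equiv.sum_comp π d).trans hT.sum_eq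
    exact congrFun (eq_of_typd_eq hs hsum (fun j => (hT.lie _).pos) h) j
  · intro h
    congr 1
    exact funext h

/-- The corner of the quasi-idempotent `e_I` at the idempotent of its shape is a scalar. -/
lemma exists_eShape_mul_e_mul_eShape {p : ℕ} {lam : Fin p → ℕ} (hpos : ∀ j, 0 < lam j)
    (hsum : ∑ j, lam j = n) : ∃ c : ℂ, c ≠ 0 ∧
      eShape e (typd n lam) * e (typd n lam) * eShape e (typd n lam) =
        c • eShape e (typd n lam) := by
  refine ⟨((univ.filter fun π : Perm (Fin p) => ∀ j, lam (π j) = lam j).card : ℂ) *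
    ((p.factorial : ℂ))⁻¹, ?_, ?_⟩
  · refine mul_ne_zero (Nat.cast_ne_zero.2 (card_ne_zero_of_mem (a := 1) (by simp)))
      (inv_ne_zero (Nat.cast_ne_zero.2 p.factorial_ne_zero))
  refine act_eq_of_symProd fun k P d hT => ?_
  rw [act_mul, act_mul, map_smul, LinearMap.smul_apply, act_eShape he hT]
  split_ifs with h
  · obtain ⟨rfl, h2⟩ := act_e_symProd he hpos hsum hT h
    obtain ⟨σ, hσ⟩ := exists_perm_of_shapeEq hT.sum_eq hsum (fun j => (hT.lie j).pos)
      (shapeEq_symm h)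
    rw [h2, map_sum]
    have h3 : ∀ π ∈ univ.filter (fun π : Perm (Fin p) => ∀ j, d (π (Fin.cast rfl j)) = lam j),
        act (eShape e (typd n lam)) (List.ofFn (P ∘ π)).prod =
          ((p.factorial : ℂ))⁻¹ • symProd P := by
      intro π _
      rw [← symProd_comp_perm P π]
      refine act_eShape_prod he (d := d ∘ π) ⟨fun j => hT.lie _, ?_⟩ ?_
      · exact (Equiv.sum_comp π d).trans hT.sum_eq
      · exact shapeEq_trans h (shapeEq_typd_comp_perm hT.sum_eq π)
    rw [sum_congr rfl h3, sum_const, ← Nat.cast_smul_eq_nsmul ℂ, smul_smul]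
    congr 3
    refine card_bij (fun π _ => σ * π) ?_ ?_ ?_
    · intro π hπ
      simp only [mem_filter, mem_univ, true_and] at hπ ⊢
      intro j
      rw [← hπ j, hσ]
      rfl
    · intro π _ π' _ hππ
      exact mul_left_cancel hππ
    · intro π hπ
      simp only [mem_filter, mem_univ, true_and] at hπ
      refine ⟨σ⁻¹ * π, ?_, by simp⟩
      simp only [mem_filter, mem_univ, true_and]
      intro j
      rw [← hπ j, hσ]
      simp
  · simp

end

/-- The cycle `s_{τ+l-1} ⋯ s_{τ+1}`. -/
def cyc (n τ l : ℕ) : Perm (Fin n) :=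
  (((List.range (l - 1)).reverse).map (fun j => sgen n (τ + j + 1))).prod

lemma cyc_succ_succ (τ l : ℕ) : cyc n τ (l + 2) = sgen n (τ + l + 1) * cyc n τ (l + 1) := by
  simp [cyc, List.range_succ]

lemma sgen_apply {i : ℕ} (hi : i + 1 < n) (x : Fin n) : (sgen n (i + 1) x : ℕ) =
    if (x : ℕ) = i then i + 1 else if (x : ℕ) = i + 1 then i else x := by
  rw [sgen_succ hi, swap_apply_def]
  simp only [Fin.ext_iff]
  split_ifs <;> rfl

lemma cyc_apply {τ l : ℕ} (hl : τ + l ≤ n) (x : Fin n) : (cyc n τ l x : ℕ) =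
    if τ ≤ x ∧ (x : ℕ) < τ + l then (if (x : ℕ) = τ then τ + l - 1 else x - 1) else x := by
  rcases l with _ | l
  · simp only [cyc, zero_tsub, List.range_zero, List.reverse_nil, List.map_nil, List.prod_nil,
      Perm.one_apply]
    split_ifs <;> omega
  induction l with
  | zero =>
    simp only [cyc, zero_add, tsub_self, List.range_zero, List.reverse_nil, List.map_nil,
      List.prod_nil, Perm.one_apply]
    split_ifs <;> omega
  | succ l ih =>
    rw [cyc_succ_succ, Perm.mul_apply, sgen_apply (by omega), ih (by omega)]
    split_ifs <;> omega

lemma cyc_pow_apply {τ l : ℕ} (hl : τ + l ≤ n) (x : Fin n) (hx : (x : ℕ) < τ + l) (k : ℕ)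
    (hk : τ + k ≤ x) : ((cyc n τ l ^ k) x : ℕ) = x - k := by
  induction k with
  | zero => simp
  | succ k ih =>
    rw [pow_succ', Perm.mul_apply, cyc_apply hl, ih (by omega)]
    split_ifs <;> omega

lemma cyc_apply_first {τ l : ℕ} (hl : τ + l ≤ n) (h0 : 0 < l) (x : Fin n) (hx : (x : ℕ) = τ) :
    (cyc n τ l x : ℕ) = τ + l - 1 := by
  rw [cyc_apply hl]
  split_ifs <;> omega

lemma cyc_apply_of_lt {τ l : ℕ} (hl : τ + l ≤ n) (x : Fin n) (hx : (x : ℕ) < τ) :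
    cyc n τ l x = x := by
  ext
  rw [cyc_apply hl, if_neg (by omega)]

lemma cyc_apply_of_le {τ l : ℕ} (hl : τ + l ≤ n) (x : Fin n) (hx : τ + l ≤ (x : ℕ)) :
    cyc n τ l x = x := by
  ext
  rw [cyc_apply hl, if_neg (by omega)]

lemma cyc_pow_self {τ l : ℕ} (hl : τ + l ≤ n) : cyc n τ l ^ l = 1 := by
  have hfix : ∀ x : Fin n, cyc n τ l x = x → (cyc n τ l ^ l) x = x := fun x hx =>
    Perm.pow_apply_eq_self_of_apply_eq_self hx l
  ext1 x
  rw [Perm.one_apply]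
  rcases lt_or_ge (x : ℕ) τ with h | h
  · exact hfix x (cyc_apply_of_lt hl x h)
  rcases lt_or_ge (x : ℕ) (τ + l) with h' | h'
  · have h1 := cyc_pow_apply hl x h' (x - τ) (by omega)
    have h2 := cyc_apply_first hl (by omega) ((cyc n τ l ^ (x - τ : ℕ)) x) (by omega)
    have h3 := cyc_pow_apply hl (cyc n τ l ((cyc n τ l ^ (x - τ : ℕ)) x)) (by omega)
      (τ + l - 1 - x) (by omega)
    have h4 : (cyc n τ l ^ l) x =
        (cyc n τ l ^ (τ + l - 1 - x : ℕ)) (cyc n τ l ((cyc n τ l ^ (x - τ : ℕ)) x)) := by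
      rw [← Perm.mul_apply, ← Perm.mul_apply, mul_assoc, ← pow_succ', ← pow_add]
      congr 2
      omega
    ext
    rw [h4, h3, h2]
    omega
  · exact hfix x (cyc_apply_of_le hl x h')

lemma fswap_apply {a b : ℕ} (ha : a < n) (hb : b < n) (x : Fin n) : (fswap n a b x : ℕ) =
    if (x : ℕ) = a then b else if (x : ℕ) = b then a else x := by
  rw [fswap, dif_pos ⟨ha, hb⟩, swap_apply_def]
  simp only [Fin.ext_iff]
  split_ifs <;> rfl

lemma prod_fswap_apply {a b m : ℕ} (ha : a + m ≤ b) (hb : b + m ≤ n) (x : Fin n) :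
    ((((List.range m).map (fun j => fswap n (a + j) (b + j))).prod) x : ℕ) =
      if a ≤ x ∧ (x : ℕ) < a + m then x + b - a
      else if b ≤ x ∧ (x : ℕ) < b + m then x + a - b else x := by
  induction m generalizing x with
  | zero =>
    simp only [List.range_zero, List.map_nil, List.prod_nil, Perm.one_apply]
    split_ifs <;> omega
  | succ m ih =>
    rw [List.range_succ, List.map_append, List.prod_append, List.map_singleton,
      List.prod_singleton, Perm.mul_apply, ih (by omega) (by omega),
      fswap_apply (by omega) (by omega)]
    split_ifs <;> omega

lemma tau_succ (lam : ℕ → ℕ) (i : ℕ) : tau lam (i + 1) = tau lam i + lam i := sum_range_succ _ _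

lemma tau_mono (lam : ℕ → ℕ) : Monotone (tau lam) :=
  monotone_nat_of_le_succ fun i => by rw [tau_succ]; omega

lemma gblock_eq_cyc (lam : ℕ → ℕ) (i : ℕ) : gblock n lam i = cyc n (tau lam i) (lam i) := rfl

lemma rgen_apply {lam : ℕ → ℕ} {i : ℕ} (h : lam i = lam (i + 1)) (hn : tau lam (i + 2) ≤ n)
    (x : Fin n) : (rgen n lam i x : ℕ) =
      if tau lam i ≤ x ∧ (x : ℕ) < tau lam (i + 1) then x + lam i
      else if tau lam (i + 1) ≤ x ∧ (x : ℕ) < tau lam (i + 2) then x - lam i else x := by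
  have h1 := tau_succ lam i
  have h2 : tau lam (i + 2) = tau lam (i + 1) + lam (i + 1) := tau_succ lam (i + 1)
  rw [rgen, prod_fswap_apply (by omega) (by omega)]
  split_ifs <;> omega

/-- `a` acts on the letters in positions `τ, …, τ + l - 1` through the operator `R`. -/
def IsLocal (a : MonoidAlgebra ℂ (Perm (Fin n))) (τ l : ℕ) (R : FreeAlg →ₗ[ℂ] FreeAlg) : Prop :=
  ∀ m, τ + l + m = n → ∀ u ∈ homog τ, ∀ v ∈ homog l, ∀ w ∈ homog m,
    act a (u * v * w) = u * R v * w

lemma isLocal_of_words {a : MonoidAlgebra ℂ (Perm (Fin n))} {τ l : ℕ} {R : FreeAlg →ₗ[ℂ] FreeAlg}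
    (h : ∀ u v w : List ℕ, u.length = τ → v.length = l → τ + l + w.length = n →
      act a (wd u * wd v * wd w) = wd u * R (wd v) * wd w) : IsLocal a τ l R := by
  intro m hm
  have h1 : ∀ u v : List ℕ, u.length = τ → v.length = l → ∀ w ∈ homog m,
      act a (wd u * wd v * w) = wd u * R (wd v) * w := fun u v hu hv => by
    have : homog m ≤ LinearMap.eqLocus (act a ∘ₗ LinearMap.mulLeft ℂ (wd u * wd v))
        (LinearMap.mulLeft ℂ (wd u * R (wd v))) := by
      apply Submodule.span_le.2
      rintro _ ⟨w, hw, rfl⟩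
      exact h u v w hu hv (by rw [← hm, ← show w.length = m from hw])
    exact this
  have h2 : ∀ u : List ℕ, u.length = τ → ∀ v ∈ homog l, ∀ w ∈ homog m,
      act a (wd u * v * w) = wd u * R v * w := fun u hu v hv w hw => by
    have : homog l ≤ LinearMap.eqLocus
        (act a ∘ₗ LinearMap.mulRight ℂ w ∘ₗ LinearMap.mulLeft ℂ (wd u))
        (LinearMap.mulRight ℂ w ∘ₗ LinearMap.mulLeft ℂ (wd u) ∘ₗ R) := by
      apply Submodule.span_le.2
      rintro _ ⟨v, hv, rfl⟩
      exact h1 u v hu hv w hw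
    exact this hv
  intro u hu v hv w hw
  have : homog τ ≤ LinearMap.eqLocus (act a ∘ₗ LinearMap.mulRight ℂ (v * w))
      (LinearMap.mulRight ℂ (R v * w)) := by
    apply Submodule.span_le.2
    rintro _ ⟨u, hu, rfl⟩
    have := h2 u hu v hv w hw
    rw [mul_assoc, mul_assoc] at this
    exact this
  have := this hu
  rw [mul_assoc, mul_assoc]
  exact this

/-- Moving the last letter to the front. -/
def rot : FreeAlg →ₗ[ℂ] FreeAlg := wlift fun l => wd (l.drop (l.length - 1) ++ l.dropLast)

lemma rot_mul_letter (t : FreeAlg) (x : ℕ) : rot (t * wd [x]) = wd [x] * t := by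
  have : rot ∘ₗ LinearMap.mulRight ℂ (wd [x]) = LinearMap.mulLeft ℂ (wd [x]) := by
    apply wd_hom_ext
    intro l
    simp only [LinearMap.comp_apply, LinearMap.mulRight_apply, LinearMap.mulLeft_apply]
    rw [← wd_append, rot, wlift_wd, ← wd_append]
    simp
  exact LinearMap.congr_fun this t

lemma homog_succ_induction {l : ℕ} {S : Submodule ℂ FreeAlg}
    (h : ∀ (v : List ℕ) (x : ℕ), v.length = l → wd v * wd [x] ∈ S) : homog (l + 1) ≤ S := by
  apply Submodule.span_le.2
  rintro _ ⟨v, hv, rfl⟩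
  rcases List.eq_nil_or_concat' v with rfl | ⟨v, x, rfl⟩
  · simp at hv
  · rw [wd_append]
    exact h v x (by simpa using hv)

lemma rot_mem_homog {l : ℕ} {t : FreeAlg} (ht : t ∈ homog (l + 1)) : rot t ∈ homog (l + 1) := by
  have : homog (l + 1) ≤ (homog (l + 1)).comap rot := homog_succ_induction fun v x hv => by
    rw [Submodule.mem_comap, rot_mul_letter, ← wd_append]
    exact wd_mem_homog (by simp [hv])
  exact this ht

lemma cyc_isLocal (τ l : ℕ) : IsLocal (of ℂ (Perm (Fin n)) (cyc n τ (l + 1))) τ (l + 1) rot := by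
  refine isLocal_of_words fun u v w hu hv hn => ?_
  rcases List.eq_nil_or_concat' v with rfl | ⟨v, x, rfl⟩
  · simp at hv
  rw [List.length_append, List.length_singleton, Nat.add_right_cancel_iff] at hv
  rw [wd_append v, rot_mul_letter, ← wd_append, ← wd_append, ← wd_append, ← wd_append, ← wd_append,
    ← wd_append, act_of_wd]
  congr 1
  apply List.ext_getElem
  · simp; omega
  · intro i h1 h2
    have hi : i < n := by simpa using h1
    have hc := cyc_apply (n := n) (τ := τ) (l := l + 1) (by omega) ⟨i, hi⟩
    rw [List.getElem_ofFn, List.getD_eq_getElem _ _ (by simp; omega)]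
    simp only [List.getElem_append, hc, List.length_append, List.length_singleton, hu, hv]
    grind

/-- The operator `vx ↦ 𝔅(v)x - ω x𝔅(v)` iterated over the letters of a word. -/
def brackOp (ω : ℂ) : FreeAlg →ₗ[ℂ] FreeAlg :=
  wlift fun l => l.foldl (fun t x => t * wd [x] - ω • (wd [x] * t)) 1

lemma brackOp_one (ω : ℂ) : brackOp ω 1 = 1 := by
  rw [← wd_nil, brackOp, wlift_wd]
  rfl

lemma brackOp_mul_letter (ω : ℂ) (t : FreeAlg) (x : ℕ) :
    brackOp ω (t * wd [x]) = brackOp ω t * wd [x] - ω • (wd [x] * brackOp ω t) := by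
  have : brackOp ω ∘ₗ LinearMap.mulRight ℂ (wd [x]) = (LinearMap.mulRight ℂ (wd [x]) -
      ω • LinearMap.mulLeft ℂ (wd [x])) ∘ₗ brackOp ω := by
    apply wd_hom_ext
    intro l
    simp only [LinearMap.comp_apply, LinearMap.mulRight_apply, LinearMap.sub_apply,
      LinearMap.smul_apply, LinearMap.mulLeft_apply]
    rw [← wd_append, brackOp, wlift_wd, wlift_wd, List.foldl_append]
    rfl
  exact LinearMap.congr_fun this t

lemma brackOp_mul_lie (ω : ℂ) {d : ℕ} {P : FreeAlg} (hP : IsLie d P) (t : FreeAlg) :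
    brackOp ω (t * P) = brackOp ω t * P - ω ^ d • (P * brackOp ω t) := by
  induction hP generalizing t with
  | letter x => rw [brackOp_mul_letter, pow_one]
  | @bracket a b P Q _ _ hP hQ =>
    rw [mul_sub, map_sub, ← mul_assoc, ← mul_assoc, hQ, hP, hP, hQ]
    simp only [mul_sub, sub_mul, smul_sub, smul_mul_assoc, mul_smul_comm, mul_assoc, smul_smul,
      pow_add, mul_comm (ω ^ b) (ω ^ a)]
    abel

lemma brackOp_lie (ω : ℂ) {d : ℕ} {P : FreeAlg} (hP : IsLie d P) :
    brackOp ω P = (1 - ω ^ d) • P := by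
  have := brackOp_mul_lie ω hP 1
  rw [brackOp_one, one_mul, mul_one] at this
  rw [this, sub_smul, one_smul]

lemma brackOp_mem_homog (ω : ℂ) {l : ℕ} {t : FreeAlg} (ht : t ∈ homog l) :
    brackOp ω t ∈ homog l := by
  have : homog l ≤ (homog l).comap (brackOp ω) := by
    induction l generalizing t with
    | zero =>
      apply Submodule.span_le.2
      rintro _ ⟨v, hv, rfl⟩
      rw [List.length_eq_zero_iff.1 hv, wd_nil]
      change brackOp ω 1 ∈ homog 0
      rw [brackOp_one, ← wd_nil]
      exact wd_mem_homog rfl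
    | succ l ih =>
      refine homog_succ_induction fun v x hv => ?_
      have h1 := ih (wd_mem_homog hv) (wd_mem_homog hv)
      rw [Submodule.mem_comap] at h1 ⊢
      rw [brackOp_mul_letter]
      refine Submodule.sub_mem _ (mul_mem_homog h1 (wd_mem_homog rfl))
        (Submodule.smul_mem _ _ ?_)
      rw [add_comm]
      exact mul_mem_homog (wd_mem_homog rfl) h1
  exact this ht

/-- The operator `vx ↦ 𝔅(v)x`. -/
def thetaOp (ω : ℂ) : FreeAlg →ₗ[ℂ] FreeAlg :=
  wlift fun l => brackOp ω (wd l.dropLast) * wd (l.drop (l.length - 1))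

lemma thetaOp_mul_letter (ω : ℂ) (t : FreeAlg) (x : ℕ) :
    thetaOp ω (t * wd [x]) = brackOp ω t * wd [x] := by
  have : thetaOp ω ∘ₗ LinearMap.mulRight ℂ (wd [x]) =
      LinearMap.mulRight ℂ (wd [x]) ∘ₗ brackOp ω := by
    apply wd_hom_ext
    intro l
    simp only [LinearMap.comp_apply, LinearMap.mulRight_apply]
    rw [← wd_append, thetaOp, wlift_wd]
    simp
  exact LinearMap.congr_fun this t

lemma thetaOp_sub_rot (ω : ℂ) {l : ℕ} {t : FreeAlg} (ht : t ∈ homog (l + 1)) :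
    thetaOp ω t - ω • rot (thetaOp ω t) = brackOp ω t := by
  have : homog (l + 1) ≤ LinearMap.eqLocus (thetaOp ω - ω • rot ∘ₗ thetaOp ω) (brackOp ω) :=
    homog_succ_induction fun v x hv => by
      rw [LinearMap.mem_eqLocus]
      simp only [LinearMap.sub_apply, LinearMap.smul_apply, LinearMap.comp_apply]
      rw [thetaOp_mul_letter, rot_mul_letter, brackOp_mul_letter]
  exact this ht

lemma thetaOp_mem_homog (ω : ℂ) {l : ℕ} {t : FreeAlg} (ht : t ∈ homog (l + 1)) :
    thetaOp ω t ∈ homog (l + 1) := by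
  have : homog (l + 1) ≤ (homog (l + 1)).comap (thetaOp ω) :=
    homog_succ_induction fun v x hv => by
      rw [Submodule.mem_comap, thetaOp_mul_letter]
      exact mul_mem_homog (brackOp_mem_homog ω (wd_mem_homog hv)) (wd_mem_homog rfl)
  exact this ht

lemma smul_rot_thetaOp_lie {ω : ℂ} {d : ℕ} {P : FreeAlg} (hP : IsLie d P) (hω : ω ^ d = 1) :
    ω • rot (thetaOp ω P) = thetaOp ω P := by
  have h := thetaOp_sub_rot ω (l := d - 1) (t := P)
    (by rw [Nat.sub_add_cancel hP.pos]; exact hP.mem_homog)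
  rw [brackOp_lie ω hP, hω, sub_self, zero_smul, sub_eq_zero] at h
  exact h.symm

/-- The product `(1 - ω c_1) ⋯ (1 - ω c_m)` over the cycles `c_l = cyc n τ l`. -/
def cycProd (n : ℕ) (ω : ℂ) (τ m : ℕ) : MonoidAlgebra ℂ (Perm (Fin n)) :=
  ((List.range m).map fun j => 1 - ω • of ℂ (Perm (Fin n)) (cyc n τ (j + 1))).prod

lemma cycProd_succ (ω : ℂ) (τ m : ℕ) : cycProd n ω τ (m + 1) =
    cycProd n ω τ m * (1 - ω • of ℂ (Perm (Fin n)) (cyc n τ (m + 1))) := by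
  rw [cycProd, List.range_succ, List.map_append, List.prod_append, List.map_singleton,
    List.prod_singleton, cycProd]

lemma cycProd_isLocal_brackOp (ω : ℂ) (τ m : ℕ) :
    IsLocal (cycProd n ω τ m) τ m (brackOp ω) := by
  induction m with
  | zero =>
    refine isLocal_of_words fun u v w hu hv hn => ?_
    rw [List.length_eq_zero_iff.1 hv, wd_nil, brackOp_one]
    refine act_one ?_
    rw [mul_one, ← wd_append]
    exact wd_mem_homog (by simp; omega)
  | succ m ih =>
    refine isLocal_of_words fun u v w hu hv hn => ?_
    rcases List.eq_nil_or_concat' v with rfl | ⟨v, x, rfl⟩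
    · simp at hv
    rw [List.length_append, List.length_singleton, Nat.add_right_cancel_iff] at hv
    have hB := brackOp_mem_homog ω (wd_mem_homog hv)
    have hBx : brackOp ω (wd v) * wd [x] ∈ homog (m + 1) := mul_mem_homog hB (wd_mem_homog rfl)
    have hU : wd u ∈ homog τ := wd_mem_homog hu
    have hW : wd w ∈ homog w.length := wd_mem_homog rfl
    rw [wd_append, brackOp_mul_letter, ← mul_assoc (wd u), mul_assoc _ (wd [x]), cycProd_succ,
      act_mul, ih (1 + w.length) (by omega) _ hU _ (wd_mem_homog hv) _
        (mul_mem_homog (wd_mem_homog rfl) hW), ← mul_assoc, mul_assoc (wd u), map_sub, map_smul,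
      LinearMap.sub_apply, LinearMap.smul_apply, cyc_isLocal τ m w.length hn _ hU _ hBx _ hW,
      rot_mul_letter, act_one]
    · simp only [mul_sub, sub_mul, mul_smul_comm, smul_mul_assoc]
    · rw [← hn]
      exact mul_mem_homog (mul_mem_homog hU hBx) hW

lemma cycProd_isLocal_thetaOp (ω : ℂ) (τ m : ℕ) :
    IsLocal (cycProd n ω τ m) τ (m + 1) (thetaOp ω) := by
  refine isLocal_of_words fun u v w hu hv hn => ?_
  rcases List.eq_nil_or_concat' v with rfl | ⟨v, x, rfl⟩
  · simp at hv
  rw [List.length_append, List.length_singleton, Nat.add_right_cancel_iff] at hv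
  rw [wd_append, thetaOp_mul_letter, ← mul_assoc (wd u), mul_assoc _ (wd [x]), ← mul_assoc (wd u),
    mul_assoc _ (wd [x])]
  exact cycProd_isLocal_brackOp ω τ m (1 + w.length) (by omega) _ (wd_mem_homog hu) _
    (wd_mem_homog hv) _ (mul_mem_homog (wd_mem_homog rfl) (wd_mem_homog rfl))

lemma isUnit_one_sub_smul_of {G : Type*} [Group G] {ω : ℂ} {c : G} {l : ℕ} (hc : c ^ l = 1)
    (hω : ω ^ l ≠ 1) : IsUnit (1 - ω • of ℂ G c) := by
  have h1 : (ω • of ℂ G c) ^ l = ω ^ l • (1 : MonoidAlgebra ℂ G) := by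
    rw [smul_pow, ← map_pow, hc, map_one]
  have h2 : IsUnit (1 - (ω • of ℂ G c) ^ l) := by
    rw [h1, show (1 : MonoidAlgebra ℂ G) - ω ^ l • 1 = algebraMap ℂ _ (1 - ω ^ l) by
      rw [map_sub, map_one, Algebra.algebraMap_eq_smul_one]]
    exact (IsUnit.mk0 _ (sub_ne_zero.2 hω.symm)).map _
  rw [← mul_neg_geom_sum] at h2
  refine ((Commute.isUnit_mul_iff ?_).1 h2).1
  refine Commute.sub_left (Commute.one_left _) (Commute.sum_right _ _ _ fun i _ => ?_)
  exact (Commute.refl _).pow_right i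

lemma isUnit_cycProd {ω : ℂ} {τ m : ℕ} (hn : τ + m ≤ n) (hω : ∀ l, 0 < l → l ≤ m → ω ^ l ≠ 1) :
    IsUnit (cycProd n ω τ m) := by
  induction m with
  | zero => exact isUnit_one
  | succ m ih =>
    rw [cycProd_succ]
    exact (ih (by omega) fun l h0 hl => hω l h0 (by omega)).mul
      (isUnit_one_sub_smul_of (cyc_pow_self hn) (hω _ (by omega) le_rfl))

/-- The product `Q 0 * ⋯ * Q (p - 1)`. -/
def prodRange (p : ℕ) (Q : ℕ → FreeAlg) : FreeAlg := ((List.range p).map Q).prod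

lemma prodRange_add (a b : ℕ) (Q : ℕ → FreeAlg) :
    prodRange (a + b) Q = prodRange a Q * prodRange b fun j => Q (a + j) := by
  rw [prodRange, List.range_add, List.map_append, List.prod_append, List.map_map]
  rfl

lemma prodRange_one (Q : ℕ → FreeAlg) : prodRange 1 Q = Q 0 := by simp [prodRange]

lemma prodRange_two (Q : ℕ → FreeAlg) : prodRange 2 Q = Q 0 * Q 1 := by
  simp [prodRange, List.range_succ]

lemma prodRange_congr {p : ℕ} {Q Q' : ℕ → FreeAlg} (h : ∀ j < p, Q j = Q' j) :
    prodRange p Q = prodRange p Q' := by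
  rw [prodRange, prodRange, List.map_congr_left fun j hj => h j (List.mem_range.1 hj)]

lemma prodRange_mem_homog {p : ℕ} {Q : ℕ → FreeAlg} {d : ℕ → ℕ} (h : ∀ j < p, Q j ∈ homog (d j)) :
    prodRange p Q ∈ homog (∑ j ∈ range p, d j) := by
  induction p with
  | zero => simpa [prodRange, wd_nil] using wd_mem_homog (l := []) rfl
  | succ p ih =>
    rw [prodRange_add, prodRange_one, sum_range_succ]
    exact mul_mem_homog (ih fun j hj => h j (by omega)) (h p (by omega))

/-- `lam` lists the parts of a composition of `n` with `p` parts. -/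
structure IsComp (n p : ℕ) (lam : ℕ → ℕ) : Prop where
  pos : ∀ i < p, 0 < lam i
  sum_eq : ∑ j ∈ range p, lam j = n

lemma IsComp.sum_fin {p : ℕ} {lam : ℕ → ℕ} (hC : IsComp n p lam) : ∑ j : Fin p, lam j = n := by
  rw [← hC.sum_eq, sum_range]

lemma IsComp.tau_le {p : ℕ} {lam : ℕ → ℕ} (hC : IsComp n p lam) {i : ℕ} (hi : i ≤ p) :
    tau lam i ≤ n := by
  have := tau_mono lam hi
  rwa [tau, tau, hC.sum_eq] at this

lemma prodRange_window {p : ℕ} {lam : ℕ → ℕ} (hC : IsComp n p lam) {i k : ℕ} (hi : i + k ≤ p)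
    {Q : ℕ → FreeAlg} (hQ : ∀ j < p, Q j ∈ homog (lam j)) : ∃ A B m, A ∈ homog (tau lam i) ∧
      B ∈ homog m ∧ tau lam (i + k) + m = n ∧ ∀ Q' : ℕ → FreeAlg,
        (∀ j, j < i ∨ i + k ≤ j → Q' j = Q j) →
          prodRange p Q' = A * prodRange k (fun j => Q' (i + j)) * B := by
  obtain ⟨r, rfl⟩ := Nat.exists_eq_add_of_le hi
  refine ⟨prodRange i Q, prodRange r fun j => Q (i + k + j), ∑ j ∈ range r, lam (i + k + j),
    prodRange_mem_homog fun j hj => hQ j (by omega),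
    prodRange_mem_homog (d := fun j => lam (i + k + j)) fun j hj => hQ _ (by omega), ?_, ?_⟩
  · rw [← hC.sum_eq, tau, ← sum_range_add]
  · intro Q' hQ'
    rw [prodRange_add, prodRange_add]
    congr 1
    · congr 1
      exact prodRange_congr fun j hj => hQ' j (Or.inl hj)
    · exact prodRange_congr fun j hj => hQ' _ (Or.inr (by omega))

lemma act_prodRange_of_isLocal {p : ℕ} {lam : ℕ → ℕ} (hC : IsComp n p lam) {i : ℕ} (hi : i < p)
    {Q : ℕ → FreeAlg} (hQ : ∀ j < p, Q j ∈ homog (lam j)) {a : MonoidAlgebra ℂ (Perm (Fin n))}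
    {R : FreeAlg →ₗ[ℂ] FreeAlg} (ha : IsLocal a (tau lam i) (lam i) R) (c : ℂ) {Q' : ℕ → FreeAlg}
    (h1 : ∀ j, j ≠ i → Q' j = Q j) (h2 : R (Q i) = c • Q' i) :
    act a (prodRange p Q) = c • prodRange p Q' := by
  obtain ⟨A, B, m, hA, hB, hm, h⟩ := prodRange_window hC (i := i) (k := 1) hi hQ
  rw [h Q fun _ _ => rfl, h Q' fun j hj => h1 j (by omega), prodRange_one, prodRange_one]
  rw [tau_succ] at hm
  rw [add_zero, ha m hm A hA _ (hQ i hi) B hB, h2, mul_smul_comm, smul_mul_assoc]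

/-- Interchanging the prefix of length `m` with the rest of the word. -/
def flipOp (m : ℕ) : FreeAlg →ₗ[ℂ] FreeAlg := wlift fun l => wd (l.drop m ++ l.take m)

lemma flipOp_mul {m : ℕ} {t : FreeAlg} (ht : t ∈ homog m) (t' : FreeAlg) :
    flipOp m (t * t') = t' * t := by
  have : homog m ≤ LinearMap.eqLocus (flipOp m ∘ₗ LinearMap.mulRight ℂ t')
      (LinearMap.mulLeft ℂ t') := by
    apply Submodule.span_le.2
    rintro _ ⟨l, hl, rfl⟩
    have : flipOp m ∘ₗ LinearMap.mulLeft ℂ (wd l) = LinearMap.mulRight ℂ (wd l) := by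
      apply wd_hom_ext
      intro l'
      simp only [LinearMap.comp_apply, LinearMap.mulRight_apply, LinearMap.mulLeft_apply]
      rw [← wd_append, flipOp, wlift_wd, ← wd_append]
      have hl : l.length = m := hl
      subst hl
      simp
    exact LinearMap.congr_fun this t'
  exact this ht

lemma rgen_isLocal {lam : ℕ → ℕ} {i : ℕ} (hi : lam i = lam (i + 1)) (hn : tau lam (i + 2) ≤ n) :
    IsLocal (of ℂ (Perm (Fin n)) (rgen n lam i)) (tau lam i) (lam i + lam i)
      (flipOp (lam i)) := by
  have t1 := tau_succ lam i
  have t2 : tau lam (i + 2) = tau lam (i + 1) + lam (i + 1) := tau_succ lam (i + 1)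
  refine isLocal_of_words fun u v w hu hv hw => ?_
  rw [← wd_append, ← wd_append, flipOp, wlift_wd, ← wd_append, ← wd_append, act_of_wd]
  congr 1
  apply List.ext_getElem
  · simp; omega
  · intro j h1 h2
    have hj : j < n := by simpa using h1
    have hr := rgen_apply hi hn ⟨j, hj⟩
    rw [List.getElem_ofFn, List.getD_eq_getElem _ _ (by simp; omega)]
    simp only [List.getElem_append, hr, List.length_append, hu, hv, List.length_drop,
      List.length_take, List.getElem_drop, List.getElem_take]
    grind

lemma act_rgen_prodRange {p : ℕ} {lam : ℕ → ℕ} (hC : IsComp n p lam) {i : ℕ} (hi : i + 1 < p)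
    (hl : lam i = lam (i + 1)) {Q : ℕ → FreeAlg} (hQ : ∀ j < p, Q j ∈ homog (lam j)) :
    act (of ℂ (Perm (Fin n)) (rgen n lam i)) (prodRange p Q) =
      prodRange p fun j => Q (swap i (i + 1) j) := by
  obtain ⟨A, B, m, hA, hB, hm, h⟩ := prodRange_window hC (i := i) (k := 2) hi hQ
  have t1 := tau_succ lam i
  have t2 : tau lam (i + 2) = tau lam (i + 1) + lam (i + 1) := tau_succ lam (i + 1)
  rw [h Q fun _ _ => rfl, h (fun j => Q (swap i (i + 1) j)) fun j hj => by
      rw [swap_apply_of_ne_of_ne (by omega) (by omega)],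
    prodRange_two, prodRange_two]
  have h0 := hQ i (by omega)
  have h1 := hQ (i + 1) (by omega)
  rw [← hl] at h1
  rw [add_zero, rgen_isLocal hl (by omega) m (by omega) A hA _ (mul_mem_homog h0 h1) B hB,
    flipOp_mul h0, swap_apply_left, swap_apply_right]

/-- The root of unity `exp (2πi / l)`. -/
def zeta (l : ℕ) : ℂ := Complex.exp (2 * Real.pi * Complex.I / l)

lemma zeta_pow_self {l : ℕ} (hl : 0 < l) : zeta l ^ l = 1 :=
  (Complex.isPrimitiveRoot_exp l hl.ne').pow_eq_one

lemma zeta_pow_ne_one {l k : ℕ} (hk : 0 < k) (hkl : k < l) : zeta l ^ k ≠ 1 :=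
  (Complex.isPrimitiveRoot_exp l (by omega)).pow_ne_one_of_pos_of_lt hk.ne' hkl

lemma zeta_ne_zero (l : ℕ) : zeta l ≠ 0 := Complex.exp_ne_zero _

lemma inv_zeta (l : ℕ) : (zeta l)⁻¹ = Complex.exp (-(2 * (Real.pi : ℂ) * Complex.I) / (l : ℂ)) := by
  rw [zeta, ← Complex.exp_neg, neg_div]

/-- The product of the elements `cycProd` over the first `m` blocks. -/
def blockProd (n : ℕ) (lam : ℕ → ℕ) (m : ℕ) : MonoidAlgebra ℂ (Perm (Fin n)) :=
  ((List.range m).map fun i => cycProd n (zeta (lam i)) (tau lam i) (lam i - 1)).prod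

lemma blockProd_succ (lam : ℕ → ℕ) (m : ℕ) : blockProd n lam (m + 1) =
    blockProd n lam m * cycProd n (zeta (lam m)) (tau lam m) (lam m - 1) := by
  rw [blockProd, List.range_succ, List.map_append, List.prod_append, List.map_singleton,
    List.prod_singleton, blockProd]

lemma isUnit_blockProd {p : ℕ} {lam : ℕ → ℕ} (hC : IsComp n p lam) {m : ℕ} (hm : m ≤ p) :
    IsUnit (blockProd n lam m) := by
  induction m with
  | zero => exact isUnit_one
  | succ m ih =>
    rw [blockProd_succ]
    have h1 := hC.pos m hm
    have h2 := hC.tau_le hm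
    rw [tau_succ] at h2
    exact (ih (by omega)).mul (isUnit_cycProd (by omega) fun l h0 hl =>
      zeta_pow_ne_one h0 (by omega))

lemma act_blockProd_prodRange {p : ℕ} {lam : ℕ → ℕ} (hC : IsComp n p lam) {m : ℕ} (hm : m ≤ p)
    {Q : ℕ → FreeAlg} (hQ : ∀ j < p, Q j ∈ homog (lam j)) :
    act (blockProd n lam m) (prodRange p Q) =
      prodRange p fun j => if j < m then thetaOp (zeta (lam j)) (Q j) else Q j := by
  induction m with
  | zero =>
    have := prodRange_mem_homog hQ
    rw [hC.sum_eq] at this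
    simpa [blockProd] using act_one this
  | succ m ih =>
    have h1 := cycProd_isLocal_thetaOp (n := n) (zeta (lam m)) (tau lam m) (lam m - 1)
    rw [Nat.sub_add_cancel (hC.pos m hm)] at h1
    rw [blockProd_succ, act_mul, ih (by omega)]
    refine (act_prodRange_of_isLocal hC hm ?_ h1 1 ?_ ?_).trans (one_smul _ _)
    · intro j hj
      split_ifs
      · have := thetaOp_mem_homog (zeta (lam j)) (l := lam j - 1) (t := Q j)
        rw [Nat.sub_add_cancel (hC.pos j hj)] at this
        exact this (hQ j hj)
      · exact hQ j hj
    · intro j hj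
      simp only [Nat.lt_succ_iff_lt_or_eq, hj, or_false]
    · simp

lemma prod_ofFn_eq_prodRange {p : ℕ} (P : Fin p → FreeAlg) :
    (List.ofFn P).prod = prodRange p fun j => if h : j < p then P ⟨j, h⟩ else 1 := by
  rw [prodRange]
  congr 1
  apply List.ext_getElem
  · simp
  · intro i h1 h2
    have : i < p := by simpa using h1
    simp [this]

section

variable {e : Finset (Perm (Fin n)) → MonoidAlgebra ℂ (Perm (Fin n))}
  (he : IsBBHT n Set.univ (Simples n) e) {p : ℕ} {lam : ℕ → ℕ} (hC : IsComp n p lam)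

/-- The type of the composition `lam`. -/
def typc (n p : ℕ) (lam : ℕ → ℕ) : Finset (Perm (Fin n)) := typd n fun j : Fin p => lam j

/-- The element `e_λ e_I U` on which the centralizer of `c_λ` acts by scalars. -/
def shapeGen (e : Finset (Perm (Fin n)) → MonoidAlgebra ℂ (Perm (Fin n))) (p : ℕ) (lam : ℕ → ℕ) :
    MonoidAlgebra ℂ (Perm (Fin n)) :=
  eShape e (typc n p lam) * e (typc n p lam) * blockProd n lam p

/-- The factor at position `j` of a product of operators applied to permuted Lie monomials. -/
def thetaFactor {p : ℕ} (lam : ℕ → ℕ) (P : Fin p → FreeAlg) (π : Perm (Fin p)) (j : ℕ) : FreeAlg :=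
  if h : j < p then thetaOp (zeta (lam j)) (P (π ⟨j, h⟩)) else 1

include he hC

lemma act_shapeGen {k : ℕ} {P : Fin k → FreeAlg} {d : Fin k → ℕ} (hT : IsLieTuple n P d) :
    act (shapeGen e p lam) (symProd P) = 0 ∨ ∃ h : p = k, act (shapeGen e p lam) (symProd P) =
      ∑ π ∈ univ.filter (fun π : Perm (Fin k) => ∀ j, d (π (Fin.cast h j)) = lam j),
        prodRange k (thetaFactor lam P π) := by
  rw [shapeGen, act_mul, act_mul, act_eShape he hT]
  split_ifs with hs
  swap
  · left; simp
  obtain ⟨rfl, h⟩ := act_e_symProd he (fun j => hC.pos j j.2) hC.sum_fin hT hs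
  refine Or.inr ⟨rfl, ?_⟩
  rw [typc, h, map_sum]
  refine sum_congr rfl fun π hπ => ?_
  simp only [mem_filter, mem_univ, true_and] at hπ
  rw [prod_ofFn_eq_prodRange, act_blockProd_prodRange hC le_rfl]
  · refine prodRange_congr fun j hj => ?_
    rw [if_pos hj, dif_pos hj, thetaFactor, dif_pos hj]
    rfl
  · intro j hj
    have := (hT.lie (π ⟨j, hj⟩)).mem_homog
    rw [dif_pos hj, ← show d (π ⟨j, hj⟩) = lam j from hπ ⟨j, hj⟩]
    exact this

omit he in
lemma thetaFactor_mem_homog {P : Fin p → FreeAlg} {d : Fin p → ℕ} (hT : IsLieTuple n P d)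
    {π : Perm (Fin p)} (hπ : ∀ j, d (π (Fin.cast rfl j)) = lam j) :
    ∀ j < p, thetaFactor lam P π j ∈ homog (lam j) := by
  intro j hj
  have h1 := (hT.lie (π ⟨j, hj⟩)).mem_homog
  rw [show d (π ⟨j, hj⟩) = lam j from hπ ⟨j, hj⟩] at h1
  rw [thetaFactor, dif_pos hj]
  have := thetaOp_mem_homog (zeta (lam j)) (l := lam j - 1) (t := P (π ⟨j, hj⟩))
  rw [Nat.sub_add_cancel (hC.pos j hj)] at this
  exact this h1

lemma shapeGen_mul_gblock {i : ℕ} (hi : i < p) :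
    shapeGen e p lam * of ℂ (Perm (Fin n)) (gblock n lam i) =
      (zeta (lam i))⁻¹ • shapeGen e p lam := by
  refine act_eq_of_symProd fun k P d hT => ?_
  rw [act_mul, map_smul, LinearMap.smul_apply]
  rcases act_shapeGen he hC hT with h | ⟨rfl, h⟩
  · rw [h, map_zero, smul_zero]
  rw [h, map_sum, smul_sum]
  refine sum_congr rfl fun π hπ => ?_
  simp only [mem_filter, mem_univ, true_and] at hπ
  have hloc := cyc_isLocal (n := n) (tau lam i) (lam i - 1)
  rw [Nat.sub_add_cancel (hC.pos i hi)] at hloc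
  refine act_prodRange_of_isLocal hC hi (thetaFactor_mem_homog hC hT hπ) hloc _
    (fun _ _ => rfl) ?_
  have h1 := hT.lie (π ⟨i, hi⟩)
  rw [show d (π ⟨i, hi⟩) = lam i from hπ ⟨i, hi⟩] at h1
  have h2 := smul_rot_thetaOp_lie h1 (zeta_pow_self h1.pos)
  rw [thetaFactor, dif_pos hi]
  conv_rhs => rw [← h2]
  rw [smul_smul, inv_mul_cancel₀ (zeta_ne_zero _), one_smul]

lemma shapeGen_mul_rgen {i : ℕ} (hi : i + 1 < p) (hl : lam i = lam (i + 1)) :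
    shapeGen e p lam * of ℂ (Perm (Fin n)) (rgen n lam i) = shapeGen e p lam := by
  refine act_eq_of_symProd fun k P d hT => ?_
  rw [act_mul]
  rcases act_shapeGen he hC hT with h | ⟨rfl, h⟩
  · rw [h, map_zero]
  rw [h, map_sum]
  let s : Perm (Fin p) := swap ⟨i, by omega⟩ ⟨i + 1, hi⟩
  have hs : ∀ j (hj : j < p), ((s ⟨j, hj⟩ : Fin p) : ℕ) = swap i (i + 1) j := by
    intro j hj
    simp only [s, swap_apply_def, Fin.ext_iff]
    split_ifs <;> rfl
  have hls : ∀ j, lam (swap i (i + 1) j) = lam j := by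
    intro j
    rw [swap_apply_def]
    split_ifs with h1 h2
    · rw [h1, hl]
    · rw [h2, hl]
    · rfl
  have hls' : ∀ j : Fin p, lam (s j) = lam j := fun j => by rw [hs j j.2, hls]
  refine sum_bij (fun π _ => π * s) ?_ ?_ ?_ ?_
  · intro π hπ
    simp only [mem_filter, mem_univ, true_and] at hπ ⊢
    intro j
    rw [← hls' j, ← hπ (s j)]
    rfl
  · intro π _ π' _ hππ
    exact mul_right_cancel hππ
  · intro π hπ
    simp only [mem_filter, mem_univ, true_and] at hπ
    refine ⟨π * s, ?_, by simp [s, mul_assoc]⟩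
    simp only [mem_filter, mem_univ, true_and]
    intro j
    rw [← hls' j, ← hπ (s j)]
    rfl
  · intro π hπ
    simp only [mem_filter, mem_univ, true_and] at hπ
    rw [act_rgen_prodRange hC hi hl (thetaFactor_mem_homog hC hT hπ)]
    refine prodRange_congr fun j hj => ?_
    have hj' : swap i (i + 1) j < p := by rw [← hs j hj]; exact Fin.isLt _
    rw [thetaFactor, thetaFactor, dif_pos hj, dif_pos hj', hls]
    have hπs : (π * s) ⟨j, hj⟩ = π ⟨swap i (i + 1) j, hj'⟩ :=
      congrArg π (Fin.ext (hs j hj))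
    rw [hπs]

omit hC in
lemma eShape_mul_shapeGen : eShape e (typc n p lam) * shapeGen e p lam = shapeGen e p lam := by
  rw [shapeGen, ← mul_assoc, ← mul_assoc, eShape_mul_self he]

lemma exists_shapeGen_mul : ∃ v, shapeGen e p lam * v = eShape e (typc n p lam) := by
  obtain ⟨c, hc, h⟩ := exists_eShape_mul_e_mul_eShape he (fun j => hC.pos j j.2) hC.sum_fin
  obtain ⟨U', hU⟩ := (isUnit_blockProd hC le_rfl).exists_right_inv
  refine ⟨c⁻¹ • (U' * eShape e (typc n p lam)), ?_⟩
  rw [mul_smul_comm, shapeGen, ← mul_assoc, mul_assoc _ _ U', hU, mul_one]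
  unfold typc
  rw [h, smul_smul, inv_mul_cancel₀ hc, one_smul]

end

/-- The point `x` lies in the `j`-th block of `lam`. -/
abbrev InBlk (lam : ℕ → ℕ) (j : ℕ) (x : Fin n) : Prop := tau lam j ≤ x ∧ (x : ℕ) < tau lam (j + 1)

section

variable {p : ℕ} {lam : ℕ → ℕ} (hC : IsComp n p lam)

lemma InBlk.unique {i j : ℕ} {x : Fin n} (hi : InBlk lam i x) (hj : InBlk lam j x) : i = j := by
  obtain ⟨h1, h2⟩ := hi
  obtain ⟨h3, h4⟩ := hj
  rcases lt_trichotomy i j with h | h | h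
  · have := tau_mono lam (show i + 1 ≤ j from h); omega
  · exact h
  · have := tau_mono lam (show j + 1 ≤ i from h); omega

lemma cpart_succ (m : ℕ) : cpart n (m + 1) lam = cpart n m lam * gblock n lam m := by
  rw [cpart, List.range_succ, List.map_append, List.prod_append, List.map_singleton,
    List.prod_singleton, cpart]

include hC

lemma IsComp.tau_eq : tau lam p = n := hC.sum_eq

lemma exists_inBlk (x : Fin n) : ∃ j < p, InBlk lam j x := by
  have hx : (x : ℕ) < tau lam p := by rw [hC.tau_eq]; exact x.2
  have hex : ∃ m, (x : ℕ) < tau lam m := ⟨p, hx⟩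
  have h0 : Nat.find hex ≠ 0 := fun h => by
    have := Nat.find_spec hex
    rw [h] at this
    simp [tau] at this
  have h1 := Nat.find_spec hex
  have h2 := Nat.find_min hex (m := Nat.find hex - 1) (by omega)
  have h3 : Nat.find hex ≤ p := Nat.find_min' hex hx
  refine ⟨Nat.find hex - 1, by omega, by omega, ?_⟩
  rwa [Nat.sub_add_cancel (by omega)]

lemma gblock_apply {j : ℕ} (hj : j < p) (x : Fin n) : (gblock n lam j x : ℕ) =
    if tau lam j ≤ x ∧ (x : ℕ) < tau lam (j + 1) then
      (if (x : ℕ) = tau lam j then tau lam (j + 1) - 1 else x - 1) else x := by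
  have := hC.tau_le (show j + 1 ≤ p from hj)
  rw [tau_succ] at this ⊢
  rw [gblock_eq_cyc, cyc_apply this]

lemma gblock_apply_eq_self {j : ℕ} (hj : j < p) {x : Fin n} (hx : ¬ InBlk lam j x) :
    gblock n lam j x = x := by
  ext
  rw [gblock_apply hC hj, if_neg hx]

lemma inBlk_gblock {j : ℕ} (hj : j < p) {x : Fin n} (hx : InBlk lam j x) :
    InBlk lam j (gblock n lam j x) := by
  have h := gblock_apply hC hj x
  have h1 := tau_succ lam j
  have h2 := hC.pos j hj
  obtain ⟨h3, h4⟩ := hx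
  rw [if_pos ⟨h3, h4⟩] at h
  constructor <;> split_ifs at h <;> omega

lemma cpart_prefix_apply {m : ℕ} (hm : m ≤ p) (x : Fin n) :
    (tau lam m ≤ x → cpart n m lam x = x) ∧
      ∀ j < m, InBlk lam j x → cpart n m lam x = gblock n lam j x := by
  induction m generalizing x with
  | zero => exact ⟨fun _ => rfl, fun j hj => absurd hj (Nat.not_lt_zero j)⟩
  | succ m ih =>
    have ht := tau_mono lam (Nat.le_succ m)
    refine ⟨fun hx => ?_, fun j hj hx => ?_⟩
    · rw [cpart_succ, Perm.mul_apply, gblock_apply_eq_self hC hm (fun h => by have := h.2; omega)]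
      exact (ih (by omega) x).1 (ht.trans hx)
    · rw [cpart_succ, Perm.mul_apply]
      rcases Nat.lt_succ_iff_lt_or_eq.1 hj with hj | rfl
      · rw [gblock_apply_eq_self hC hm fun h => hj.ne (hx.unique h)]
        exact (ih (by omega) x).2 j hj hx
      · exact (ih (by omega) _).1 (inBlk_gblock hC hm hx).1

lemma cpart_eq_gblock {j : ℕ} (hj : j < p) {x : Fin n} (hx : InBlk lam j x) :
    cpart n p lam x = gblock n lam j x :=
  (cpart_prefix_apply hC le_rfl x).2 j hj hx

lemma cpart_apply {j : ℕ} (hj : j < p) {x : Fin n} (hx : InBlk lam j x) :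
    (cpart n p lam x : ℕ) = if (x : ℕ) = tau lam j then tau lam (j + 1) - 1 else x - 1 := by
  rw [cpart_eq_gblock hC hj hx, gblock_apply hC hj, if_pos hx]

lemma inBlk_cpart {j : ℕ} (hj : j < p) {x : Fin n} (hx : InBlk lam j x) :
    InBlk lam j (cpart n p lam x) := by
  rw [cpart_eq_gblock hC hj hx]
  exact inBlk_gblock hC hj hx

lemma inBlk_cpart_pow {j : ℕ} (hj : j < p) {x : Fin n} (hx : InBlk lam j x) (k : ℕ) :
    InBlk lam j ((cpart n p lam ^ k) x) := by
  induction k with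
  | zero => exact hx
  | succ k ih =>
    rw [pow_succ', Perm.mul_apply]
    exact inBlk_cpart hC hj ih

lemma cpart_pow_apply {j : ℕ} (hj : j < p) {x : Fin n} (hx : InBlk lam j x) {k : ℕ}
    (hk : tau lam j + k ≤ x) : ((cpart n p lam ^ k) x : ℕ) = x - k := by
  induction k with
  | zero => simp
  | succ k ih =>
    have h := ih (by omega)
    rw [pow_succ', Perm.mul_apply, cpart_apply hC hj (inBlk_cpart_pow hC hj hx k), if_neg (by omega)]
    omega

/-- A power of `c_λ` moves any point of a block to the first point of the block. -/
lemma cpart_pow_first {j : ℕ} (hj : j < p) {x : Fin n} (hx : InBlk lam j x) :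
    ((cpart n p lam ^ (x - tau lam j : ℕ)) x : ℕ) = tau lam j := by
  have := hx.1
  rw [cpart_pow_apply hC hj hx (by omega)]
  omega

lemma exists_cpart_pow_last {j : ℕ} (hj : j < p) {x : Fin n} (hx : InBlk lam j x) :
    ((cpart n p lam ^ (x - tau lam j + 1 : ℕ)) x : ℕ) = tau lam (j + 1) - 1 := by
  rw [pow_succ', Perm.mul_apply, cpart_apply hC hj (inBlk_cpart_pow hC hj hx _),
    if_pos (cpart_pow_first hC hj hx)]

lemma cpart_pow_block {j : ℕ} (hj : j < p) {x : Fin n} (hx : InBlk lam j x) :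
    (cpart n p lam ^ lam j) x = x := by
  have h1 := tau_succ lam j
  have h2 := hx.1
  have h3 := hx.2
  have h4 := exists_cpart_pow_last hC hj hx
  have h5 := cpart_pow_apply hC hj (inBlk_cpart_pow hC hj hx (x - tau lam j + 1 : ℕ))
    (k := tau lam (j + 1) - 1 - x) (by omega)
  rw [← Perm.mul_apply, ← pow_add, h4] at h5
  ext
  rw [show lam j = tau lam (j + 1) - 1 - x + (x - tau lam j + 1) by omega, h5]
  omega

lemma le_of_cpart_pow_apply_eq {j m : ℕ} (hj : j < p) {x : Fin n} (hx : InBlk lam j x)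
    (hm : 0 < m) (h : (cpart n p lam ^ m) x = x) : lam j ≤ m := by
  by_contra! hlt
  have h1 := tau_succ lam j
  have h4 := exists_cpart_pow_last hC hj hx
  have h5 := inBlk_cpart_pow hC hj hx (x - tau lam j + 1 : ℕ)
  have h6 : (cpart n p lam ^ m) ((cpart n p lam ^ (x - tau lam j + 1 : ℕ)) x) =
      (cpart n p lam ^ (x - tau lam j + 1 : ℕ)) x := by
    rw [← Perm.mul_apply, ← pow_add, add_comm, pow_add, Perm.mul_apply, h]
  have h7 := cpart_pow_apply hC hj h5 (k := m) (by omega)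
  rw [h6] at h7
  have := h5.1
  omega

lemma gblock_mem_centralizer {j : ℕ} (hj : j < p) :
    gblock n lam j ∈ Subgroup.centralizer {cpart n p lam} := by
  rw [Subgroup.mem_centralizer_singleton_iff]
  ext1 x
  rw [Perm.mul_apply, Perm.mul_apply]
  obtain ⟨i, hi, hx⟩ := exists_inBlk hC x
  by_cases hij : i = j
  · subst hij
    rw [cpart_eq_gblock hC hi hx, cpart_eq_gblock hC hi (inBlk_gblock hC hi hx)]
  · rw [gblock_apply_eq_self hC hj fun h => hij (hx.unique h),
      gblock_apply_eq_self hC hj fun h => hij ((inBlk_cpart hC hi hx).unique h)]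

omit hC in
lemma rgen_apply_of_not_inBlk {i : ℕ} (h : lam i = lam (i + 1)) (hn : tau lam (i + 2) ≤ n)
    {x : Fin n} (h1 : ¬ InBlk lam i x) (h2 : ¬ InBlk lam (i + 1) x) : rgen n lam i x = x := by
  ext
  rw [rgen_apply h hn, if_neg h1, if_neg h2]

lemma rgen_mem_centralizer {i : ℕ} (hi : i + 1 < p) (hl : lam i = lam (i + 1)) :
    rgen n lam i ∈ Subgroup.centralizer {cpart n p lam} := by
  rw [Subgroup.mem_centralizer_singleton_iff]
  have hn := hC.tau_le (show i + 2 ≤ p from hi)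
  have t1 := tau_succ lam i
  have t2 : tau lam (i + 2) = tau lam (i + 1) + lam (i + 1) := tau_succ lam (i + 1)
  have hpos := hC.pos i (by omega)
  ext1 x
  rw [Perm.mul_apply, Perm.mul_apply]
  obtain ⟨j, hj, hx⟩ := exists_inBlk hC x
  have hcx := inBlk_cpart hC hj hx
  by_cases h1 : j = i
  · subst h1
    have r1 := rgen_apply hl hn x
    have r2 := rgen_apply hl hn (cpart n p lam x)
    have c1 := cpart_apply hC hj hx
    rw [if_pos hx] at r1
    rw [if_pos hcx] at r2
    have := hx.1
    have := hx.2
    have hrx : InBlk lam (j + 1) (rgen n lam j x) := by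
      change _ ∧ _ < tau lam (j + 2)
      omega
    have c2 := cpart_apply hC hi hrx
    ext
    rw [show j + 1 + 1 = j + 2 from rfl] at c2
    split_ifs at c1 c2 <;> omega
  by_cases h2 : j = i + 1
  · subst h2
    have r1 := rgen_apply hl hn x
    have r2 := rgen_apply hl hn (cpart n p lam x)
    have c1 := cpart_apply hC hj hx
    rw [if_neg (fun h => h1 (hx.unique h)), if_pos hx] at r1
    rw [if_neg (fun h => h1 (hcx.unique h)), if_pos hcx] at r2
    have := hx.1
    have : (x : ℕ) < tau lam (i + 2) := hx.2
    have hrx : InBlk lam i (rgen n lam i x) := by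
      constructor <;> omega
    have c2 := cpart_apply hC (by omega) hrx
    ext
    rw [show i + 1 + 1 = i + 2 from rfl] at c1
    split_ifs at c1 c2 <;> omega
  · rw [rgen_apply_of_not_inBlk hl hn (fun h => h1 (hx.unique h)) (fun h => h2 (hx.unique h)),
      rgen_apply_of_not_inBlk hl hn (fun h => h1 (hcx.unique h)) (fun h => h2 (hcx.unique h))]

/-- The generators of the centralizer of `c_λ`. -/
def centGens (n p : ℕ) (lam : ℕ → ℕ) : Set (Perm (Fin n)) :=
  {x | (∃ i < p, x = gblock n lam i) ∨ ∃ i, i + 1 < p ∧ lam i = lam (i + 1) ∧ x = rgen n lam i}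

lemma apply_eq_of_fix_first {z : Perm (Fin n)} (hz : z * cpart n p lam = cpart n p lam * z)
    {k : ℕ} (hk : k < p) {x x0 : Fin n} (hx : InBlk lam k x) (hx0 : (x0 : ℕ) = tau lam k)
    (h : z x0 = x0) : z x = x := by
  have h1 : (cpart n p lam ^ (x - tau lam k : ℕ)) x = x0 :=
    Fin.ext ((cpart_pow_first hC hk hx).trans hx0.symm)
  have hzc : Commute z (cpart n p lam) := hz
  apply (cpart n p lam ^ (x - tau lam k : ℕ)).injective
  rw [h1, ← Perm.mul_apply, ← (hzc.pow_right _).eq, Perm.mul_apply, h1, h]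

lemma mem_closure_centGens (hmono : ∀ i j, i ≤ j → j < p → lam j ≤ lam i) (k : ℕ) (hk : k ≤ p)
    (z : Perm (Fin n)) (hz : z ∈ Subgroup.centralizer {cpart n p lam})
    (hfix : ∀ x : Fin n, (x : ℕ) < tau lam k → z x = x) :
    z ∈ Subgroup.closure (centGens n p lam) := by
  induction hk using Nat.decreasingInduction generalizing z with
  | self =>
    have : z = 1 := by
      ext1 x
      exact hfix x (by rw [hC.tau_eq]; exact x.2)
    rw [this]
    exact one_mem _
  | of_succ k hk ih =>
    have ht := tau_succ lam k
    have hpk := hC.pos k hk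
    have hle := hC.tau_le (show k + 1 ≤ p from hk)
    let x0 : Fin n := ⟨tau lam k, by omega⟩
    have hx0 : InBlk lam k x0 := ⟨le_rfl, by change tau lam k < _; omega⟩
    have key : ∀ j, k ≤ j → ∀ z ∈ Subgroup.centralizer {cpart n p lam},
        (∀ x : Fin n, (x : ℕ) < tau lam k → z x = x) → j < p → InBlk lam j (z x0) →
          z ∈ Subgroup.closure (centGens n p lam) := by
      intro j hkj
      induction j, hkj using Nat.le_induction with
      | base =>
        intro z hz hfix _ hj
        have hg : gblock n lam k ∈ Subgroup.closure (centGens n p lam) :=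
          Subgroup.subset_closure (Or.inl ⟨k, hk, rfl⟩)
        have hy := hj.1
        have hy' := hj.2
        have h1 := cyc_pow_apply (n := n) (τ := tau lam k) (l := lam k) (by omega) (z x0)
          (by omega) ((z x0 : ℕ) - tau lam k) (by omega)
        have hz' := mul_mem (pow_mem (gblock_mem_centralizer hC hk) ((z x0 : ℕ) - tau lam k)) hz
        have hfix0 : (gblock n lam k ^ ((z x0 : ℕ) - tau lam k) * z) x0 = x0 := by
          ext
          rw [Perm.mul_apply]
          change ((cyc n (tau lam k) (lam k) ^ ((z x0 : ℕ) - tau lam k)) (z x0) : ℕ) = tau lam k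
          omega
        have h2 := ih _ hz' fun x hx => by
          rcases lt_or_ge (x : ℕ) (tau lam k) with hlt | hge
          · rw [Perm.mul_apply, hfix x hlt]
            exact Perm.pow_apply_eq_self_of_apply_eq_self
              (gblock_apply_eq_self hC hk fun h => by have := h.1; omega) _
          · exact apply_eq_of_fix_first hC (Subgroup.mem_centralizer_singleton_iff.1 hz') hk
              ⟨hge, hx⟩ (x0 := x0) rfl hfix0
        exact (Subgroup.mul_mem_cancel_left _ (pow_mem hg _)).1 h2
      | succ j hkj ihj =>
        intro z hz hfix hj hzj
        have hzc : Commute z (cpart n p lam) := Subgroup.mem_centralizer_singleton_iff.1 hz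
        have h1 : lam (j + 1) ≤ lam k := hmono _ _ (by omega) hj
        have h2 : lam k ≤ lam (j + 1) := by
          refine le_of_cpart_pow_apply_eq hC hk hx0 (hC.pos _ hj) (z.injective ?_)
          rw [← Perm.mul_apply, (hzc.pow_right _).eq, Perm.mul_apply, cpart_pow_block hC hj hzj]
        have h3 : lam j ≤ lam k := hmono _ _ hkj (by omega)
        have h4 : lam (j + 1) ≤ lam j := hmono _ _ (by omega) hj
        have hl : lam j = lam (j + 1) := by omega
        have hr : rgen n lam j ∈ Subgroup.closure (centGens n p lam) :=
          Subgroup.subset_closure (Or.inr ⟨j, hj, hl, rfl⟩)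
        have hn := hC.tau_le (show j + 2 ≤ p from hj)
        have t1 := tau_succ lam j
        have t2 : tau lam (j + 2) = tau lam (j + 1) + lam (j + 1) := tau_succ lam (j + 1)
        have t3 := tau_mono lam hkj
        refine (Subgroup.mul_mem_cancel_left _ hr).1
          (ihj _ (mul_mem (rgen_mem_centralizer hC hj hl) hz) ?_ (by omega) ?_)
        · intro x hx
          rw [Perm.mul_apply, hfix x hx]
          refine rgen_apply_of_not_inBlk hl hn (fun h => ?_) (fun h => ?_)
          · have := h.1; omega
          · have := h.1; omega
        · have r1 := rgen_apply hl hn (z x0)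
          have h5 := hzj.1
          have h6 : (z x0 : ℕ) < tau lam (j + 2) := hzj.2
          rw [if_neg (by omega), if_pos ⟨h5, h6⟩] at r1
          rw [Perm.mul_apply]
          constructor <;> omega
    obtain ⟨j, hj, hzj⟩ := exists_inBlk hC (z x0)
    refine key j ?_ z hz hfix hj hzj
    by_contra! hlt
    have h1 := tau_mono lam (show j + 1 ≤ k from hlt)
    have h2 := hzj.2
    have h3 := z.injective (hfix (z x0) (by omega))
    rw [h3] at h2
    change tau lam k < _ at h2
    omega

lemma centralizer_le_closure (hmono : ∀ i j, i ≤ j → j < p → lam j ≤ lam i) :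
    Subgroup.centralizer {cpart n p lam} ≤ Subgroup.closure (centGens n p lam) := fun z hz =>
  mem_closure_centGens hC hmono 0 (Nat.zero_le p) z hz fun x hx => by simp [tau] at hx

end

section

variable {p : ℕ} {lam : ℕ → ℕ} (hC : IsComp n p lam)

/-- The index of the block containing a point. -/
def blk (hC : IsComp n p lam) (x : Fin n) : Fin p :=
  ⟨(exists_inBlk hC x).choose, (exists_inBlk hC x).choose_spec.1⟩

lemma inBlk_blk (x : Fin n) : InBlk lam (blk hC x) x := (exists_inBlk hC x).choose_spec.2

lemma blk_eq_iff {x : Fin n} {j : Fin p} : blk hC x = j ↔ InBlk lam j x :=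
  ⟨fun h => h ▸ inBlk_blk hC x, fun h => Fin.ext ((inBlk_blk hC x).unique h)⟩

lemma blk_monotone : Monotone (blk hC) := by
  intro x y hxy
  by_contra! h
  have h1 := inBlk_blk hC x
  have h2 := inBlk_blk hC y
  have h3 := tau_mono lam (show (blk hC y : ℕ) + 1 ≤ blk hC x from h)
  have h4 : (x : ℕ) ≤ y := hxy
  have := h1.1
  have := h2.2
  omega

lemma blk_isBlock : IsBlock (blk hC) fun j : Fin p => lam j := by
  refine ⟨blk_monotone hC, fun l => ?_⟩
  have h : (univ.filter fun x => blk hC x = l).map Fin.valEmbedding =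
      Ico (tau lam l) (tau lam (l + 1)) := by
    ext m
    simp only [Finset.mem_map, mem_filter, mem_univ, true_and, blk_eq_iff, Finset.mem_Ico,
      Fin.valEmbedding_apply]
    constructor
    · rintro ⟨x, hx, rfl⟩
      exact hx
    · intro hm
      have := hC.tau_le (show (l : ℕ) + 1 ≤ p from l.2)
      exact ⟨⟨m, by omega⟩, hm, rfl⟩
  have h2 := congrArg card h
  rw [card_map, Nat.card_Ico, tau_succ] at h2
  rw [h2]
  omega

lemma typc_eq_typ_blk : typc n p lam = typ (blk hC) := (blk_isBlock hC).typd_eq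

lemma sameCycle_cpart_iff {x y : Fin n} :
    (cpart n p lam).SameCycle x y ↔ blk hC x = blk hC y := by
  have key : ∀ x (k : ℕ), blk hC ((cpart n p lam ^ k) x) = blk hC x := fun x k =>
    (blk_eq_iff hC).2 (inBlk_cpart_pow hC (blk hC x).2 (inBlk_blk hC x) k)
  constructor
  · intro h
    obtain ⟨k, -, rfl⟩ := h.exists_pow_eq'
    exact (key x k).symm
  · intro h
    have hx := inBlk_blk hC x
    have hy := inBlk_blk hC y
    rw [← h] at hy
    have h1 := cpart_pow_first hC (blk hC x).2 hx
    have h2 := cpart_pow_first hC (blk hC x).2 hy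
    have h3 := Fin.ext (h1.trans h2.symm)
    have s1 : (cpart n p lam).SameCycle x _ :=
      ⟨((x - tau lam (blk hC x) : ℕ) : ℤ), rfl⟩
    have s2 : (cpart n p lam).SameCycle y _ :=
      ⟨((y - tau lam (blk hC x) : ℕ) : ℤ), rfl⟩
    rw [zpow_natCast] at s1 s2
    rw [h3] at s1
    exact s1.trans s2.symm

/-- Conjugate elements `c_λ` belong to the same shape. -/
lemma shapeEq_of_isConj {q : ℕ} {mu : ℕ → ℕ} (hC : IsComp n p lam) (hD : IsComp n q mu)
    (h : IsConj (cpart n p lam) (cpart n q mu)) : ShapeEq n (typc n p lam) (typc n q mu) := by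
  obtain ⟨w, hw⟩ := isConj_iff.1 h
  rw [typc_eq_typ_blk hC, typc_eq_typ_blk hD, shapeEq_typ_iff (blk_monotone hC) (blk_monotone hD)]
  refine ⟨w, fun x y => ?_⟩
  rw [← sameCycle_cpart_iff, ← sameCycle_cpart_iff, ← hw, Perm.sameCycle_conj,
    ← Perm.mul_apply, ← Perm.mul_apply, inv_mul_cancel, Perm.one_apply, Perm.one_apply]

/-- The set `I_λ` obtained by deleting the reflections at the partial sums. -/
lemma simples_sdiff_eq_typc (hC : IsComp n p lam) :
    Simples n \ (Icc 1 (p - 1)).image (fun i => sgen n (tau lam i)) = typc n p lam := by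
  rw [typc_eq_typ_blk hC]
  refine finset_ext_sgen sdiff_subset (typ_subset _) fun i hi => ?_
  rw [sgen_mem_typ hi, mem_sdiff, and_iff_right (sgen_mem_Simples hi), mem_image]
  set a : Fin n := ⟨i, by omega⟩
  set b : Fin n := ⟨i + 1, hi⟩
  have ha := inBlk_blk hC a
  have hb := inBlk_blk hC b
  have ha1 : tau lam (blk hC a) ≤ i := ha.1
  have ha2 : i < tau lam (blk hC a + 1) := ha.2
  have hb1 : tau lam (blk hC b) ≤ i + 1 := hb.1
  have hb2 : i + 1 < tau lam (blk hC b + 1) := hb.2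
  constructor
  · intro H
    by_contra hne
    have hlt : blk hC a < blk hC b :=
      lt_of_le_of_ne (blk_monotone hC (show a ≤ b from Fin.mk_le_mk.2 (Nat.le_succ i))) hne
    have hlt' : (blk hC a : ℕ) + 1 ≤ blk hC b := hlt
    have := tau_mono lam hlt'
    refine H ⟨blk hC b, ?_, ?_⟩
    · have := (blk hC b).2
      rw [Finset.mem_Icc]
      omega
    · congr 1
      omega
  · rintro hab ⟨j, hj, hji⟩
    rw [Finset.mem_Icc] at hj
    have hj0 : 0 < tau lam j := by
      have h1 := tau_mono lam hj.1
      have h2 := tau_succ lam 0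
      have h3 := hC.pos 0 (by omega)
      rw [zero_add] at h2
      omega
    have hjn : tau lam j < n := by
      have h1 := hC.tau_le (show j + 1 ≤ p by omega)
      have h2 := tau_succ lam j
      have h3 := hC.pos j (by omega)
      omega
    obtain ⟨t, ht⟩ : ∃ t, tau lam j = t + 1 := ⟨tau lam j - 1, by omega⟩
    rw [ht] at hji hjn
    have hti := sgen_succ_injective hjn hi hji
    rw [← hab] at hb2
    rcases lt_or_ge (blk hC a : ℕ) j with h | h
    · have := tau_mono lam (show (blk hC a : ℕ) + 1 ≤ j from h)
      omega
    · have := tau_mono lam h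
      omega

end

/-- Every shape contains the standard parabolic subset of a partition. -/
lemma exists_partition_shapeEq {J : Finset (Perm (Fin n))} (hJ : J ⊆ Simples n) :
    ∃ (p : ℕ) (lam : ℕ → ℕ), IsComp n p lam ∧ (∀ i j, i ≤ j → j < p → lam j ≤ lam i) ∧
      ShapeEq n J (typc n p lam) := by
  let K : Finset (Fin n) := univ.image (colour J)
  let f : Fin K.card ≃o K := K.orderIsoOfFin rfl
  let b : Fin n → Fin K.card := fun x => f.symm ⟨colour J x, mem_image_of_mem _ (mem_univ x)⟩
  have hbm : Monotone b := fun x y hxy => f.symm.monotone (colour_monotone J hxy)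
  let d : Fin K.card → ℕ := fun l => (univ.filter fun x => b x = l).card
  have hb : IsBlock b d := ⟨hbm, fun l => rfl⟩
  have hd : ∑ l, d l = n := by
    rw [← card_eq_sum_card_fiberwise (f := b) (s := univ) (t := univ) (fun _ _ => mem_coe.2 (mem_univ _)),
      card_univ, Fintype.card_fin]
  have hbs : Function.Surjective b := fun l => by
    obtain ⟨x, -, hx⟩ := mem_image.1 (f l).2
    refine ⟨x, ?_⟩
    rw [← f.symm_apply_apply l]
    exact congrArg f.symm (Subtype.ext hx)
  have hpos : ∀ l, 0 < d l := fun l => by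
    obtain ⟨x, hx⟩ := hbs l
    exact card_pos.2 ⟨x, by simp [hx]⟩
  have hJ' : typd n d = J := by
    rw [hb.typd_eq, ← typ_colour hJ]
    refine finset_ext_sgen (typ_subset _) (typ_subset _) fun i hi => ?_
    rw [sgen_mem_typ hi, sgen_mem_typ hi]
    simp only [b, f.symm.injective.eq_iff, Subtype.mk.injEq]
  let π : Perm (Fin K.card) := Tuple.sort (OrderDual.toDual ∘ d)
  have hπ : Antitone (d ∘ π) := Tuple.monotone_sort (OrderDual.toDual ∘ d)
  let lam : ℕ → ℕ := fun i => if h : i < K.card then (d ∘ π) ⟨i, h⟩ else 0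
  have hlam : (fun j : Fin K.card => lam j) = d ∘ π := funext fun j => dif_pos j.2
  refine ⟨K.card, lam, ⟨fun i hi => ?_, ?_⟩, fun i j hij hj => ?_, ?_⟩
  · simp only [lam, dif_pos hi]
    exact hpos _
  · rw [sum_range, hlam]
    exact (Equiv.sum_comp π d).trans hd
  · simp only [lam, dif_pos hj, dif_pos (hij.trans_lt hj)]
    exact hπ (Fin.mk_le_mk.2 hij)
  · rw [typc, hlam, ← hJ']
    exact shapeEq_typd_comp_perm hd π

section

variable {G : Type*} [Group G] [Finite G]

lemma finrank_range_mulLeft_le_index {x : MonoidAlgebra ℂ G} {Z : Subgroup G}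
    (h : ∀ z ∈ Z, ∃ s : ℂ, x * of ℂ G z = s • x) :
    Module.finrank ℂ (LinearMap.range (LinearMap.mulLeft ℂ x)) ≤ Z.index := by
  have := Fintype.ofFinite (G ⧸ Z)
  let q : G ⧸ Z → MonoidAlgebra ℂ G := fun c => x * of ℂ G c.out⁻¹
  have hle : LinearMap.range (LinearMap.mulLeft ℂ x) ≤ Submodule.span ℂ (Set.range q) := by
    rintro _ ⟨y, rfl⟩
    rw [LinearMap.mulLeft_apply]
    induction y using MonoidAlgebra.induction_on with
    | of g =>
      let z : G := g * ((g⁻¹ : G) : G ⧸ Z).out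
      have hz : z ∈ Z := by
        have h1 : ((g⁻¹ : G) : G ⧸ Z) = (((g⁻¹ : G) : G ⧸ Z).out : G ⧸ Z) :=
          (QuotientGroup.out_eq' _).symm
        have h2 := QuotientGroup.eq.1 h1
        rwa [inv_inv] at h2
      obtain ⟨s, hs⟩ := h z hz
      have h3 : x * of ℂ G g = s • q (g⁻¹ : G) := by
        rw [← smul_mul_assoc, ← hs, mul_assoc, ← map_mul]
        simp [z]
      rw [h3]
      exact Submodule.smul_mem _ _ (Submodule.subset_span ⟨_, rfl⟩)
    | add f g hf hg => rw [mul_add]; exact add_mem hf hg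
    | smul r f hf => rw [mul_smul_comm]; exact Submodule.smul_mem _ _ hf
  have : FiniteDimensional ℂ (Submodule.span ℂ (Set.range q)) :=
    FiniteDimensional.span_of_finite ℂ (Set.finite_range q)
  refine (Submodule.finrank_mono hle).trans ((finrank_range_le_card q).trans ?_)
  rw [Subgroup.index, Nat.card_eq_fintype_card]

lemma index_centralizer (g : G) :
    (Subgroup.centralizer {g}).index = (ConjClasses.mk g).carrier.ncard := by
  rw [← ConjAct.orbit_eq_carrier_conjClasses, ← MulAction.index_stabilizer]
  have h1 := (Subgroup.centralizer {g}).index_mul_card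
  have h2 := (MulAction.stabilizer (ConjAct G) g).index_mul_card
  rw [Subgroup.nat_card_centralizer_nat_card_stabilizer] at h1
  have : Finite (ConjAct G) := inferInstanceAs (Finite G)
  have h3 : Nat.card (ConjAct G) = Nat.card G := rfl
  rw [h3] at h2
  exact Nat.eq_of_mul_eq_mul_right Nat.card_pos (h1.trans h2.symm)

end

lemma finrank_biSup_le {ι K V : Type*} [Field K] [AddCommGroup V] [Module K V]
    [FiniteDimensional K V] (s : Finset ι) (t : ι → Submodule K V) :
    Module.finrank K (⨆ i ∈ s, t i : Submodule K V) ≤ ∑ i ∈ s, Module.finrank K (t i) := by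
  induction s using Finset.induction_on with
  | empty => simp
  | insert a s ha ih =>
    rw [Finset.iSup_insert, sum_insert ha]
    exact (Submodule.finrank_add_le_finrank_add_finrank _ _).trans (Nat.add_le_add_left ih _)

section

variable {A ι : Type*} [Ring A] [Algebra ℂ A] {s : Finset ι} {E : ι → A}

lemma biSup_range_mulLeft_eq_top (h : ∑ i ∈ s, E i = 1) :
    ⨆ i ∈ s, LinearMap.range (LinearMap.mulLeft ℂ (E i)) = ⊤ := by
  refine eq_top_iff.2 fun x _ => ?_
  rw [← one_mul x, ← h, sum_mul]
  exact Submodule.sum_mem _ fun i hi => Submodule.mem_iSup_of_mem i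
    (Submodule.mem_iSup_of_mem hi ⟨x, rfl⟩)

lemma iSupIndep_range_mulLeft (h : ∑ i ∈ s, E i = 1)
    (ho : ∀ i ∈ s, ∀ j ∈ s, i ≠ j → E i * E j = 0) :
    iSupIndep fun i : s => LinearMap.range (LinearMap.mulLeft ℂ (E i)) := by
  intro i
  have hid : E i * E i = E i := by
    conv_rhs => rw [← mul_one (E i), ← h, mul_sum]
    rw [sum_eq_single (i : ι) (fun j hj hji => ho i i.2 j hj hji.symm) fun hi => absurd i.2 hi]
  rw [Submodule.disjoint_def]
  rintro _ ⟨y, rfl⟩ hx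
  have hle : ⨆ j, ⨆ (_ : j ≠ i), LinearMap.range (LinearMap.mulLeft ℂ (E j)) ≤
      LinearMap.ker (LinearMap.mulLeft ℂ (E i)) := by
    refine iSup₂_le fun j hj => ?_
    rintro _ ⟨z, rfl⟩
    rw [LinearMap.mem_ker, LinearMap.mulLeft_apply, LinearMap.mulLeft_apply, ← mul_assoc,
      ho i i.2 j j.2 fun h => hj (Subtype.ext h.symm), zero_mul]
  have := hle hx
  rwa [LinearMap.mem_ker, LinearMap.mulLeft_apply, LinearMap.mulLeft_apply, ← mul_assoc,
    hid] at this

end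

lemma shapeClass_eq_iff {I J : Finset (Perm (Fin n))} (hJ : J ⊆ Simples n) :
    shapeClass I = shapeClass J ↔ ShapeEq n I J := by
  constructor
  · intro h
    have : J ∈ shapeClass J := mem_shapeClass.2 ⟨hJ, shapeEq_refl J⟩
    rw [← h] at this
    exact (mem_shapeClass.1 this).2
  · intro h
    ext K
    rw [mem_shapeClass, mem_shapeClass]
    exact and_congr_right fun _ => ⟨shapeEq_trans (shapeEq_symm h), shapeEq_trans h⟩

/-- A family of classes of subsets of `S` is the partition into shapes. -/
structure IsShapePartition (P : Finset (Finset (Finset (Perm (Fin n))))) : Prop where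
  exists_unique : ∀ I ∈ (Simples n).powerset, ∃! cl, cl ∈ P ∧ I ∈ cl
  subset : ∀ cl ∈ P, ∀ I ∈ cl, I ⊆ Simples n
  shapeEq_iff : ∀ cl ∈ P, ∀ I ∈ cl, ∀ J, J ⊆ Simples n → (ShapeEq n I J ↔ J ∈ cl)

lemma isShapePartition_image :
    IsShapePartition ((Simples n).powerset.image (shapeClass (n := n))) := by
  refine ⟨fun I hI => ?_, fun cl hcl I hI => ?_, fun cl hcl I hI J hJ => ?_⟩
  · have hI' := mem_powerset.1 hI
    refine ⟨shapeClass I, ⟨mem_image_of_mem _ hI, mem_shapeClass.2 ⟨hI', shapeEq_refl I⟩⟩, ?_⟩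
    rintro _ ⟨h, hIc⟩
    obtain ⟨J, -, rfl⟩ := mem_image.1 h
    exact (shapeClass_eq_iff hI').2 (mem_shapeClass.1 hIc).2
  · obtain ⟨K, -, rfl⟩ := mem_image.1 hcl
    exact (mem_shapeClass.1 hI).1
  · obtain ⟨K, -, rfl⟩ := mem_image.1 hcl
    have hKI := (mem_shapeClass.1 hI).2
    rw [mem_shapeClass, and_iff_right hJ]
    exact ⟨shapeEq_trans hKI, shapeEq_trans (shapeEq_symm hKI)⟩

section

variable {P : Finset (Finset (Finset (Perm (Fin n))))}
  {e : Finset (Perm (Fin n)) → MonoidAlgebra ℂ (Perm (Fin n))}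

lemma IsShapePartition.eq_shapeClass (hP : IsShapePartition P) {cl : Finset (Finset (Perm (Fin n)))}
    (hcl : cl ∈ P) {I : Finset (Perm (Fin n))} (hI : I ∈ cl) : cl = shapeClass I := by
  ext J
  rw [mem_shapeClass]
  exact ⟨fun h => ⟨hP.subset cl hcl J h, (hP.shapeEq_iff cl hcl I hI J (hP.subset cl hcl J h)).2 h⟩,
    fun h => (hP.shapeEq_iff cl hcl I hI J h.1).1 h.2⟩

lemma IsShapePartition.sum_eq_one (hP : IsShapePartition P)
    (he : IsBBHT n Set.univ (Simples n) e) : ∑ cl ∈ P, ∑ I ∈ cl, e I = 1 := by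
  have hun : P.biUnion id = (Simples n).powerset := by
    ext I
    rw [mem_biUnion]
    constructor
    · rintro ⟨cl, hcl, hI⟩
      exact mem_powerset.2 (hP.subset cl hcl I hI)
    · intro hI
      obtain ⟨cl, ⟨hcl, hIc⟩, -⟩ := hP.exists_unique I hI
      exact ⟨cl, hcl, hIc⟩
  rw [← sum_e_eq_one he, ← hun, sum_biUnion]
  · rfl
  · intro c hc c' hc' hne
    refine Finset.disjoint_left.2 fun I hI hI' => hne ?_
    exact (hP.exists_unique I (mem_powerset.2 (hP.subset c hc I hI))).unique ⟨hc, hI⟩ ⟨hc', hI'⟩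

lemma IsShapePartition.mul_eq_zero (hP : IsShapePartition P)
    (he : IsBBHT n Set.univ (Simples n) e) {c c' : Finset (Finset (Perm (Fin n)))} (hc : c ∈ P)
    (hc' : c' ∈ P) (hne : c ≠ c') : (∑ I ∈ c, e I) * (∑ I ∈ c', e I) = 0 := by
  rcases c.eq_empty_or_nonempty with rfl | ⟨I, hI⟩
  · rw [sum_empty, zero_mul]
  rcases c'.eq_empty_or_nonempty with rfl | ⟨J, hJ⟩
  · rw [sum_empty, mul_zero]
  have h1 := hP.eq_shapeClass hc hI
  have h2 := hP.eq_shapeClass hc' hJ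
  have hs : ¬ ShapeEq n I J := fun h => hne <| by
    rw [h1, h2]
    exact (shapeClass_eq_iff (hP.subset c' hc' J hJ)).2 h
  have := eShape_mul_of_not_shapeEq he hs
  rwa [eShape, eShape, ← h1, ← h2] at this

end

lemma sum_ncard_carrier_le {G ι : Type*} [Group G] [Finite G] {s : Finset ι} {g : ι → G}
    (h : Set.InjOn (fun i => ConjClasses.mk (g i)) s) :
    ∑ i ∈ s, (ConjClasses.mk (g i)).carrier.ncard ≤ Nat.card G := by
  have := Fintype.ofFinite (ConjClasses G)
  rw [← Group.sum_card_conj_classes_eq_card G, finsum_eq_sum_of_fintype,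
    ← sum_image (f := fun c : ConjClasses G => c.carrier.ncard) h]
  exact sum_le_sum_of_subset (subset_univ _)

section

variable {p : ℕ} {lam : ℕ → ℕ} {e : Finset (Perm (Fin n)) → MonoidAlgebra ℂ (Perm (Fin n))}

lemma exists_shapeGen_mul_eq_smul (he : IsBBHT n Set.univ (Simples n) e) (hC : IsComp n p lam)
    (hmono : ∀ i j, i ≤ j → j < p → lam j ≤ lam i) {z : Perm (Fin n)}
    (hz : z ∈ Subgroup.centralizer {cpart n p lam}) :
    ∃ s : ℂ, s ≠ 0 ∧ shapeGen e p lam * of ℂ _ z = s • shapeGen e p lam := by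
  replace hz := centralizer_le_closure hC hmono hz
  induction hz using Subgroup.closure_induction with
  | mem x hx =>
    rcases hx with ⟨i, hi, rfl⟩ | ⟨i, hi, hl, rfl⟩
    · exact ⟨_, inv_ne_zero (zeta_ne_zero _), shapeGen_mul_gblock he hC hi⟩
    · exact ⟨1, one_ne_zero, by rw [shapeGen_mul_rgen he hC hi hl, one_smul]⟩
  | one => exact ⟨1, one_ne_zero, by rw [map_one, mul_one, one_smul]⟩
  | mul x y _ _ hx hy =>
    obtain ⟨s, hs, h1⟩ := hx
    obtain ⟨t, ht, h2⟩ := hy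
    exact ⟨s * t, mul_ne_zero hs ht, by
      rw [map_mul, ← mul_assoc, h1, smul_mul_assoc, h2, smul_smul]⟩
  | inv x _ hx =>
    obtain ⟨s, hs, h1⟩ := hx
    refine ⟨s⁻¹, inv_ne_zero hs, ?_⟩
    rw [eq_inv_smul_iff₀ hs, ← smul_mul_assoc, ← h1, mul_assoc, ← map_mul, mul_inv_cancel, map_one,
      mul_one]

lemma finrank_eShape_le (he : IsBBHT n Set.univ (Simples n) e) (hC : IsComp n p lam)
    (hmono : ∀ i j, i ≤ j → j < p → lam j ≤ lam i) :
    Module.finrank ℂ (LinearMap.range (LinearMap.mulLeft ℂ (eShape e (typc n p lam)))) ≤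
      (Subgroup.centralizer {cpart n p lam}).index := by
  obtain ⟨v, hv⟩ := exists_shapeGen_mul he hC
  have hle : LinearMap.range (LinearMap.mulLeft ℂ (eShape e (typc n p lam))) ≤
      LinearMap.range (LinearMap.mulLeft ℂ (shapeGen e p lam)) := by
    rintro _ ⟨x, rfl⟩
    exact ⟨v * x, by rw [LinearMap.mulLeft_apply, LinearMap.mulLeft_apply, ← hv, mul_assoc]⟩
  refine (Submodule.finrank_mono hle).trans (finrank_range_mulLeft_le_index fun z hz => ?_)
  obtain ⟨s, -, hs⟩ := exists_shapeGen_mul_eq_smul he hC hmono hz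
  exact ⟨s, hs⟩

/-- The right ideal of a shape has the dimension of the corresponding conjugacy class. -/
lemma finrank_eShape (he : IsBBHT n Set.univ (Simples n) e) (hC : IsComp n p lam)
    (hmono : ∀ i j, i ≤ j → j < p → lam j ≤ lam i) :
    Module.finrank ℂ (LinearMap.range (LinearMap.mulLeft ℂ (eShape e (typc n p lam)))) =
      (Subgroup.centralizer {cpart n p lam}).index := by
  have hP := isShapePartition_image (n := n)
  set P := (Simples n).powerset.image (shapeClass (n := n)) with hPdef
  have hex : ∀ cl ∈ P, ∃ g : Perm (Fin n), (cl = shapeClass (typc n p lam) → g = cpart n p lam) ∧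
      ∃ q mu, IsComp n q mu ∧ (∀ i j, i ≤ j → j < q → mu j ≤ mu i) ∧ g = cpart n q mu ∧
        cl = shapeClass (typc n q mu) := by
    intro cl hcl
    by_cases h : cl = shapeClass (typc n p lam)
    · exact ⟨_, fun _ => rfl, p, lam, hC, hmono, rfl, h⟩
    · obtain ⟨J, hJ, rfl⟩ := mem_image.1 hcl
      obtain ⟨q, mu, hD, hm, hs⟩ := exists_partition_shapeEq (mem_powerset.1 hJ)
      exact ⟨_, fun h' => absurd h' h, q, mu, hD, hm, rfl,
        (shapeClass_eq_iff (typd_subset _)).2 hs⟩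
  choose! g hg1 hg2 using hex
  let D : Finset (Finset (Perm (Fin n))) → ℕ := fun cl =>
    Module.finrank ℂ (LinearMap.range (LinearMap.mulLeft ℂ (∑ I ∈ cl, e I)))
  let K : Finset (Finset (Perm (Fin n))) → ℕ := fun cl => (ConjClasses.mk (g cl)).carrier.ncard
  have hDK : ∀ cl ∈ P, D cl ≤ K cl := by
    intro cl hcl
    obtain ⟨q, mu, hE, hm, h1, h2⟩ := hg2 cl hcl
    have := finrank_eShape_le he hE hm
    rw [index_centralizer, ← h1, eShape, ← h2] at this
    exact this
  have hinj : Set.InjOn (fun cl => ConjClasses.mk (g cl)) P := by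
    intro cl hcl cl' hcl' h
    obtain ⟨q, mu, hE, -, h1, h2⟩ := hg2 cl hcl
    obtain ⟨q', mu', hE', -, h1', h2'⟩ := hg2 cl' hcl'
    have hc : IsConj (g cl) (g cl') := ConjClasses.mk_eq_mk_iff_isConj.1 h
    rw [h1, h1'] at hc
    rw [h2, h2']
    exact (shapeClass_eq_iff (typd_subset _)).2 (shapeEq_of_isConj hE hE' hc)
  have hD : Nat.card (Perm (Fin n)) ≤ ∑ cl ∈ P, D cl := by
    have h1 := finrank_biSup_le P fun cl => LinearMap.range (LinearMap.mulLeft ℂ (∑ I ∈ cl, e I))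
    rw [biSup_range_mulLeft_eq_top (hP.sum_eq_one he), finrank_top] at h1
    refine le_trans (le_of_eq ?_) h1
    rw [Nat.card_eq_fintype_card]
    exact ((MonoidAlgebra.coeffLinearEquiv ℂ).finrank_eq.trans (Module.finrank_finsupp_self ℂ)).symm
  have hK : ∑ cl ∈ P, K cl ≤ Nat.card (Perm (Fin n)) := sum_ncard_carrier_le hinj
  have hsum : ∑ cl ∈ P, D cl = ∑ cl ∈ P, K cl :=
    le_antisymm (sum_le_sum hDK) (hK.trans hD)
  have hmem : shapeClass (typc n p lam) ∈ P :=
    mem_image_of_mem _ (mem_powerset.2 (typd_subset _))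
  have := (sum_eq_sum_iff_of_le hDK).1 hsum _ hmem
  rw [index_centralizer, ← hg1 _ hmem rfl]
  exact this

variable {φ : Perm (Fin n) → ℂ}

lemma shapeGen_mul_of_mem_centralizer (he : IsBBHT n Set.univ (Simples n) e)
    (hC : IsComp n p lam) (hmono : ∀ i j, i ≤ j → j < p → lam j ≤ lam i)
    (hmul : ∀ x ∈ Subgroup.centralizer {cpart n p lam},
      ∀ y ∈ Subgroup.centralizer {cpart n p lam}, φ (x * y) = φ x * φ y)
    (h1 : φ 1 = 1) (hg : ∀ i < p, φ (gblock n lam i) = (zeta (lam i))⁻¹)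
    (hr : ∀ i, i + 1 < p → lam i = lam (i + 1) → φ (rgen n lam i) = 1) {z : Perm (Fin n)}
    (hz : z ∈ Subgroup.centralizer {cpart n p lam}) :
    shapeGen e p lam * of ℂ _ z = φ z • shapeGen e p lam := by
  suffices h : z ∈ Subgroup.centralizer {cpart n p lam} ∧
      shapeGen e p lam * of ℂ _ z = φ z • shapeGen e p lam from h.2
  replace hz := centralizer_le_closure hC hmono hz
  induction hz using Subgroup.closure_induction with
  | mem x hx =>
    rcases hx with ⟨i, hi, rfl⟩ | ⟨i, hi, hl, rfl⟩
    · exact ⟨gblock_mem_centralizer hC hi, by rw [shapeGen_mul_gblock he hC hi, hg i hi]⟩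
    · exact ⟨rgen_mem_centralizer hC hi hl, by
        rw [shapeGen_mul_rgen he hC hi hl, hr i hi hl, one_smul]⟩
  | one => exact ⟨one_mem _, by rw [map_one, mul_one, h1, one_smul]⟩
  | mul x y _ _ hx hy =>
    refine ⟨mul_mem hx.1 hy.1, ?_⟩
    rw [map_mul, ← mul_assoc, hx.2, smul_mul_assoc, hy.2, smul_smul, hmul x hx.1 y hy.1]
  | inv x _ hx =>
    have h2 := hmul x hx.1 x⁻¹ (inv_mem hx.1)
    rw [mul_inv_cancel, h1] at h2
    have h3 : φ x ≠ 0 := left_ne_zero_of_mul_eq_one h2.symm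
    refine ⟨inv_mem hx.1, ?_⟩
    rw [eq_inv_of_mul_eq_one_right h2.symm, eq_inv_smul_iff₀ h3, ← smul_mul_assoc, ← hx.2,
      mul_assoc, ← map_mul, mul_inv_cancel, map_one, mul_one]

end

section

variable {G : Type*} [Group G] [Fintype G] (Z : Subgroup G) (φ : G → ℂ)

/-- The primitive idempotent of `ℂZ` belonging to the linear character `φ` of `Z`. -/
def charIdem : MonoidAlgebra ℂ G :=
  (((univ.filter fun z => z ∈ Z).card : ℂ))⁻¹ • ∑ z ∈ univ.filter (fun z => z ∈ Z), φ z • of ℂ G z⁻¹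

variable {Z φ}

lemma charIdem_mul_of (hmul : ∀ x ∈ Z, ∀ y ∈ Z, φ (x * y) = φ x * φ y) {w : G} (hw : w ∈ Z) :
    charIdem Z φ * of ℂ G w = φ w • charIdem Z φ := by
  rw [charIdem, smul_mul_assoc, smul_comm (φ w)]
  congr 1
  rw [sum_mul, smul_sum]
  refine sum_bij' (fun z _ => w⁻¹ * z) (fun z _ => w * z) ?_ ?_ ?_ ?_ ?_
  · intro z hz
    simp only [mem_filter, mem_univ, true_and] at hz ⊢
    exact mul_mem (inv_mem hw) hz
  · intro z hz
    simp only [mem_filter, mem_univ, true_and] at hz ⊢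
    exact mul_mem hw hz
  · intro z _
    exact mul_inv_cancel_left w z
  · intro z _
    exact inv_mul_cancel_left w z
  · intro z hz
    simp only [mem_filter, mem_univ, true_and] at hz
    rw [smul_mul_assoc, ← map_mul, smul_smul, ← hmul w hw _ (mul_mem (inv_mem hw) hz),
      mul_inv_cancel_left, mul_inv_rev, inv_inv]

lemma mul_charIdem (hmul : ∀ x ∈ Z, ∀ y ∈ Z, φ (x * y) = φ x * φ y) (h1 : φ 1 = 1)
    {u : MonoidAlgebra ℂ G} (hu : ∀ z ∈ Z, u * of ℂ G z = φ z • u) : u * charIdem Z φ = u := by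
  have h : ∀ z ∈ univ.filter (fun z => z ∈ Z), u * φ z • of ℂ G z⁻¹ = u := by
    intro z hz
    simp only [mem_filter, mem_univ, true_and] at hz
    rw [mul_smul_comm, hu _ (inv_mem hz), smul_smul, ← hmul z hz _ (inv_mem hz), mul_inv_cancel,
      h1, one_smul]
  rw [charIdem, mul_smul_comm, mul_sum, sum_congr rfl h, sum_const, ← Nat.cast_smul_eq_nsmul ℂ,
    smul_smul, inv_mul_cancel₀, one_smul]
  exact Nat.cast_ne_zero.2 (card_ne_zero_of_mem (a := 1) (by simp))

/-- Left multiplication by a `Z`-eigenvector generating the right ideal of an idempotent `E` of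
the right dimension identifies the module induced from `φ` with that right ideal. -/
lemma bijOn_mul_of_finrank_eq (hmul : ∀ x ∈ Z, ∀ y ∈ Z, φ (x * y) = φ x * φ y) (h1 : φ 1 = 1)
    {u v E : MonoidAlgebra ℂ G} (hu : ∀ z ∈ Z, u * of ℂ G z = φ z • u) (hEu : E * u = u)
    (huv : u * v = E)
    (hE : Module.finrank ℂ (LinearMap.range (LinearMap.mulLeft ℂ E)) = Z.index) :
    Set.BijOn (fun x => u * x) {y | ∃ x, y = charIdem Z φ * x} {y | ∃ x, y = E * x} := by
  have hf := mul_charIdem hmul h1 hu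
  refine ⟨?_, ?_, ?_⟩
  · rintro _ ⟨x, rfl⟩
    refine ⟨u * x, ?_⟩
    change u * (charIdem Z φ * x) = E * (u * x)
    rw [← mul_assoc, ← mul_assoc, hf, hEu]
  · let R := LinearMap.range (LinearMap.mulLeft ℂ (charIdem Z φ))
    let L : R →ₗ[ℂ] MonoidAlgebra ℂ G := (LinearMap.mulLeft ℂ u).domRestrict R
    have hR : Module.finrank ℂ R ≤ Z.index :=
      finrank_range_mulLeft_le_index fun z hz => ⟨φ z, charIdem_mul_of hmul hz⟩
    have hL : Z.index ≤ Module.finrank ℂ (LinearMap.range L) := by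
      rw [← hE]
      refine Submodule.finrank_mono ?_
      rintro _ ⟨x, rfl⟩
      refine ⟨⟨charIdem Z φ * (v * x), ⟨v * x, rfl⟩⟩, ?_⟩
      change u * (charIdem Z φ * (v * x)) = E * x
      rw [← mul_assoc, hf, ← mul_assoc, huv]
    have hker := L.finrank_range_add_finrank_ker
    have h0 : Module.finrank ℂ (LinearMap.ker L) = 0 := by omega
    have hinj : Function.Injective L :=
      LinearMap.ker_eq_bot.1 (Submodule.finrank_eq_zero.1 h0)
    rintro _ ⟨x, rfl⟩ _ ⟨y, rfl⟩ hxy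
    have := @hinj ⟨charIdem Z φ * x, ⟨x, rfl⟩⟩ ⟨charIdem Z φ * y, ⟨y, rfl⟩⟩ hxy
    exact congrArg Subtype.val this
  · rintro _ ⟨x, rfl⟩
    refine ⟨charIdem Z φ * (v * x), ⟨v * x, rfl⟩, ?_⟩
    change u * (charIdem Z φ * (v * x)) = E * x
    rw [← mul_assoc, hf, ← mul_assoc, huv]

end

end

/-- Theorem 6.3(a) and its consequence: for each partition `λ` of `n`, the right
ideal `E_λ = e_λ ℂS_n` (where `e_λ = ∑_{I ∈ S_λ} e_I`) is isomorphic as right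
`ℂS_n`-module to `f̃_λ ℂS_n`, i.e. its character is
`Ind_{Z_{S_n}(c_λ)}^{S_n}(φ̃_λ)`; moreover the `e_λ` (summed over the shapes of
`S_n`) are pairwise orthogonal idempotents summing to `1`, so
`ℂS_n = ⨁_λ E_λ` decomposes as a direct sum of representations induced from
linear characters of centralizers, one for each conjugacy class. -/
theorem stmt18 (hn : 2 ≤ n) (p : ℕ) (hp : 0 < p) (lam : ℕ → ℕ)
    (hpos : ∀ i < p, 0 < lam i)
    (hmono : ∀ i j, i ≤ j → j < p → lam j ≤ lam i)
    (hsum : ∑ j ∈ Finset.range p, lam j = n)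
    (e : Finset (Equiv.Perm (Fin n)) → MonoidAlgebra ℂ (Equiv.Perm (Fin n)))
    (he : IsBBHT n Set.univ (Simples n) e)
    (φt : Equiv.Perm (Fin n) → ℂ)
    (hmul : ∀ x ∈ Subgroup.centralizer {cpart n p lam},
      ∀ y ∈ Subgroup.centralizer {cpart n p lam}, φt (x * y) = φt x * φt y)
    (h1 : φt 1 = 1)
    (hg : ∀ i < p, φt (gblock n lam i)
      = Complex.exp (-(2 * (Real.pi : ℂ) * Complex.I) / (lam i : ℂ)))
    (hNtriv : ∀ r ∈ Npart n p lam, φt r = 1) :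
    let Ilam : Finset (Equiv.Perm (Fin n)) :=
      Simples n \ (Finset.Icc 1 (p - 1)).image (fun i => sgen n (tau lam i))
    let Slam : Finset (Finset (Equiv.Perm (Fin n))) :=
      (Simples n).powerset.filter (fun J => ShapeEq n Ilam J)
    let elam : MonoidAlgebra ℂ (Equiv.Perm (Fin n)) := ∑ J ∈ Slam, e J
    let Z : Subgroup (Equiv.Perm (Fin n)) := Subgroup.centralizer {cpart n p lam}
    let Zfin : Finset (Equiv.Perm (Fin n)) := Finset.univ.filter (fun z => z ∈ Z)
    let ftilde : MonoidAlgebra ℂ (Equiv.Perm (Fin n)) :=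
      ((Zfin.card : ℂ))⁻¹ • ∑ z ∈ Zfin, φt z • of ℂ (Equiv.Perm (Fin n)) z⁻¹
    (∃ a : MonoidAlgebra ℂ (Equiv.Perm (Fin n)),
      Set.BijOn (fun x => a * x)
        {y | ∃ x : MonoidAlgebra ℂ (Equiv.Perm (Fin n)), y = ftilde * x}
        {y | ∃ x : MonoidAlgebra ℂ (Equiv.Perm (Fin n)), y = elam * x}) ∧
    (∀ P : Finset (Finset (Finset (Equiv.Perm (Fin n)))),
      (∀ I ∈ (Simples n).powerset, ∃! cl, cl ∈ P ∧ I ∈ cl) →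
      (∀ cl ∈ P, ∀ I ∈ cl, I ⊆ Simples n) →
      (∀ cl ∈ P, ∀ I ∈ cl, ∀ J, J ⊆ Simples n → (ShapeEq n I J ↔ J ∈ cl)) →
      (∑ cl ∈ P, ∑ I ∈ cl, e I) = 1 ∧
      (∀ cl1 ∈ P, ∀ cl2 ∈ P, cl1 ≠ cl2 →
        (∑ I ∈ cl1, e I) * (∑ I ∈ cl2, e I) = 0) ∧
      iSupIndep (fun cl : P =>
        LinearMap.range (LinearMap.mulLeft ℂ (∑ I ∈ (cl : Finset (Finset (Equiv.Perm (Fin n)))), e I))) ∧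
      (⨆ cl ∈ P, LinearMap.range (LinearMap.mulLeft ℂ (∑ I ∈ cl, e I))) = ⊤) := by
  intro Ilam Slam elam Z Zfin ftilde
  have hC : IsComp n p lam := ⟨hpos, hsum⟩
  have hElam : elam = eShape e (typc n p lam) := by
    have h : Ilam = typc n p lam := simples_sdiff_eq_typc hC
    change ∑ J ∈ (Simples n).powerset.filter (fun J => ShapeEq n Ilam J), e J = _
    rw [h]
    rfl
  refine ⟨?_, ?_⟩
  · obtain ⟨v, hv⟩ := exists_shapeGen_mul he hC
    refine ⟨shapeGen e p lam, ?_⟩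
    have hftilde : ftilde = charIdem Z φt := rfl
    rw [hElam, hftilde]
    exact bijOn_mul_of_finrank_eq hmul h1
      (fun z hz => shapeGen_mul_of_mem_centralizer he hC hmono hmul h1
        (fun i hi => (hg i hi).trans (inv_zeta _).symm)
        (fun i hi hl => hNtriv _ (Subgroup.subset_closure ⟨i, hi, hl, rfl⟩)) hz)
      (eShape_mul_shapeGen he) hv (finrank_eShape he hC hmono)
  · intro P hP1 hP2 hP3
    have hP : IsShapePartition P := ⟨hP1, hP2, hP3⟩
    have ho : ∀ cl1 ∈ P, ∀ cl2 ∈ P, cl1 ≠ cl2 → (∑ I ∈ cl1, e I) * (∑ I ∈ cl2, e I) = 0 :=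
      fun _ h _ h' hne => hP.mul_eq_zero he h h' hne
    have hsum1 := hP.sum_eq_one he
    have hindep := iSupIndep_range_mulLeft (E := fun cl => ∑ I ∈ cl, e I) hsum1 ho
    have htop := biSup_range_mulLeft_eq_top (E := fun cl => ∑ I ∈ cl, e I) hsum1
    exact ⟨hsum1, ho, hindep, htop⟩

end DPRSym
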